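/- Unassisted covert secrecy capacity (Theorem 3): Let P_{X→BW} be a classical-quantum covert communication channel with binary input satisfying supp(σ_1) ⊆ supp(σ_0) and supp(ω_1) ⊆ supp(ω_0). Then the covert secrecy capacity without key assistance is C_S(P) = [D(σ_1||σ_0) − D(ω_1||ω_0)]_+ / √( (1/2) χ²(ω_1||ω_0) ), where [t]_+ = max(0,t). -/

import Mathlib

open Matrix Filter
open scoped Kronecker Classical ComplexOrder

noncomputable section

namespace CovertPaper



variable {ι : Type*} [Fintype ι] [DecidableEq ι]

/-- `ρ` is a density matrix (state). -/
def IsDensity (ρ : Matrix ι ι ℂ) : Prop := ρ.PosSemidef ∧ ρ.trace = 1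

/-- `supp ρ ⊆ supp σ`, expressed (for Hermitian PSD matrices) as `ker σ ⊆ ker ρ`. -/
def SuppLE (ρ σ : Matrix ι ι ℂ) : Prop :=
  ∀ v : ι → ℂ, σ.mulVec v = 0 → ρ.mulVec v = 0

/-- Functional calculus on Hermitian matrices (junk value `0` otherwise). -/
def matFun (f : ℝ → ℝ) (A : Matrix ι ι ℂ) : Matrix ι ι ℂ :=
  if hA : A.IsHermitian then
    (hA.eigenvectorUnitary : Matrix ι ι ℂ) *
      diagonal (fun i => (f (hA.eigenvalues i) : ℂ)) *
      (star (hA.eigenvectorUnitary : Matrix ι ι ℂ))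
  else 0

/-- Matrix logarithm of a Hermitian matrix (`0` on the kernel, by `Real.log 0 = 0`). -/
def matLog (A : Matrix ι ι ℂ) : Matrix ι ι ℂ := matFun Real.log A

/-- Trace norm `‖A‖₁ = Tr √(AᴴA)`. -/
def traceNorm (A : Matrix ι ι ℂ) : ℝ := ((matFun Real.sqrt (Aᴴ * A)).trace).re

/-- Fidelity `F(ρ,σ) = ‖√ρ√σ‖₁²`. -/
def fidelity (ρ σ : Matrix ι ι ℂ) : ℝ :=
  (traceNorm (matFun Real.sqrt ρ * matFun Real.sqrt σ)) ^ 2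

/-- von Neumann entropy `H(ρ) = −Tr[ρ log ρ]` (natural logarithm). -/
def vnEnt (ρ : Matrix ι ι ℂ) : ℝ := -((ρ * matLog ρ).trace).re

/-- Quantum (Umegaki) relative entropy `D(ρ‖σ) = Tr[ρ (log ρ − log σ)]`; this real-valued
formula agrees with the usual definition whenever `supp ρ ⊆ supp σ`. -/
def relEnt (ρ σ : Matrix ι ι ℂ) : ℝ := ((ρ * (matLog ρ - matLog σ)).trace).re

/-- The quantum chi-square divergence
`χ²(ρ‖σ) = (∂²/∂α²) D(αρ + (1−α)σ ‖ σ) |_{α=0}`. -/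
def chiSq (ρ σ : Matrix ι ι ℂ) : ℝ :=
  iteratedDeriv 2 (fun α : ℝ => relEnt ((α : ℂ) • ρ + ((1 - α : ℝ) : ℂ) • σ) σ) 0

section PTrace

variable {α β : Type*} [Fintype α] [Fintype β]

/-- Partial trace over the second (right) tensor factor. -/
def ptraceRight (ρ : Matrix (α × β) (α × β) ℂ) : Matrix α α ℂ :=
  of fun a a' => ∑ b, ρ (a, b) (a', b)

/-- Partial trace over the first (left) tensor factor. -/
def ptraceLeft (ρ : Matrix (α × β) (α × β) ℂ) : Matrix β β ℂ :=
  of fun b b' => ∑ a, ρ (a, b) (a, b')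

/-- The product state `⊗_{i=1}^n ω_{x_i}` associated with a classical string `x^n`. -/
def stringState {d : ℕ} (ω : Fin d → Matrix β β ℂ) {n : ℕ} (x : Fin n → Fin d) :
    Matrix (Fin n → β) (Fin n → β) ℂ :=
  of fun a b => ∏ i, ω (x i) (a i) (b i)

/-- The `n`-fold tensor power `ω^{⊗n}`. -/
def tpow (ω : Matrix β β ℂ) (n : ℕ) : Matrix (Fin n → β) (Fin n → β) ℂ :=
  of fun a b => ∏ i, ω (a i) (b i)

end PTrace

/-- Asymptotic little-o : `f ∈ o(g)` iff `f/g → 0`. -/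
def LittleO (f g : ℕ → ℝ) : Prop :=
  Tendsto (fun n => f n / g n) atTop (nhds 0)

/-- Asymptotic little-omega : `f ∈ ω(g)` iff `|f/g| → ∞`. -/
def LittleOmega (f g : ℕ → ℝ) : Prop :=
  Tendsto (fun n => |f n / g n|) atTop atTop

section CQ

variable {B W : Type*} [Fintype B] [DecidableEq B] [Fintype W] [DecidableEq W]

/-- Bob's reduced output `σ_x` of the classical-quantum channel `π`. -/
def bobOut (π : Fin 2 → Matrix (B × W) (B × W) ℂ) (x : Fin 2) : Matrix B B ℂ :=
  ptraceRight (π x)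

/-- Willie's reduced output `ω_x` of the classical-quantum channel `π`. -/
def willieOut (π : Fin 2 → Matrix (B × W) (B × W) ℂ) (x : Fin 2) : Matrix W W ℂ :=
  ptraceLeft (π x)

variable (π : Fin 2 → Matrix (B × W) (B × W) ℂ)

/-- Bob's output state for the codeword `x^n`. -/
def bobWord {n : ℕ} (x : Fin n → Fin 2) : Matrix (Fin n → B) (Fin n → B) ℂ :=
  stringState (bobOut π) x

/-- Willie's output state for the codeword `x^n`. -/
def willieWord {n : ℕ} (x : Fin n → Fin 2) : Matrix (Fin n → W) (Fin n → W) ℂ :=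
  stringState (willieOut π) x

/-- `Λ` is a (sub-normalized) decoding POVM for each key value. -/
def IsPOVM {n M L K : ℕ} (Λ : Fin K → Fin M → Fin L → Matrix (Fin n → B) (Fin n → B) ℂ) :
    Prop :=
  (∀ k m ℓ, (Λ k m ℓ).PosSemidef) ∧
    ∀ k, ((1 : Matrix (Fin n → B) (Fin n → B) ℂ) - ∑ m, ∑ ℓ, Λ k m ℓ).PosSemidef

/-- Average decoding error probability of a covert secrecy code. -/
def avgErr {n M L K : ℕ} (f : Fin M → Fin L → Fin K → Fin n → Fin 2)
    (Λ : Fin K → Fin M → Fin L → Matrix (Fin n → B) (Fin n → B) ℂ) : ℝ :=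
  ((M : ℝ) * L * K)⁻¹ *
    ∑ m, ∑ ℓ, ∑ k, (1 - ((Λ k m ℓ * bobWord π (f m ℓ k)).trace).re)

/-- Willie's average output state `ρ̄_{W^n}` (averaged over message, public message and key). -/
def willieAvg {n M L K : ℕ} (f : Fin M → Fin L → Fin K → Fin n → Fin 2) :
    Matrix (Fin n → W) (Fin n → W) ℂ :=
  ((((M : ℝ) * L * K)⁻¹ : ℝ) : ℂ) • ∑ m, ∑ ℓ, ∑ k, willieWord π (f m ℓ k)

/-- Willie's state `ρ_{W^n}^{(m)}` given the secret message `m` (averaged over `ℓ` and `k`). -/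
def willieMsg {n M L K : ℕ} (f : Fin M → Fin L → Fin K → Fin n → Fin 2) (m : Fin M) :
    Matrix (Fin n → W) (Fin n → W) ℂ :=
  ((((L : ℝ) * K)⁻¹ : ℝ) : ℂ) • ∑ ℓ, ∑ k, willieWord π (f m ℓ k)

/-- The covertness criterion `D(ρ̄_{W^n} ‖ ω₀^{⊗n}) ≤ δ_cov`. -/
def Covert {n M L K : ℕ} (f : Fin M → Fin L → Fin K → Fin n → Fin 2) (δcov : ℝ) : Prop :=
  relEnt (willieAvg π f) (tpow (willieOut π 0) n) ≤ δcov

/-- The secrecy criterion: some state `ρ̆` independent of `m` is `δ_sec`-close on average. -/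
def Secret {n M L K : ℕ} (f : Fin M → Fin L → Fin K → Fin n → Fin 2) (δsec : ℝ) : Prop :=
  ∃ ρ' : Matrix (Fin n → W) (Fin n → W) ℂ, IsDensity ρ' ∧
    (M : ℝ)⁻¹ * ∑ m, traceNorm (willieMsg π f m - ρ') ≤ δsec

/-- Existence of an `(|M|,|L|,|K|,n,ε,δ_cov,δ_sec)` covert secrecy code. -/
def CodeExists (n M L K : ℕ) (ε δcov δsec : ℝ) : Prop :=
  ∃ (f : Fin M → Fin L → Fin K → Fin n → Fin 2)
    (Λ : Fin K → Fin M → Fin L → Matrix (Fin n → B) (Fin n → B) ℂ),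
      IsPOVM (B := B) Λ ∧ avgErr π f Λ ≤ ε ∧ Covert π f δcov ∧ Secret π f δsec

end CQ



section Statement2

variable {B W : Type*} [Fintype B] [DecidableEq B] [Fintype W] [DecidableEq W]

/-- `L_S > 0` is an achievable covert secrecy rate without key assistance
(`L_key = 0`, i.e. `|K| = 1`; an arbitrary public message is allowed). -/
def AchievableNoKey (π : Fin 2 → Matrix (B × W) (B × W) ℂ) (LS : ℝ) : Prop :=
  0 < LS ∧ ∀ ε δcov δsec : ℝ, 0 < ε → 0 < δcov → 0 < δsec →
    ∀ᶠ n : ℕ in atTop, ∃ M L : ℕ,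
      Real.sqrt ((n : ℝ) * δcov) * LS ≤ Real.log M ∧
      CodeExists π n M L 1 ε δcov δsec

/-- The covert secrecy capacity without key assistance. -/
def covertSecrecyCapacity (π : Fin 2 → Matrix (B × W) (B × W) ℂ) : ℝ :=
  sSup {LS : ℝ | AchievableNoKey π LS}

end Statement2

end CovertPaper

end

section Parts

section
open Matrix Filter
open scoped Kronecker Classical ComplexOrder MatrixOrder

noncomputable section

namespace CovertPaper

section Basics
variable {ι : Type*} [Fintype ι] [DecidableEq ι]

/-- Unitary conjugate of a real diagonal matrix. -/
def ud (U : Matrix ι ι ℂ) (d : ι → ℝ) : Matrix ι ι ℂ :=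
  U * diagonal (fun i => (d i : ℂ)) * Uᴴ

lemma uni_l {U : Matrix ι ι ℂ} (hU : U ∈ unitaryGroup ι ℂ) : Uᴴ * U = 1 :=
  Matrix.mem_unitaryGroup_iff'.mp hU

lemma uni_r {U : Matrix ι ι ℂ} (hU : U ∈ unitaryGroup ι ℂ) : U * Uᴴ = 1 :=
  Matrix.mem_unitaryGroup_iff.mp hU

lemma uni_ct_mul {U V : Matrix ι ι ℂ} (hU : U ∈ unitaryGroup ι ℂ) (hV : V ∈ unitaryGroup ι ℂ) :
    Uᴴ * V ∈ unitaryGroup ι ℂ := by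
  rw [Matrix.mem_unitaryGroup_iff]
  rw [star_eq_conjTranspose, conjTranspose_mul, conjTranspose_conjTranspose,
    Matrix.mul_assoc, ← Matrix.mul_assoc V, uni_r hV, Matrix.one_mul, uni_l hU]

lemma ud_isHermitian (U : Matrix ι ι ℂ) (d : ι → ℝ) : (ud U d).IsHermitian := by
  unfold ud
  apply Matrix.isHermitian_mul_mul_conjTranspose
  rw [Matrix.IsHermitian, diagonal_conjTranspose]
  congr 1
  funext i
  simp

lemma herm_ud {A : Matrix ι ι ℂ} (hA : A.IsHermitian) :
    A = ud (hA.eigenvectorUnitary : Matrix ι ι ℂ) hA.eigenvalues := by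
  conv_lhs => rw [hA.spectral_theorem]
  rfl

lemma exists_ud {A : Matrix ι ι ℂ} (hA : A.IsHermitian) :
    ∃ U ∈ unitaryGroup ι ℂ, ∃ d : ι → ℝ, A = ud U d :=
  ⟨_, (hA.eigenvectorUnitary).2, _, herm_ud hA⟩

lemma exists_ud_psd {A : Matrix ι ι ℂ} (hA : A.PosSemidef) :
    ∃ U ∈ unitaryGroup ι ℂ, ∃ d : ι → ℝ, (∀ i, 0 ≤ d i) ∧ A = ud U d :=
  ⟨_, (hA.1.eigenvectorUnitary).2, _, hA.eigenvalues_nonneg, herm_ud hA.1⟩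

lemma ud_psd (U : Matrix ι ι ℂ) {d : ι → ℝ} (hd : ∀ i, 0 ≤ d i) : (ud U d).PosSemidef := by
  unfold ud
  apply PosSemidef.mul_mul_conjTranspose_same
  apply PosSemidef.diagonal
  intro i
  simpa using hd i

lemma ud_mul {U : Matrix ι ι ℂ} (hU : U ∈ unitaryGroup ι ℂ) (d e : ι → ℝ) :
    ud U d * ud U e = ud U (fun i => d i * e i) := by
  unfold ud
  have : U * diagonal (fun i => (d i : ℂ)) * Uᴴ * (U * diagonal (fun i => (e i : ℂ)) * Uᴴ)
      = U * diagonal (fun i => (d i : ℂ)) * (Uᴴ * U) * diagonal (fun i => (e i : ℂ)) * Uᴴ := by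
    simp only [Matrix.mul_assoc]
  rw [this, uni_l hU, Matrix.mul_one, Matrix.mul_assoc U, diagonal_mul_diagonal]
  simp

lemma ud_add (U : Matrix ι ι ℂ) (d e : ι → ℝ) :
    ud U d + ud U e = ud U (fun i => d i + e i) := by
  unfold ud
  rw [← Matrix.add_mul, ← Matrix.mul_add, diagonal_add]
  simp

lemma ud_sub (U : Matrix ι ι ℂ) (d e : ι → ℝ) :
    ud U d - ud U e = ud U (fun i => d i - e i) := by
  unfold ud
  rw [← Matrix.sub_mul, ← Matrix.mul_sub, diagonal_sub]
  simp

lemma ud_smul (U : Matrix ι ι ℂ) (c : ℝ) (d : ι → ℝ) :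
    (c : ℂ) • ud U d = ud U (fun i => c * d i) := by
  unfold ud
  rw [← Matrix.smul_mul, ← Matrix.mul_smul, ← diagonal_smul]
  congr 3
  funext i
  simp

lemma ud_one {U : Matrix ι ι ℂ} (hU : U ∈ unitaryGroup ι ℂ) : ud U (fun _ => 1) = 1 := by
  unfold ud
  simp [uni_r hU]

lemma ud_const {U : Matrix ι ι ℂ} (hU : U ∈ unitaryGroup ι ℂ) (c : ℝ) :
    ud U (fun _ => c) = (c : ℂ) • (1 : Matrix ι ι ℂ) := by
  rw [← ud_one hU, ud_smul]
  simp

lemma ud_le {U : Matrix ι ι ℂ} {d e : ι → ℝ} (h : ∀ i, d i ≤ e i) : ud U d ≤ ud U e := by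
  rw [Matrix.le_iff, ud_sub]
  exact ud_psd _ (fun i => sub_nonneg.mpr (h i))

lemma trace_ud {U : Matrix ι ι ℂ} (hU : U ∈ unitaryGroup ι ℂ) (d : ι → ℝ) :
    (ud U d).trace = ((∑ i, d i : ℝ) : ℂ) := by
  unfold ud
  rw [Matrix.trace_mul_comm, ← Matrix.mul_assoc, uni_l hU, Matrix.one_mul, trace_diagonal]
  push_cast
  rfl

/-- Functional calculus does not depend on the chosen diagonalization. -/
lemma matFun_ud {U : Matrix ι ι ℂ} (hU : U ∈ unitaryGroup ι ℂ) (f : ℝ → ℝ) (d : ι → ℝ) :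
    matFun f (ud U d) = ud U (fun i => f (d i)) := by
  have hA := ud_isHermitian U d
  unfold matFun
  rw [dif_pos hA]
  set V : Matrix ι ι ℂ := (hA.eigenvectorUnitary : Matrix ι ι ℂ) with hVdef
  have hV : V ∈ unitaryGroup ι ℂ := (hA.eigenvectorUnitary).2
  set e := hA.eigenvalues
  have h1 : ud V e = ud U d := (herm_ud hA).symm
  set Wm := Vᴴ * U with hW
  have h2 : diagonal (fun i => (e i : ℂ)) * Wm = Wm * diagonal (fun i => (d i : ℂ)) := by
    have : Vᴴ * ud V e * U = Vᴴ * ud U d * U := by rw [h1]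
    unfold ud at this
    have e1 : Vᴴ * (V * diagonal (fun i => (e i : ℂ)) * Vᴴ) * U
        = (Vᴴ * V) * diagonal (fun i => (e i : ℂ)) * (Vᴴ * U) := by
      simp only [Matrix.mul_assoc]
    have e2 : Vᴴ * (U * diagonal (fun i => (d i : ℂ)) * Uᴴ) * U
        = (Vᴴ * U) * diagonal (fun i => (d i : ℂ)) * (Uᴴ * U) := by
      simp only [Matrix.mul_assoc]
    rw [e1, e2, uni_l hV, uni_l hU, Matrix.one_mul, Matrix.mul_one] at this
    exact this
  have h3 : diagonal (fun i => (f (e i) : ℂ)) * Wm = Wm * diagonal (fun i => (f (d i) : ℂ)) := by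
    ext i j
    have := congrFun (congrFun h2 i) j
    rw [diagonal_mul, mul_diagonal] at this ⊢
    by_cases hz : Wm i j = 0
    · simp [hz]
    · have h4 : (e i : ℂ) = d j := by
        apply mul_right_cancel₀ hz
        rw [this, mul_comm]
      have h5 : e i = d j := by exact_mod_cast h4
      rw [h5, mul_comm]
  have h6 : V * (diagonal (fun i => (f (e i) : ℂ)) * Wm) * Uᴴ
      = V * (Wm * diagonal (fun i => (f (d i) : ℂ))) * Uᴴ := by rw [h3]
  have e1 : V * (diagonal (fun i => (f (e i) : ℂ)) * Wm) * Uᴴ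
      = V * diagonal (fun i => (f (e i) : ℂ)) * Vᴴ * (U * Uᴴ) := by
    simp only [hW, Matrix.mul_assoc]
  have e2 : V * (Wm * diagonal (fun i => (f (d i) : ℂ))) * Uᴴ
      = (V * Vᴴ) * (U * diagonal (fun i => (f (d i) : ℂ)) * Uᴴ) := by
    simp only [hW, Matrix.mul_assoc]
  rw [e1, e2, uni_r hU, uni_r hV, Matrix.mul_one, Matrix.one_mul] at h6
  exact h6

/-- Overlap matrix (doubly stochastic) of two unitary bases. -/
def ov (U V : Matrix ι ι ℂ) (i j : ι) : ℝ := Complex.normSq ((Uᴴ * V) i j)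

lemma ov_nonneg (U V : Matrix ι ι ℂ) (i j : ι) : 0 ≤ ov U V i j := Complex.normSq_nonneg _

lemma uni_row_sum {W : Matrix ι ι ℂ} (hW : W ∈ unitaryGroup ι ℂ) (i : ι) :
    ∑ j, Complex.normSq (W i j) = 1 := by
  have h := congrFun (congrFun (uni_r hW) i) i
  rw [Matrix.mul_apply] at h
  simp only [conjTranspose_apply, RCLike.star_def, Complex.mul_conj, one_apply_eq] at h
  exact_mod_cast h

lemma uni_col_sum {W : Matrix ι ι ℂ} (hW : W ∈ unitaryGroup ι ℂ) (j : ι) :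
    ∑ i, Complex.normSq (W i j) = 1 := by
  have h := congrFun (congrFun (uni_l hW) j) j
  rw [Matrix.mul_apply] at h
  simp only [conjTranspose_apply, RCLike.star_def, one_apply_eq] at h
  have : ∀ i, (starRingEnd ℂ) (W i j) * W i j = (Complex.normSq (W i j) : ℂ) := by
    intro i; rw [mul_comm, Complex.mul_conj]
  simp only [this] at h
  exact_mod_cast h

lemma ov_row {U V : Matrix ι ι ℂ} (hU : U ∈ unitaryGroup ι ℂ) (hV : V ∈ unitaryGroup ι ℂ)
    (i : ι) : ∑ j, ov U V i j = 1 := uni_row_sum (uni_ct_mul hU hV) i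

lemma ov_col {U V : Matrix ι ι ℂ} (hU : U ∈ unitaryGroup ι ℂ) (hV : V ∈ unitaryGroup ι ℂ)
    (j : ι) : ∑ i, ov U V i j = 1 := uni_col_sum (uni_ct_mul hU hV) j

lemma trace_ud_mul_ud (U V : Matrix ι ι ℂ) (a c : ι → ℝ) :
    (ud U a * ud V c).trace = ((∑ i, ∑ j, ov U V i j * (a i * c j) : ℝ) : ℂ) := by
  unfold ud
  have e1 : U * diagonal (fun i => (a i : ℂ)) * Uᴴ * (V * diagonal (fun i => (c i : ℂ)) * Vᴴ)
      = U * (diagonal (fun i => (a i : ℂ)) * (Uᴴ * V) * diagonal (fun i => (c i : ℂ)) * Vᴴ) := by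
    simp only [Matrix.mul_assoc]
  have e2 : diagonal (fun i => (a i : ℂ)) * (Uᴴ * V) * diagonal (fun i => (c i : ℂ)) * Vᴴ * U
      = (diagonal (fun i => (a i : ℂ)) * (Uᴴ * V) * diagonal (fun i => (c i : ℂ))) *
        (Uᴴ * V)ᴴ := by
    rw [conjTranspose_mul, conjTranspose_conjTranspose, Matrix.mul_assoc]
  rw [e1, Matrix.trace_mul_comm, e2, Matrix.trace]
  push_cast
  refine Finset.sum_congr rfl fun i _ => ?_
  rw [diag_apply, Matrix.mul_apply]
  refine Finset.sum_congr rfl fun j _ => ?_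
  rw [mul_diagonal, diagonal_mul, conjTranspose_apply]
  unfold ov
  rw [← Complex.mul_conj, RCLike.star_def]
  ring

lemma matLog_ud {U : Matrix ι ι ℂ} (hU : U ∈ unitaryGroup ι ℂ) (d : ι → ℝ) :
    matLog (ud U d) = ud U (fun i => Real.log (d i)) := matFun_ud hU _ _

lemma matLog_isHermitian (A : Matrix ι ι ℂ) : (matLog A).IsHermitian := by
  by_cases hA : A.IsHermitian
  · obtain ⟨U, hU, d, rfl⟩ := exists_ud hA
    rw [matLog_ud hU]
    exact ud_isHermitian _ _
  · unfold matLog matFun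
    rw [dif_neg hA]
    exact isHermitian_zero

lemma trace_mul_matLog (U V : Matrix ι ι ℂ) (hV : V ∈ unitaryGroup ι ℂ) (p q : ι → ℝ) :
    ((ud U p * matLog (ud V q)).trace).re = ∑ i, ∑ j, ov U V i j * (p i * Real.log (q j)) := by
  rw [matLog_ud hV, trace_ud_mul_ud, Complex.ofReal_re]

lemma vnEnt_ud {U : Matrix ι ι ℂ} (hU : U ∈ unitaryGroup ι ℂ) (p : ι → ℝ) :
    vnEnt (ud U p) = - ∑ i, p i * Real.log (p i) := by
  unfold vnEnt
  rw [matLog_ud hU, ud_mul hU, trace_ud hU, Complex.ofReal_re]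

lemma relEnt_eq (ρ σ : Matrix ι ι ℂ) : relEnt ρ σ = - vnEnt ρ - ((ρ * matLog σ).trace).re := by
  unfold relEnt vnEnt
  rw [Matrix.mul_sub, Matrix.trace_sub, Complex.sub_re]
  ring

lemma suppLE_ud {U V : Matrix ι ι ℂ} (hU : U ∈ unitaryGroup ι ℂ) (hV : V ∈ unitaryGroup ι ℂ)
    {p q : ι → ℝ} (h : SuppLE (ud U p) (ud V q)) (i j : ι) (hq : q j = 0) :
    ov U V i j = 0 ∨ p i = 0 := by
  have h1 : (ud V q).mulVec (V.mulVec (Pi.single j 1)) = 0 := by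
    unfold ud
    rw [Matrix.mulVec_mulVec, Matrix.mul_assoc, uni_l hV, Matrix.mul_one, ← Matrix.mulVec_mulVec]
    have : (diagonal (fun i => (q i : ℂ))).mulVec (Pi.single j 1) = 0 := by
      ext k
      rw [mulVec_diagonal]
      by_cases hk : k = j
      · subst hk; simp [hq]
      · simp [hk]
    rw [this, Matrix.mulVec_zero]
  have h2 := h _ h1
  have h3 : (diagonal (fun i => (p i : ℂ)) * (Uᴴ * V)).mulVec (Pi.single j 1) = 0 := by
    have : Uᴴ.mulVec ((ud U p).mulVec (V.mulVec (Pi.single j 1))) = 0 := by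
      rw [h2, Matrix.mulVec_zero]
    rw [Matrix.mulVec_mulVec, Matrix.mulVec_mulVec] at this
    unfold ud at this
    have e : Uᴴ * (U * diagonal (fun i => (p i : ℂ)) * Uᴴ) * V
       = (Uᴴ * U) * (diagonal (fun i => (p i : ℂ)) * (Uᴴ * V)) := by
      simp only [Matrix.mul_assoc]
    rw [e, uni_l hU, Matrix.one_mul] at this
    exact this
  have h4 := congrFun h3 i
  rw [Matrix.mulVec_single_one] at h4
  simp only [col_apply, diagonal_mul, Pi.zero_apply, mul_eq_zero, Complex.ofReal_eq_zero] at h4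
  rcases h4 with h4 | h4
  · exact Or.inr h4
  · left; unfold ov; rw [h4]; simp

end Basics

end CovertPaper

end

end

section
open Matrix Filter
open scoped Kronecker Classical ComplexOrder MatrixOrder

noncomputable section
set_option linter.unusedSectionVars false
set_option linter.unusedVariables false

namespace CovertPaper

section Entropy
variable {ι : Type*} [Fintype ι] [DecidableEq ι]

/-- Real part of the trace. -/
def rtr {ι : Type*} [Fintype ι] (A : Matrix ι ι ℂ) : ℝ := A.trace.re

lemma rtr_add (A B : Matrix ι ι ℂ) : rtr (A + B) = rtr A + rtr B := by
  simp [rtr, Matrix.trace_add]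
lemma rtr_sub (A B : Matrix ι ι ℂ) : rtr (A - B) = rtr A - rtr B := by
  simp [rtr, Matrix.trace_sub]
lemma rtr_neg (A : Matrix ι ι ℂ) : rtr (-A) = - rtr A := by
  simp [rtr, Matrix.trace_neg]
lemma rtr_zero : rtr (0 : Matrix ι ι ℂ) = 0 := by simp [rtr]
lemma rtr_smul (c : ℝ) (A : Matrix ι ι ℂ) : rtr ((c : ℂ) • A) = c * rtr A := by
  simp [rtr, Matrix.trace_smul]
lemma rtr_sum {κ : Type*} (s : Finset κ) (A : κ → Matrix ι ι ℂ) :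
    rtr (∑ k ∈ s, A k) = ∑ k ∈ s, rtr (A k) := by
  simp [rtr, Matrix.trace_sum]
lemma rtr_comm (A B : Matrix ι ι ℂ) : rtr (A * B) = rtr (B * A) := by
  unfold rtr; rw [Matrix.trace_mul_comm]
lemma rtr_ct (A : Matrix ι ι ℂ) : rtr Aᴴ = rtr A := by
  unfold rtr; rw [Matrix.trace_conjTranspose]; simp

lemma rtr_nonneg {A : Matrix ι ι ℂ} (hA : A.PosSemidef) : 0 ≤ rtr A := by
  have := hA.trace_nonneg
  rw [Complex.le_def] at this
  exact this.1

lemma rtr_density {A : Matrix ι ι ℂ} (hA : IsDensity A) : rtr A = 1 := by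
  unfold rtr; rw [hA.2]; simp

lemma rtr_mono {A B : Matrix ι ι ℂ} (h : A ≤ B) : rtr A ≤ rtr B := by
  have := rtr_nonneg (Matrix.le_iff.mp h)
  rw [rtr_sub] at this; linarith

lemma psd_ofReal_smul {c : ℝ} (hc : 0 ≤ c) {A : Matrix ι ι ℂ} (hA : A.PosSemidef) :
    ((c : ℂ) • A).PosSemidef := hA.smul (by exact_mod_cast hc)

lemma rtr_mul_nonneg {A B : Matrix ι ι ℂ} (hA : A.PosSemidef) (hB : B.PosSemidef) :
    0 ≤ rtr (A * B) := by
  obtain ⟨U, hU, p, hp, rfl⟩ := exists_ud_psd hA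
  obtain ⟨V, hV, q, hq, rfl⟩ := exists_ud_psd hB
  unfold rtr
  rw [trace_ud_mul_ud, Complex.ofReal_re]
  exact Finset.sum_nonneg fun i _ => Finset.sum_nonneg fun j _ =>
    mul_nonneg (ov_nonneg _ _ _ _) (mul_nonneg (hp i) (hq j))

lemma rtr_mul_mono {A B C : Matrix ι ι ℂ} (hA : A.PosSemidef) (h : B ≤ C) :
    rtr (A * B) ≤ rtr (A * C) := by
  have := rtr_mul_nonneg hA (Matrix.le_iff.mp h)
  rw [Matrix.mul_sub, rtr_sub] at this; linarith

lemma rtr_ud {U : Matrix ι ι ℂ} (hU : U ∈ unitaryGroup ι ℂ) (d : ι → ℝ) :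
    rtr (ud U d) = ∑ i, d i := by
  unfold rtr; rw [trace_ud hU, Complex.ofReal_re]

lemma rtr_ud_mul_ud (U V : Matrix ι ι ℂ) (a c : ι → ℝ) :
    rtr (ud U a * ud V c) = ∑ i, ∑ j, ov U V i j * (a i * c j) := by
  unfold rtr; rw [trace_ud_mul_ud, Complex.ofReal_re]

lemma sum_ov_left {U V : Matrix ι ι ℂ} (hU : U ∈ unitaryGroup ι ℂ) (hV : V ∈ unitaryGroup ι ℂ)
    (a : ι → ℝ) : ∑ i, a i = ∑ i, ∑ j, ov U V i j * a i := by
  refine Finset.sum_congr rfl fun i _ => ?_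
  rw [← Finset.sum_mul, ov_row hU hV, one_mul]

lemma sum_ov_right {U V : Matrix ι ι ℂ} (hU : U ∈ unitaryGroup ι ℂ) (hV : V ∈ unitaryGroup ι ℂ)
    (a : ι → ℝ) : ∑ i, a i = ∑ i, ∑ j, ov U V i j * a j := by
  rw [Finset.sum_comm]
  refine Finset.sum_congr rfl fun i _ => ?_
  rw [← Finset.sum_mul, ov_col hU hV, one_mul]

lemma scalar_klein {p q : ℝ} (hp : 0 ≤ p) (hq : 0 < q) :
    p - q ≤ p * Real.log p - p * Real.log q := by
  rcases hp.eq_or_lt with h | h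
  · subst h; simp; linarith
  · have := Real.log_le_sub_one_of_pos (div_pos hq h)
    rw [Real.log_div hq.ne' h.ne'] at this
    have h2 := mul_le_mul_of_nonneg_left this hp
    have : p * (q / p - 1) = q - p := by field_simp
    nlinarith

lemma klein {A B : Matrix ι ι ℂ} (hA : A.PosSemidef) (hB : B.PosSemidef) (h : SuppLE A B) :
    rtr A - rtr B ≤ - vnEnt A - rtr (A * matLog B) := by
  obtain ⟨U, hU, p, hp, rfl⟩ := exists_ud_psd hA
  obtain ⟨V, hV, q, hq, rfl⟩ := exists_ud_psd hB
  rw [rtr_ud hU, rtr_ud hV, vnEnt_ud hU, matLog_ud hV, rtr_ud_mul_ud, neg_neg,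
    sum_ov_left hU hV p, sum_ov_right hU hV q, sum_ov_left hU hV (fun i => p i * Real.log (p i)),
    ← Finset.sum_sub_distrib, ← Finset.sum_sub_distrib]
  refine Finset.sum_le_sum fun i _ => ?_
  rw [← Finset.sum_sub_distrib, ← Finset.sum_sub_distrib]
  refine Finset.sum_le_sum fun j _ => ?_
  rw [← mul_sub, ← mul_sub]
  rcases (hq j).eq_or_lt with h0 | h0
  · rcases suppLE_ud hU hV h i j h0.symm with h1 | h1
    · simp [h1]
    · simp [h1, ← h0]
  · exact mul_le_mul_of_nonneg_left (scalar_klein (hp i) h0) (ov_nonneg _ _ _ _)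

lemma scalar_klein2 {p q : ℝ} (hp : 0 ≤ p) (hp1 : p ≤ 1) (hq : 0 < q) (hq1 : q ≤ 1) :
    p - q + (p - q) ^ 2 / 2 ≤ p * Real.log p - p * Real.log q := by
  -- f p = p log p - p log q - p + q - (p-q)^2/2, f' = log p - log q - (p - q)
  rcases hp.eq_or_lt with h | h
  · subst h; simp; nlinarith
  -- h(y) = log y - y is monotone on (0,1]
  have mono : ∀ x y : ℝ, 0 < x → x ≤ y → y ≤ 1 → Real.log x - x ≤ Real.log y - y := by
    intro x y hx hxy hy
    have hy0 : 0 < y := lt_of_lt_of_le hx hxy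
    have := Real.log_le_sub_one_of_pos (div_pos hx hy0)
    rw [Real.log_div hx.ne' hy0.ne'] at this
    have e : x / y - 1 = (x - y) / y := by field_simp
    rw [e] at this
    have : (x - y) / y ≤ x - y := by
      rw [div_le_iff₀ hy0]; nlinarith
    linarith
  let F : ℝ → ℝ := fun t => t * Real.log t - t * Real.log q - t + q - (t - q) ^ 2 / 2
  have hd : ∀ t : ℝ, 0 < t → HasDerivAt F (Real.log t - Real.log q - (t - q)) t := by
    intro t ht
    have h1 := (((Real.hasDerivAt_mul_log ht.ne').sub ((hasDerivAt_id t).mul_const (Real.log q))).sub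
      (hasDerivAt_id t)).add_const q
    have h2 := (((hasDerivAt_id t).sub_const q).pow 2).div_const 2
    have := h1.sub h2
    refine HasDerivAt.congr_deriv (f := F) this ?_
    simp; ring
  have hFq : F q = 0 := by simp [F]
  suffices 0 ≤ F p by simp only [F] at this; linarith
  rcases le_total p q with hpq | hpq
  · have : AntitoneOn F (Set.Icc p q) := by
      apply antitoneOn_of_deriv_nonpos (convex_Icc _ _)
      · exact fun t ht => (hd t (lt_of_lt_of_le h ht.1)).continuousAt.continuousWithinAt
      · intro t ht
        rw [interior_Icc] at ht
        exact (hd t (h.trans ht.1)).differentiableAt.differentiableWithinAt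
      · intro t ht
        rw [interior_Icc] at ht
        rw [(hd t (h.trans ht.1)).deriv]
        have := mono t q (h.trans ht.1) ht.2.le hq1
        linarith
    have := this (Set.left_mem_Icc.mpr hpq) (Set.right_mem_Icc.mpr hpq) hpq
    linarith
  · have : MonotoneOn F (Set.Icc q p) := by
      apply monotoneOn_of_deriv_nonneg (convex_Icc _ _)
      · exact fun t ht => (hd t (lt_of_lt_of_le hq ht.1)).continuousAt.continuousWithinAt
      · intro t ht
        rw [interior_Icc] at ht
        exact (hd t (hq.trans ht.1)).differentiableAt.differentiableWithinAt
      · intro t ht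
        rw [interior_Icc] at ht
        rw [(hd t (hq.trans ht.1)).deriv]
        have := mono q t hq ht.1.le (ht.2.le.trans hp1)
        linarith
    have := this (Set.left_mem_Icc.mpr hpq) (Set.right_mem_Icc.mpr hpq) hpq
    linarith

lemma eig_le_of_rtr_le {U : Matrix ι ι ℂ} (hU : U ∈ unitaryGroup ι ℂ) {p : ι → ℝ}
    (hp : ∀ i, 0 ≤ p i) {c : ℝ} (h : rtr (ud U p) ≤ c) (i : ι) : p i ≤ c := by
  rw [rtr_ud hU] at h
  exact le_trans (Finset.single_le_sum (fun j _ => hp j) (Finset.mem_univ i)) h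

lemma klein_sq {A B : Matrix ι ι ℂ} (hA : IsDensity A) (hB : IsDensity B) (h : SuppLE A B) :
    rtr ((A - B) * (A - B)) / 2 ≤ relEnt A B := by
  have ha := rtr_density hA
  have hb := rtr_density hB
  rw [relEnt_eq]
  obtain ⟨U, hU, p, hp, rfl⟩ := exists_ud_psd hA.1
  obtain ⟨V, hV, q, hq, rfl⟩ := exists_ud_psd hB.1
  have hp1 : ∀ i, p i ≤ 1 := eig_le_of_rtr_le hU hp ha.le
  have hq1 : ∀ i, q i ≤ 1 := eig_le_of_rtr_le hV hq hb.le
  have e0 : rtr ((ud U p - ud V q) * (ud U p - ud V q))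
      = ∑ i, ∑ j, ov U V i j * (p i - q j) ^ 2 := by
    have : (ud U p - ud V q) * (ud U p - ud V q)
      = ud U p * ud U p + ud V q * ud V q - ud U p * ud V q - ud V q * ud U p := by noncomm_ring
    rw [this, rtr_sub, rtr_sub, rtr_add, rtr_comm (ud V q) (ud U p), ud_mul hU, ud_mul hV,
      rtr_ud hU, rtr_ud hV, rtr_ud_mul_ud, sum_ov_left hU hV (fun i => p i * p i),
      sum_ov_right hU hV (fun i => q i * q i)]
    simp only [← Finset.sum_sub_distrib, ← Finset.sum_add_distrib]
    refine Finset.sum_congr rfl fun i _ => Finset.sum_congr rfl fun j _ => ?_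
    ring
  have hz : ∑ i, ∑ j, ov U V i j * (p i - q j) = 0 := by
    simp only [mul_sub, Finset.sum_sub_distrib]
    rw [← sum_ov_left hU hV p, ← sum_ov_right hU hV q, ← rtr_ud hU, ← rtr_ud hV, ha, hb, sub_self]
  change _ ≤ _ - rtr _
  rw [e0, vnEnt_ud hU, matLog_ud hV, rtr_ud_mul_ud, neg_neg,
    sum_ov_left hU hV (fun i => p i * Real.log (p i)), ← zero_add (_ / 2), ← hz,
    Finset.sum_div, ← Finset.sum_sub_distrib, ← Finset.sum_add_distrib]
  refine Finset.sum_le_sum fun i _ => ?_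
  rw [Finset.sum_div, ← Finset.sum_sub_distrib, ← Finset.sum_add_distrib]
  refine Finset.sum_le_sum fun j _ => ?_
  rcases (hq j).eq_or_lt with h0 | h0
  · rcases suppLE_ud hU hV h i j h0.symm with h1 | h1
    · simp [h1]
    · simp [h1, ← h0]
  · have := mul_le_mul_of_nonneg_left (scalar_klein2 (hp i) (hp1 i) h0 (hq1 j)) (ov_nonneg U V i j)
    linarith

/-- support inclusion from domination -/
lemma suppLE_of_le {A B : Matrix ι ι ℂ} (hA : A.PosSemidef) (hB : B.PosSemidef) (h : A ≤ B) :
    SuppLE A B := by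
  intro v hv
  have h1 := (Matrix.le_iff.mp h).dotProduct_mulVec_nonneg v
  rw [Matrix.sub_mulVec, hv, zero_sub, dotProduct_neg] at h1
  have h2 := hA.dotProduct_mulVec_nonneg v
  have h3 : star v ⬝ᵥ A.mulVec v = 0 := by
    apply le_antisymm _ h2
    simpa using h1
  exact (hA.dotProduct_mulVec_zero_iff v).mp h3

lemma le_add_right_psd {A B : Matrix ι ι ℂ} (hB : B.PosSemidef) : A ≤ A + B := by
  rw [Matrix.le_iff]; simpa using hB

lemma suppLE_self (A : Matrix ι ι ℂ) : SuppLE A A := fun _ h => h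

lemma suppLE_smul_right {A B : Matrix ι ι ℂ} {c : ℝ} (hc : c ≠ 0) (h : SuppLE A B) :
    SuppLE A ((c : ℂ) • B) := by
  intro v hv
  apply h
  rw [Matrix.smul_mulVec] at hv
  exact (smul_eq_zero.mp hv).resolve_left (by exact_mod_cast hc)

lemma suppLE_smul_left {A B : Matrix ι ι ℂ} (c : ℂ) (h : SuppLE A B) :
    SuppLE (c • A) B := by
  intro v hv
  rw [Matrix.smul_mulVec, h v hv, smul_zero]

lemma suppLE_sum_left {κ : Type*} (s : Finset κ) {A : κ → Matrix ι ι ℂ} {B : Matrix ι ι ℂ}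
    (h : ∀ k ∈ s, SuppLE (A k) B) : SuppLE (∑ k ∈ s, A k) B := by
  intro v hv
  rw [Matrix.sum_mulVec]
  exact Finset.sum_eq_zero fun k hk => h k hk v hv

lemma suppLE_add_left {A A' B : Matrix ι ι ℂ}
    (h : SuppLE A B) (h' : SuppLE A' B) : SuppLE (A + A') B := by
  intro v hv
  rw [Matrix.add_mulVec, h v hv, h' v hv, add_zero]

lemma suppLE_trans {A B C : Matrix ι ι ℂ} (h : SuppLE A B) (h' : SuppLE B C) : SuppLE A C :=
  fun v hv => h v (h' v hv)

lemma vnEnt_eq (A : Matrix ι ι ℂ) : vnEnt A = - rtr (A * matLog A) := rfl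

lemma vnEnt_zero : vnEnt (0 : Matrix ι ι ℂ) = 0 := by simp [vnEnt]

lemma psd_zero_of_rtr {A : Matrix ι ι ℂ} (hA : A.PosSemidef) (h : rtr A = 0) : A = 0 := by
  obtain ⟨U, hU, p, hp, rfl⟩ := exists_ud_psd hA
  have hp0 : ∀ i, p i = 0 := fun i => le_antisymm (eig_le_of_rtr_le hU hp h.le i) (hp i)
  have : p = fun _ => 0 := funext hp0
  rw [this, ud_const hU]; simp

lemma vnEnt_smul {A : Matrix ι ι ℂ} (hA : A.IsHermitian) {c : ℝ} (hc : 0 < c) :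
    vnEnt ((c : ℂ) • A) = c * vnEnt A - c * Real.log c * rtr A := by
  obtain ⟨U, hU, p, rfl⟩ := exists_ud hA
  rw [ud_smul, vnEnt_ud hU, vnEnt_ud hU, rtr_ud hU, mul_neg, Finset.mul_sum, Finset.mul_sum,
    ← Finset.sum_neg_distrib, ← Finset.sum_neg_distrib, ← Finset.sum_sub_distrib]
  refine Finset.sum_congr rfl fun i _ => ?_
  by_cases h : p i = 0
  · simp [h]
  · rw [Real.log_mul hc.ne' h]; ring

/-- `s(A) ≤ a log (t/a) - Tr A log T`. -/
lemma vnEnt_le_cross {A T : Matrix ι ι ℂ} (hA : A.PosSemidef) (hT : T.PosSemidef)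
    (h : SuppLE A T) (ht : 0 < rtr T) :
    vnEnt A ≤ rtr A * Real.log (rtr T) - rtr A * Real.log (rtr A) - rtr (A * matLog T) := by
  rcases (rtr_nonneg hA).eq_or_lt with h0 | h0
  · have := psd_zero_of_rtr hA h0.symm
    subst this
    simp [vnEnt_zero, rtr_zero]
  · set c := rtr T / rtr A with hc
    have hc0 : 0 < c := div_pos ht h0
    have h1 := klein (psd_ofReal_smul hc0.le hA) hT (suppLE_smul_left _ h)
    rw [vnEnt_smul hA.1 hc0, Matrix.smul_mul, rtr_smul, rtr_smul] at h1
    have e : c * rtr A = rtr T := by rw [hc]; field_simp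
    rw [e] at h1
    have h2 : c * vnEnt A ≤ c * (Real.log c * rtr A - rtr (A * matLog T)) := by nlinarith
    have h3 := le_of_mul_le_mul_left h2 hc0
    rw [hc, Real.log_div ht.ne' h0.ne'] at h3
    nlinarith

lemma psd_sum' {κ : Type*} (s : Finset κ) {A : κ → Matrix ι ι ℂ} (h : ∀ k ∈ s, (A k).PosSemidef) :
    (∑ k ∈ s, A k).PosSemidef := Matrix.posSemidef_sum s h

/-- lower bound for the entropy of a sum -/
lemma vnEnt_add_ge {A B : Matrix ι ι ℂ} (hA : A.PosSemidef) (hB : B.PosSemidef) :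
    vnEnt A + vnEnt B - ((rtr A + rtr B) * Real.log (rtr A + rtr B) - rtr A * Real.log (rtr A)
      - rtr B * Real.log (rtr B)) ≤ vnEnt (A + B) := by
  have hT := hA.add hB
  rcases (rtr_nonneg hT).eq_or_lt with h0 | h0
  · rw [rtr_add] at h0
    have ha : rtr A = 0 := by linarith [rtr_nonneg hA, rtr_nonneg hB]
    have hb : rtr B = 0 := by linarith [rtr_nonneg hA, rtr_nonneg hB]
    rw [ha, hb, psd_zero_of_rtr hA ha, psd_zero_of_rtr hB hb]
    simp [vnEnt_zero]
  · have h1 := vnEnt_le_cross hA hT (suppLE_of_le hA hT (le_add_right_psd hB)) h0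
    have h2 := vnEnt_le_cross hB hT (suppLE_of_le hB hT
      (by rw [add_comm]; exact le_add_right_psd hA)) h0
    have h3 : vnEnt (A + B) = - rtr (A * matLog (A+B)) - rtr (B * matLog (A + B)) := by
      rw [vnEnt_eq, Matrix.add_mul, rtr_add]; ring
    rw [rtr_add] at h1 h2
    linarith

/-- concavity -/
lemma vnEnt_concave {κ : Type*} [Fintype κ] (A : κ → Matrix ι ι ℂ) (hA : ∀ k, (A k).PosSemidef)
    {c : ℝ} (hc : c * Fintype.card κ = 1) :
    c * ∑ k, vnEnt (A k) ≤ vnEnt ((c : ℂ) • ∑ k, A k) := by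
  have hc0 : 0 < c := by
    by_contra hcon
    push Not at hcon
    have : c * (Fintype.card κ : ℝ) ≤ 0 := mul_nonpos_of_nonpos_of_nonneg hcon (by positivity)
    linarith
  have hS := psd_sum' Finset.univ (fun k _ => hA k)
  set T := (c : ℂ) • ∑ k, A k with hTdef
  have hT : T.PosSemidef := psd_ofReal_smul hc0.le hS
  have hs : ∀ k, SuppLE (A k) T := by
    intro k
    apply suppLE_smul_right hc0.ne'
    apply suppLE_of_le (hA k) hS
    exact Finset.single_le_sum (f := A) (fun j _ => Matrix.nonneg_iff_posSemidef.mpr (hA j))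
      (Finset.mem_univ k)
  have h1 : ∑ k, (rtr (A k) - rtr T) ≤ ∑ k, (- vnEnt (A k) - rtr (A k * matLog T)) :=
    Finset.sum_le_sum fun k _ => klein (hA k) hT (hs k)
  rw [Finset.sum_sub_distrib, Finset.sum_sub_distrib, Finset.sum_neg_distrib, Finset.sum_const,
    ← rtr_sum, ← rtr_sum, ← Finset.sum_mul, nsmul_eq_mul, Finset.card_univ] at h1
  have h2 : vnEnt T = - (c * rtr ((∑ k, A k) * matLog T)) := by
    rw [vnEnt_eq]; conv_lhs => rw [hTdef, Matrix.smul_mul, rtr_smul]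
  have h3 : rtr T = c * rtr (∑ k, A k) := by rw [hTdef, rtr_smul]
  have h4 := mul_le_mul_of_nonneg_left h1 hc0.le
  rw [h2]
  have h5 : c * ((Fintype.card κ : ℝ) * rtr T) = rtr T := by rw [← mul_assoc, hc, one_mul]
  nlinarith

lemma matLog_smul_one {c : ℝ} :
    matLog ((c : ℂ) • (1 : Matrix ι ι ℂ)) = ((Real.log c : ℝ) : ℂ) • (1 : Matrix ι ι ℂ) := by
  have h1 : (1 : Matrix ι ι ℂ) ∈ unitaryGroup ι ℂ := one_mem _
  rw [← ud_const h1, matLog_ud h1, ud_const h1]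

lemma rtr_one : rtr (1 : Matrix ι ι ℂ) = Fintype.card ι := by simp [rtr]

lemma vnEnt_le_dim {A : Matrix ι ι ℂ} (hA : A.PosSemidef) :
    vnEnt A ≤ rtr A * Real.log (Fintype.card ι) - rtr A * Real.log (rtr A) := by
  rcases isEmpty_or_nonempty ι with he | he
  · simp [vnEnt, rtr, Matrix.trace]
  · have h1 := vnEnt_le_cross hA (T := ((1:ℝ):ℂ) • 1) (psd_ofReal_smul zero_le_one PosSemidef.one)
      (suppLE_smul_right one_ne_zero (by intro v hv; rw [Matrix.one_mulVec] at hv; simp [hv]))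
      (by rw [rtr_smul, rtr_one]; simp [Fintype.card_pos])
    rw [matLog_smul_one, rtr_smul, rtr_one] at h1
    simpa [rtr_zero] using h1

lemma vnEnt_nonneg {A : Matrix ι ι ℂ} (hA : A.PosSemidef) (h : rtr A ≤ 1) : 0 ≤ vnEnt A := by
  obtain ⟨U, hU, p, hp, rfl⟩ := exists_ud_psd hA
  rw [vnEnt_ud hU, ← Finset.sum_neg_distrib]
  refine Finset.sum_nonneg fun i _ => ?_
  have := Real.mul_log_nonpos (hp i) (eig_le_of_rtr_le hU hp h i)
  linarith

section logmono
open scoped Matrix.Norms.L2Operator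

lemma matLog_mono {A B : Matrix ι ι ℂ} (hA : A.PosDef) (h : A ≤ B) : matLog A ≤ matLog B := by
  have hB : B.IsHermitian := by
    have := (Matrix.le_iff.mp h).1.add hA.1
    simpa using this
  have e : ∀ {C : Matrix ι ι ℂ} (hC : C.IsHermitian), matLog C = CFC.log C := by
    intro C hC
    unfold matLog matFun CFC.log
    rw [dif_pos hC, hC.cfc_eq]
    rfl
  rw [e hA.1, e hB]
  exact CFC.log_le_log h (Matrix.isStrictlyPositive_iff_posDef.mpr hA)
end logmono

lemma posDef_add_eps {A : Matrix ι ι ℂ} (hA : A.PosSemidef) {ε : ℝ} (hε : 0 < ε) :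
    (A + (ε : ℂ) • 1).PosDef :=
  Matrix.PosDef.posSemidef_add hA (PosDef.one.smul (by exact_mod_cast hε))

/-- regularised cross term converges -/
lemma cross_tendsto {A T : Matrix ι ι ℂ} (hA : A.PosSemidef) (hT : T.PosSemidef)
    (h : SuppLE A T) :
    Tendsto (fun ε : ℝ => rtr (A * matLog (T + (ε : ℂ) • 1))) (nhdsWithin 0 (Set.Ioi 0))
      (nhds (rtr (A * matLog T))) := by
  obtain ⟨U, hU, p, hp, rfl⟩ := exists_ud_psd hA
  obtain ⟨V, hV, q, hq, rfl⟩ := exists_ud_psd hT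
  have e : ∀ ε : ℝ, ud V q + (ε : ℂ) • 1 = ud V (fun i => q i + ε) := by
    intro ε; rw [← ud_const hV, ud_add]
  simp only [e, matLog_ud hV, rtr_ud_mul_ud]
  refine tendsto_finsetSum _ fun i _ => tendsto_finsetSum _ fun j _ => ?_
  rcases (hq j).eq_or_lt with h0 | h0
  · rcases suppLE_ud hU hV h i j h0.symm with h1 | h1
    · simp [h1]
    · simp [h1]
  · refine Tendsto.const_mul _ (Tendsto.const_mul _ ?_)
    have : ContinuousAt (fun ε : ℝ => Real.log (q j + ε)) 0 := by
      refine ContinuousAt.log (by fun_prop) (by simpa using h0.ne')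
    have h2 := this.tendsto
    simp only [add_zero] at h2
    exact h2.mono_left nhdsWithin_le_nhds

lemma rtr_log_mono {C A T : Matrix ι ι ℂ} (hC : C.PosSemidef) (hA : A.PosSemidef)
    (hT : T.PosSemidef) (h : A ≤ T) (hs : SuppLE C A) :
    rtr (C * matLog A) ≤ rtr (C * matLog T) := by
  refine le_of_tendsto_of_tendsto (cross_tendsto hC hA hs)
    (cross_tendsto hC hT (suppLE_trans hs (suppLE_of_le hA hT h))) ?_
  filter_upwards [self_mem_nhdsWithin] with ε hε
  exact rtr_mul_mono hC (matLog_mono (posDef_add_eps hA hε) (by gcongr))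

lemma vnEnt_add_le {A B : Matrix ι ι ℂ} (hA : A.PosSemidef) (hB : B.PosSemidef) :
    vnEnt (A + B) ≤ vnEnt A + vnEnt B := by
  have hT := hA.add hB
  have h1 := rtr_log_mono hA hA hT (le_add_right_psd hB) (suppLE_self _)
  have h2 := rtr_log_mono hB hB hT (by rw [add_comm]; exact le_add_right_psd hA) (suppLE_self _)
  rw [vnEnt_eq, vnEnt_eq, vnEnt_eq, Matrix.add_mul, rtr_add]
  linarith

lemma vnEnt_sum_le {κ : Type*} (s : Finset κ) {A : κ → Matrix ι ι ℂ}
    (hA : ∀ k, (A k).PosSemidef) : vnEnt (∑ k ∈ s, A k) ≤ ∑ k ∈ s, vnEnt (A k) := by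
  induction s using Finset.induction_on with
  | empty => simp [vnEnt_zero]
  | insert a s ha ih =>
    rw [Finset.sum_insert ha, Finset.sum_insert ha]
    exact (vnEnt_add_le (hA a) (psd_sum' s fun k _ => hA k)).trans (by linarith)

end Entropy

section TraceNorm
variable {ι : Type*} [Fintype ι] [DecidableEq ι]

lemma traceNorm_ud {U : Matrix ι ι ℂ} (hU : U ∈ unitaryGroup ι ℂ) (d : ι → ℝ) :
    traceNorm (ud U d) = ∑ i, |d i| := by
  unfold traceNorm
  rw [(ud_isHermitian U d).eq, ud_mul hU, matFun_ud hU, trace_ud hU, Complex.ofReal_re]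
  refine Finset.sum_congr rfl fun i _ => ?_
  exact Real.sqrt_mul_self_eq_abs _

/-- positive / negative part decomposition -/
lemma exists_parts {A : Matrix ι ι ℂ} (hA : A.IsHermitian) :
    ∃ P N : Matrix ι ι ℂ, P.PosSemidef ∧ N.PosSemidef ∧ A = P - N ∧
      rtr P + rtr N = traceNorm A := by
  obtain ⟨U, hU, d, rfl⟩ := exists_ud hA
  refine ⟨ud U (fun i => max (d i) 0), ud U (fun i => max (-d i) 0), ud_psd _ (by simp),
    ud_psd _ (by simp), ?_, ?_⟩
  · rw [ud_sub]
    congr 1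
    funext i
    rcases le_total 0 (d i) with h | h
    · rw [max_eq_left h, max_eq_right (by linarith)]; ring
    · rw [max_eq_right h, max_eq_left (by linarith)]; ring
  · rw [rtr_ud hU, rtr_ud hU, traceNorm_ud hU, ← Finset.sum_add_distrib]
    refine Finset.sum_congr rfl fun i _ => ?_
    rcases le_total 0 (d i) with h | h
    · rw [max_eq_left h, max_eq_right (by linarith), abs_of_nonneg h]; ring
    · rw [max_eq_right h, max_eq_left (by linarith), abs_of_nonpos h]; ring

/-- `S` is a Hermitian involution attaining the trace norm. -/
lemma exists_sign {A : Matrix ι ι ℂ} (hA : A.IsHermitian) :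
    ∃ S : Matrix ι ι ℂ, S.IsHermitian ∧ S * S = 1 ∧ traceNorm A = rtr (S * A) := by
  obtain ⟨U, hU, d, rfl⟩ := exists_ud hA
  refine ⟨ud U (fun i => if 0 ≤ d i then 1 else -1), ud_isHermitian _ _, ?_, ?_⟩
  · rw [ud_mul hU, ← ud_one hU]
    congr 1; funext i; split_ifs <;> norm_num
  · rw [ud_mul hU, rtr_ud hU, traceNorm_ud hU]
    refine Finset.sum_congr rfl fun i _ => ?_
    split_ifs with h
    · rw [abs_of_nonneg h, one_mul]
    · rw [abs_of_neg (not_le.mp h)]; ring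

end TraceNorm

end CovertPaper

end

end

section
open Matrix Filter
open scoped Kronecker Classical ComplexOrder MatrixOrder

noncomputable section
set_option linter.unusedSectionVars false
set_option linter.unusedVariables false

namespace CovertPaper

section DPI
variable {ι : Type*} [Fintype ι] [DecidableEq ι]

lemma trace_diag_mul (d : ι → ℂ) (A : Matrix ι ι ℂ) :
    (diagonal d * A).trace = ∑ i, d i * A i i := by
  simp [Matrix.trace, diagonal_mul]

lemma rtr_ud_mul (U : Matrix ι ι ℂ) (p : ι → ℝ) (A : Matrix ι ι ℂ) :
    rtr (ud U p * A) = ∑ i, p i * ((Uᴴ * A * U) i i).re := by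
  unfold rtr ud
  have : U * diagonal (fun i => (p i : ℂ)) * Uᴴ * A = U * (diagonal (fun i => (p i : ℂ)) * (Uᴴ * A)) := by
    simp only [Matrix.mul_assoc]
  rw [this, Matrix.trace_mul_comm, Matrix.mul_assoc, trace_diag_mul]
  simp

lemma scalar_var (p m : ℝ) (hm : 0 < m) (o y : ℂ) :
    2 * (p * (o * y).re) - m * Complex.normSq y ≤ Complex.normSq o * (p ^ 2 / m) := by
  have h1 : (o * y).re ^ 2 ≤ Complex.normSq o * Complex.normSq y := by
    rw [← Complex.normSq_mul, Complex.normSq_apply]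
    nlinarith [sq_nonneg (o * y).im]
  have hy := Complex.normSq_nonneg y
  have ho := Complex.normSq_nonneg o
  rw [mul_div_assoc', le_div_iff₀ hm]
  by_cases h0 : Complex.normSq y = 0
  · have : (o * y).re = 0 := by rw [h0, mul_zero] at h1; nlinarith
    rw [this, h0]; nlinarith [mul_nonneg ho (sq_nonneg p)]
  · have hy' : 0 < Complex.normSq y := lt_of_le_of_ne hy (Ne.symm h0)
    have h2 : 0 ≤ (p * (o * y).re - m * Complex.normSq y) ^ 2 := sq_nonneg _
    have h3 : p ^ 2 * (o * y).re ^ 2 ≤ p ^ 2 * (Complex.normSq o * Complex.normSq y) :=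
      mul_le_mul_of_nonneg_left h1 (sq_nonneg p)
    have h4 : (2 * (p * (o * y).re) - m * Complex.normSq y) * m * Complex.normSq y ≤
      Complex.normSq o * p ^ 2 * Complex.normSq y := by nlinarith
    exact le_of_mul_le_mul_right h4 hy'

lemma var_bound {U V : Matrix ι ι ℂ} (hU : U ∈ unitaryGroup ι ℂ) (hV : V ∈ unitaryGroup ι ℂ)
    (p q : ι → ℝ) (a b : ℝ) (hm : ∀ i j, 0 < a * q j + b * p i) {X : Matrix ι ι ℂ}
    (hX : X.IsHermitian) :
    2 * rtr (ud U p * X) - (a * rtr (ud V q * (X * X)) + b * rtr (ud U p * (X * X))) ≤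
      ∑ i, ∑ j, ov U V i j * (p i ^ 2 / (a * q j + b * p i)) := by
  set Y := Vᴴ * X * U with hY
  have hYc : Yᴴ = Uᴴ * X * V := by
    rw [hY, conjTranspose_mul, conjTranspose_mul, conjTranspose_conjTranspose, hX.eq,
      Matrix.mul_assoc]
  have e1 : Uᴴ * X * U = (Uᴴ * V) * Y := by
    rw [hY]
    calc Uᴴ * X * U = Uᴴ * 1 * X * U := by rw [Matrix.mul_one]
      _ = Uᴴ * (V * Vᴴ) * X * U := by rw [uni_r hV]
      _ = _ := by simp only [Matrix.mul_assoc]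
  have e2 : Vᴴ * (X * X) * V = Y * Yᴴ := by
    rw [hYc, hY]
    calc Vᴴ * (X * X) * V = Vᴴ * (X * 1 * X) * V := by rw [Matrix.mul_one]
      _ = Vᴴ * (X * (U * Uᴴ) * X) * V := by rw [uni_r hU]
      _ = _ := by simp only [Matrix.mul_assoc]
  have e3 : Uᴴ * (X * X) * U = Yᴴ * Y := by
    rw [hYc, hY]
    calc Uᴴ * (X * X) * U = Uᴴ * (X * 1 * X) * U := by rw [Matrix.mul_one]
      _ = Uᴴ * (X * (V * Vᴴ) * X) * U := by rw [uni_r hV]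
      _ = _ := by simp only [Matrix.mul_assoc]
  have f2 : ∀ j, ((Y * Yᴴ) j j).re = ∑ i, Complex.normSq (Y j i) := by
    intro j
    rw [Matrix.mul_apply, Complex.re_sum]
    refine Finset.sum_congr rfl fun i _ => ?_
    rw [conjTranspose_apply, RCLike.star_def, Complex.mul_conj, Complex.ofReal_re]
  have f3 : ∀ i, ((Yᴴ * Y) i i).re = ∑ j, Complex.normSq (Y j i) := by
    intro j
    rw [Matrix.mul_apply, Complex.re_sum]
    refine Finset.sum_congr rfl fun i _ => ?_
    rw [conjTranspose_apply, RCLike.star_def, mul_comm, Complex.mul_conj, Complex.ofReal_re]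
  have f1 : ∀ i, (((Uᴴ * V) * Y) i i).re = ∑ j, ((Uᴴ * V) i j * Y j i).re := by
    intro j
    rw [Matrix.mul_apply, Complex.re_sum]
  rw [rtr_ud_mul, rtr_ud_mul, rtr_ud_mul, e1, e2, e3]
  simp only [f1, f2, f3, Finset.mul_sum]
  rw [Finset.sum_comm (f := fun j i => a * (q j * Complex.normSq (Y j i))),
    ← Finset.sum_add_distrib, ← Finset.sum_sub_distrib]
  refine Finset.sum_le_sum fun i _ => ?_
  rw [← Finset.sum_add_distrib, ← Finset.sum_sub_distrib]
  refine Finset.sum_le_sum fun j _ => ?_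
  have := scalar_var (p i) (a * q j + b * p i) (hm i j) ((Uᴴ * V) i j) (Y j i)
  unfold ov
  linarith

lemma comm_psd_mul {Λ : Matrix ι ι ℂ} (h0 : Λ.PosSemidef) (h1 : (1 - Λ).PosSemidef) :
    (Λ * (1 - Λ)).PosSemidef := by
  obtain ⟨U, hU, d, hd, rfl⟩ := exists_ud_psd h0
  have e : 1 - ud U d = ud U (fun i => 1 - d i) := by rw [← ud_one hU, ud_sub]
  have hd1 : ∀ i, d i ≤ 1 := by
    intro i
    rw [e] at h1
    have := h1.conjTranspose_mul_mul_same U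
    unfold ud at this
    have e2 : Uᴴ * (U * diagonal (fun i => ((1 - d i : ℝ) : ℂ)) * Uᴴ) * U
        = (Uᴴ * U) * diagonal (fun i => ((1 - d i : ℝ) : ℂ)) * (Uᴴ * U) := by
      simp only [Matrix.mul_assoc]
    rw [e2, uni_l hU, Matrix.one_mul, Matrix.mul_one] at this
    have h3 := this.diag_nonneg (i := i)
    rw [diagonal_apply_eq, Complex.le_def] at h3
    simpa using h3.1
  rw [e, ud_mul hU]
  exact ud_psd _ (fun i => mul_nonneg (hd i) (sub_nonneg.mpr (hd1 i)))

lemma sq_combo_le {Λ : Matrix ι ι ℂ} (h0 : Λ.PosSemidef) (h1 : (1 - Λ).PosSemidef) (c c' : ℝ) :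
    ((c : ℂ) • Λ + (c' : ℂ) • (1 - Λ)) * ((c : ℂ) • Λ + (c' : ℂ) • (1 - Λ)) ≤
      ((c ^ 2 : ℝ) : ℂ) • Λ + ((c' ^ 2 : ℝ) : ℂ) • (1 - Λ) := by
  rw [Matrix.le_iff]
  have := psd_ofReal_smul (sq_nonneg (c - c')) (comm_psd_mul h0 h1)
  have e : ((c ^ 2 : ℝ) : ℂ) • Λ + ((c' ^ 2 : ℝ) : ℂ) • (1 - Λ) -
      ((c : ℂ) • Λ + (c' : ℂ) • (1 - Λ)) * ((c : ℂ) • Λ + (c' : ℂ) • (1 - Λ))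
      = (((c - c') ^ 2 : ℝ) : ℂ) • (Λ * (1 - Λ)) := by
    simp only [Matrix.mul_sub, Matrix.sub_mul, Matrix.mul_add, Matrix.add_mul, Matrix.mul_one,
      Matrix.one_mul, smul_sub, Matrix.smul_mul, Matrix.mul_smul, smul_add, smul_smul]
    ext i j
    simp only [Matrix.sub_apply, Matrix.add_apply, Matrix.smul_apply, smul_eq_mul]
    push_cast
    ring
  rw [e]
  exact this

/-- Binary data processing inequality (for `σ` positive definite). -/
lemma binary_dpi {ρ σ Λ : Matrix ι ι ℂ} (hρ : ρ.PosSemidef) (hσ : σ.PosDef)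
    (h0 : Λ.PosSemidef) (h1 : (1 - Λ).PosSemidef) :
    rtr (ρ * Λ) * Real.log (rtr (ρ * Λ)) + rtr (ρ * (1 - Λ)) * Real.log (rtr (ρ * (1 - Λ)))
     - rtr (ρ * Λ) * Real.log (rtr (σ * Λ)) - rtr (ρ * (1 - Λ)) * Real.log (rtr (σ * (1 - Λ)))
      ≤ - vnEnt ρ - rtr (ρ * matLog σ) := by
  have hP := rtr_mul_nonneg hρ h0
  have hP' := rtr_mul_nonneg hρ h1
  have hQ := rtr_mul_nonneg hσ.posSemidef h0
  have hQ' := rtr_mul_nonneg hσ.posSemidef h1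
  have hsumP : rtr (ρ * Λ) + rtr (ρ * (1 - Λ)) = rtr ρ := by
    rw [← rtr_add, ← Matrix.mul_add]; simp
  -- vanishing implies vanishing
  have hz : ∀ M : Matrix ι ι ℂ, M.PosSemidef → rtr (σ * M) = 0 → M = 0 := by
    intro M hM h
    obtain ⟨V, hV, q, rfl⟩ := exists_ud hσ.1
    have hq : ∀ i, 0 < q i := by
      intro i
      have := hσ.conjTranspose_mul_mul_same (B := V) (by
        intro x y hxy
        have : Vᴴ.mulVec (V.mulVec x) = Vᴴ.mulVec (V.mulVec y) := congrArg _ hxy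
        rwa [Matrix.mulVec_mulVec, Matrix.mulVec_mulVec, uni_l hV, Matrix.one_mulVec,
          Matrix.one_mulVec] at this)
      unfold ud at this
      have e2 : Vᴴ * (V * diagonal (fun i => (q i : ℂ)) * Vᴴ) * V
        = (Vᴴ * V) * diagonal (fun i => (q i : ℂ)) * (Vᴴ * V) := by
        simp only [Matrix.mul_assoc]
      rw [e2, uni_l hV, Matrix.one_mul, Matrix.mul_one] at this
      have h3 := this.diag_pos (i := i)
      rw [diagonal_apply_eq, Complex.lt_def] at h3
      simpa using h3.1
    obtain ⟨U, hU, d, hd, rfl⟩ := exists_ud_psd hM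
    rw [rtr_comm, rtr_ud_mul_ud] at h
    rw [Finset.sum_eq_zero_iff_of_nonneg (fun i _ => Finset.sum_nonneg fun j _ =>
      mul_nonneg (ov_nonneg _ _ _ _) (mul_nonneg (hd i) (hq j).le))] at h
    apply psd_zero_of_rtr (ud_psd U hd)
    rw [rtr_ud hU]
    refine Finset.sum_eq_zero fun i _ => ?_
    have hi := h i (Finset.mem_univ _)
    rw [Finset.sum_eq_zero_iff_of_nonneg (fun j _ =>
      mul_nonneg (ov_nonneg _ _ _ _) (mul_nonneg (hd i) (hq j).le))] at hi
    rw [← one_mul (d i), ← ov_row hU hV i, Finset.sum_mul]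
    refine Finset.sum_eq_zero fun j _ => ?_
    have hj := hi j (Finset.mem_univ _)
    have := (hq j).ne'
    rcases mul_eq_zero.mp hj with h | h
    · rw [h, zero_mul]
    · rw [(mul_eq_zero.mp h).resolve_right this, mul_zero]
  have hz1 : rtr (σ * Λ) = 0 → rtr (ρ * Λ) = 0 := by
    intro h; rw [hz Λ h0 h]; simp [rtr_zero]
  have hz2 : rtr (σ * (1 - Λ)) = 0 → rtr (ρ * (1 - Λ)) = 0 := by
    intro h; rw [hz _ h1 h]; simp [rtr_zero]
  obtain ⟨U, hU, p, hp, rfl⟩ := exists_ud_psd hρ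
  obtain ⟨V, hV, q, hσe⟩ := exists_ud hσ.1
  have hq : ∀ i, 0 < q i := by
    intro i
    by_contra hcon
    push Not at hcon
    have hpsd : (Matrix.vecMulVec (fun a => V a i) (star fun a => V a i)).PosSemidef :=
      Matrix.posSemidef_vecMulVec_self_star _
    have hnn : rtr (σ * Matrix.vecMulVec (fun a => V a i) (star fun a => V a i)) = q i := by
      have e : Matrix.vecMulVec (fun a => V a i) (star fun a => V a i)
          = ud V (fun j => if j = i then 1 else 0) := by
        ext a b
        unfold ud
        rw [Matrix.mul_apply, Finset.sum_eq_single i]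
        · simp [Matrix.vecMulVec_apply]
        · intro j _ hj; simp [hj]
        · simp
      rw [e, hσe, ud_mul hV, rtr_ud hV]
      simp
    have h5 := rtr_mul_nonneg hσ.posSemidef hpsd
    rw [hnn] at h5
    have h6 := hz _ hpsd (by rw [hnn]; linarith)
    have h7 : rtr (Matrix.vecMulVec (fun a => V a i) (star fun a => V a i)) = 1 := by
      have := uni_col_sum hV i
      rw [← this]
      unfold rtr
      simp only [Matrix.trace, diag_apply, Matrix.vecMulVec_apply, Pi.star_apply, RCLike.star_def,
        Complex.mul_conj, Complex.re_sum, Complex.ofReal_re]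
    rw [h6, rtr_zero] at h7
    norm_num at h7
  subst hσe
  set P := rtr (ud U p * Λ) with hPd
  set P' := rtr (ud U p * (1 - Λ)) with hPd'
  set Q := rtr (ud V q * Λ) with hQd
  set Q' := rtr (ud V q * (1 - Λ)) with hQd'
  let Φ : ℝ → ℝ := fun u => (∑ i, ∑ j, ov U V i j * (p i * Real.log ((1 - u) * q j + u * p i)))
    - (P * Real.log ((1 - u) * Q + u * P) + P' * Real.log ((1 - u) * Q' + u * P'))
  have hlin : ∀ (c d : ℝ) (u : ℝ), HasDerivAt (fun u : ℝ => (1 - u) * c + u * d) (d - c) u := by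
    intro c d u
    have := (((hasDerivAt_id u).const_sub 1).mul_const c).add ((hasDerivAt_id u).mul_const d)
    refine HasDerivAt.congr_deriv this ?_
    ring
  have hpos : ∀ (c d u : ℝ), 0 < c → 0 ≤ d → (d = 0 ∨ u ≤ 1) → 0 ≤ u → u ≤ 1 → d ≠ 0 →
      0 < (1 - u) * c + u * d := by
    intro c d u hc hd _ hu hu1 hd0
    have hd' : 0 < d := lt_of_le_of_ne hd (Ne.symm hd0)
    rcases hu.eq_or_lt with h | h
    · rw [← h]; simpa using hc
    · have : 0 ≤ (1 - u) * c := mul_nonneg (by linarith) hc.le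
      have : 0 < u * d := mul_pos h hd'
      linarith
  have hterm : ∀ (c d u : ℝ), 0 ≤ c → (c = 0 → d = 0) → 0 ≤ d → 0 ≤ u → u ≤ 1 →
      HasDerivAt (fun u : ℝ => d * Real.log ((1 - u) * c + u * d))
        (d * (d - c) / ((1 - u) * c + u * d)) u := by
    intro c d u hc hcd hd hu hu1
    by_cases hd0 : d = 0
    · subst hd0; simpa using hasDerivAt_const u (0:ℝ)
    · have hc' : 0 < c := lt_of_le_of_ne hc (fun h => hd0 (hcd h.symm))
      have := ((hlin c d u).log (hpos c d u hc' hd (Or.inr hu1) hu hu1 hd0).ne').const_mul d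
      refine HasDerivAt.congr_deriv this ?_
      ring
  have hΦ : ∀ u : ℝ, 0 ≤ u → u ≤ 1 → HasDerivAt Φ
      ((∑ i, ∑ j, ov U V i j * (p i * (p i - q j) / ((1 - u) * q j + u * p i)))
        - (P * (P - Q) / ((1 - u) * Q + u * P) + P' * (P' - Q') / ((1 - u) * Q' + u * P'))) u := by
    intro u hu hu1
    refine HasDerivAt.sub (HasDerivAt.fun_sum fun i _ => HasDerivAt.fun_sum fun j _ =>
      HasDerivAt.const_mul _ ?_) (HasDerivAt.add ?_ ?_)
    · exact hterm _ _ _ (hq j).le (fun h => absurd h (hq j).ne') (hp i) hu hu1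
    · exact hterm _ _ _ hQ hz1 hP hu hu1
    · exact hterm _ _ _ hQ' hz2 hP' hu hu1
  have hmono : MonotoneOn Φ (Set.Icc 0 1) := by
    apply monotoneOn_of_deriv_nonneg (convex_Icc _ _)
    · exact fun t ht => (hΦ t ht.1 ht.2).continuousAt.continuousWithinAt
    · intro t ht
      rw [interior_Icc] at ht
      exact (hΦ t ht.1.le ht.2.le).differentiableAt.differentiableWithinAt
    · intro t ht
      rw [interior_Icc] at ht
      rw [(hΦ t ht.1.le ht.2.le).deriv]
      have ht1 : 0 < 1 - t := by linarith [ht.2]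
      have hm : ∀ i j, 0 < (1 - t) * q j + t * p i := fun i j => by
        have := mul_pos ht1 (hq j)
        have := mul_nonneg ht.1.le (hp i)
        linarith
      -- rewriting of the terms
      have key : ∀ c d : ℝ, 0 ≤ c → (c = 0 → d = 0) → 0 ≤ d →
          d * (d - c) / ((1 - t) * c + t * d) = (1 - t)⁻¹ * (d ^ 2 / ((1 - t) * c + t * d) - d) := by
        intro c d hc hcd hd
        by_cases hd0 : d = 0
        · subst hd0; simp
        · have hc' : 0 < c := lt_of_le_of_ne hc (fun h => hd0 (hcd h.symm))
          have := hpos c d t hc' hd (Or.inr ht.2.le) ht.1.le ht.2.le hd0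
          obtain ⟨m, hm⟩ : ∃ m, m = (1 - t) * c + t * d := ⟨_, rfl⟩
          rw [← hm] at this ⊢
          have h9 : (1 - t) * (d - c) = d - m := by rw [hm]; ring
          field_simp
          linear_combination h9
      rw [key Q P hQ hz1 hP, key Q' P' hQ' hz2 hP']
      have e1 : ∑ i, ∑ j, ov U V i j * (p i * (p i - q j) / ((1 - t) * q j + t * p i))
          = (1 - t)⁻¹ * ((∑ i, ∑ j, ov U V i j * (p i ^ 2 / ((1 - t) * q j + t * p i)))
            - ∑ i, p i) := by
        rw [sum_ov_left hU hV p, ← Finset.sum_sub_distrib, Finset.mul_sum]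
        refine Finset.sum_congr rfl fun i _ => ?_
        rw [← Finset.sum_sub_distrib, Finset.mul_sum]
        refine Finset.sum_congr rfl fun j _ => ?_
        rw [key (q j) (p i) (hq j).le (fun h => absurd h (hq j).ne') (hp i)]
        ring
      rw [e1]
      rw [rtr_ud hU] at hsumP
      have hX : ((((P / ((1 - t) * Q + t * P) : ℝ)) : ℂ) • Λ +
          ((P' / ((1 - t) * Q' + t * P') : ℝ) : ℂ) • (1 - Λ)).IsHermitian := by
        exact ((psd_ofReal_smul (div_nonneg hP (add_nonneg (mul_nonneg ht1.le hQ)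
          (mul_nonneg ht.1.le hP))) h0).add (psd_ofReal_smul (div_nonneg hP'
          (add_nonneg (mul_nonneg ht1.le hQ') (mul_nonneg ht.1.le hP'))) h1)).1
      have hv := var_bound hU hV p q (1 - t) t hm hX
      have hsq := sq_combo_le h0 h1 (P / ((1 - t) * Q + t * P)) (P' / ((1 - t) * Q' + t * P'))
      have g1 := rtr_mul_mono hσ.posSemidef hsq
      have g2 := rtr_mul_mono hρ hsq
      have hcombo : ∀ (A : Matrix ι ι ℂ) (c c' : ℝ), rtr (A * ((c : ℂ) • Λ + (c' : ℂ) • (1 - Λ)))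
          = c * rtr (A * Λ) + c' * rtr (A * (1 - Λ)) := by
        intro A c c'
        rw [Matrix.mul_add, Matrix.mul_smul, Matrix.mul_smul, rtr_add, rtr_smul, rtr_smul]
      rw [hcombo] at g1 g2
      rw [hcombo] at hv
      rw [← hPd, ← hPd'] at g2
      rw [← hPd, ← hPd'] at hv
      rw [← hQd, ← hQd'] at g1
      have fin : ∀ c d : ℝ, 0 ≤ c → (c = 0 → d = 0) → 0 ≤ d →
          d ^ 2 / ((1 - t) * c + t * d) = 2 * (d / ((1 - t) * c + t * d) * d)
           - ((1 - t) * ((d / ((1 - t) * c + t * d)) ^ 2 * c) +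
            t * ((d / ((1 - t) * c + t * d)) ^ 2 * d)) := by
        intro c d hc hcd hd
        by_cases hd0 : d = 0
        · subst hd0; simp
        · have hc' : 0 < c := lt_of_le_of_ne hc (fun h => hd0 (hcd h.symm))
          have := hpos c d t hc' hd (Or.inr ht.2.le) ht.1.le ht.2.le hd0
          obtain ⟨m, hm⟩ : ∃ m, m = (1 - t) * c + t * d := ⟨_, rfl⟩
          rw [← hm] at this ⊢
          have h9 : c * (1 - t) = m - t * d := by rw [hm]; ring
          field_simp
          linear_combination h9
      have f1 := fin Q P hQ hz1 hP
      have f2 := fin Q' P' hQ' hz2 hP'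
      have g1' := mul_le_mul_of_nonneg_left g1 ht1.le
      have g2' := mul_le_mul_of_nonneg_left g2 ht.1.le
      rw [← hsumP, ← mul_add, ← mul_sub]
      refine mul_nonneg (inv_nonneg.mpr ht1.le) ?_
      rw [f1, f2]
      linarith
  have hfin := hmono (Set.left_mem_Icc.mpr zero_le_one) (Set.right_mem_Icc.mpr zero_le_one)
    zero_le_one
  simp only [Φ, sub_zero, one_mul, zero_mul, add_zero, sub_self, zero_add] at hfin
  rw [vnEnt_ud hU, matLog_ud hV, rtr_ud_mul_ud, neg_neg,
    sum_ov_left hU hV (fun i => p i * Real.log (p i))]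
  linarith

end DPI

end CovertPaper

end

end

section
open Matrix Filter
open scoped Kronecker Classical ComplexOrder MatrixOrder

noncomputable section
set_option linter.unusedSectionVars false
set_option linter.unusedVariables false

namespace CovertPaper

section Fano
variable {ι : Type*} [Fintype ι] [DecidableEq ι]

lemma scalar_gibbs {P P' Q Q' t : ℝ} (hP : 0 ≤ P) (hP' : 0 ≤ P') (hQ : 0 ≤ Q) (hQ' : 0 ≤ Q')
    (hs : P + P' = 1) (h : Q = 0 → P = 0) (h' : Q' = 0 → P' = 0) :
    t * P - Real.log (Real.exp t * Q + Q') ≤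
      P * Real.log P + P' * Real.log P' - P * Real.log Q - P' * Real.log Q' := by
  set Z := Real.exp t * Q + Q' with hZ
  have he := Real.exp_pos t
  have hZ0 : 0 < Z := by
    rcases hQ.eq_or_lt with h1 | h1
    · have hp := h h1.symm
      have : Q' ≠ 0 := fun h2 => by have := h' h2; linarith
      have : 0 < Q' := lt_of_le_of_ne hQ' (Ne.symm this)
      rw [hZ]; nlinarith [mul_nonneg he.le hQ]
    · rw [hZ]; nlinarith [mul_pos he h1]
  have k1 : P - Real.exp t * Q / Z ≤ P * Real.log P - P * Real.log Q - P * t + P * Real.log Z := by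
    rcases hQ.eq_or_lt with h1 | h1
    · rw [h h1.symm, ← h1]; simp
    · have := scalar_klein hP (div_pos (mul_pos he h1) hZ0)
      rw [Real.log_div (mul_pos he h1).ne' hZ0.ne', Real.log_mul he.ne' h1.ne', Real.log_exp] at this
      linarith
  have k2 : P' - Q' / Z ≤ P' * Real.log P' - P' * Real.log Q' + P' * Real.log Z := by
    rcases hQ'.eq_or_lt with h1 | h1
    · rw [h' h1.symm, ← h1]; simp
    · have := scalar_klein hP' (div_pos h1 hZ0)
      rw [Real.log_div h1.ne' hZ0.ne'] at this
      linarith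
  have k3 : Real.exp t * Q / Z + Q' / Z = 1 := by rw [← add_div, ← hZ, div_self hZ0.ne']
  have k4 : P * Real.log Z + P' * Real.log Z = Real.log Z := by rw [← add_mul, hs, one_mul]
  linarith

lemma linear_dpi {ρ σ Λ : Matrix ι ι ℂ} (hρ : IsDensity ρ) (hσ : IsDensity σ) (hs : SuppLE ρ σ)
    (h0 : Λ.PosSemidef) (h1 : (1 - Λ).PosSemidef) {t : ℝ} (ht : 0 ≤ t) :
    t * rtr (ρ * Λ) - Real.log (1 + (Real.exp t - 1) * rtr (σ * Λ)) ≤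
      - vnEnt ρ - rtr (ρ * matLog σ) := by
  have hlim := (cross_tendsto hρ.1 hσ.1 hs).const_sub (- vnEnt ρ)
  have hQ := rtr_mul_nonneg hσ.1 h0
  have hpos : 0 < 1 + (Real.exp t - 1) * rtr (σ * Λ) := by
    have : 0 ≤ Real.exp t - 1 := by have := Real.add_one_le_exp t; linarith
    nlinarith [mul_nonneg this hQ]
  have hsum : ∀ A : Matrix ι ι ℂ, rtr (A * (1 - Λ)) = rtr A - rtr (A * Λ) := by
    intro A; rw [Matrix.mul_sub, Matrix.mul_one, rtr_sub]
  have hexp : ∀ (ε : ℝ) (M : Matrix ι ι ℂ), rtr ((σ + (ε : ℂ) • 1) * M) = rtr (σ * M) + ε * rtr M := by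
    intro ε M; rw [Matrix.add_mul, rtr_add, Matrix.smul_mul, rtr_smul, Matrix.one_mul]
  have hlim2 : Tendsto (fun ε : ℝ => t * rtr (ρ * Λ) - Real.log (Real.exp t * rtr ((σ + (ε : ℂ) • 1) * Λ)
      + rtr ((σ + (ε : ℂ) • 1) * (1 - Λ)))) (nhdsWithin 0 (Set.Ioi 0))
      (nhds (t * rtr (ρ * Λ) - Real.log (1 + (Real.exp t - 1) * rtr (σ * Λ)))) := by
    refine Tendsto.const_sub _ ?_
    simp only [hexp]
    have e : 1 + (Real.exp t - 1) * rtr (σ * Λ) = Real.exp t * (rtr (σ * Λ) + 0 * rtr Λ) +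
      (rtr (σ * (1 - Λ)) + 0 * rtr (1 - Λ)) := by
      rw [hsum σ, rtr_density hσ]; ring
    have hc : ContinuousAt (fun ε : ℝ => Real.log (Real.exp t * (rtr (σ * Λ) + ε * rtr Λ) +
      (rtr (σ * (1 - Λ)) + ε * rtr (1 - Λ)))) 0 := by
      refine ContinuousAt.log (by fun_prop) ?_
      rw [← e]; exact hpos.ne'
    have := hc.tendsto
    rw [← e] at this
    exact this.mono_left nhdsWithin_le_nhds
  refine le_of_tendsto_of_tendsto hlim2 hlim ?_
  filter_upwards [self_mem_nhdsWithin] with ε hε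
  have hε' : 0 < ε := hε
  have hpd := posDef_add_eps hσ.1 hε'
  refine le_trans ?_ (binary_dpi hρ.1 hpd h0 h1)
  have hz : ∀ M : Matrix ι ι ℂ, M.PosSemidef → rtr ((σ + (ε : ℂ) • 1) * M) = 0 → rtr (ρ * M) = 0 := by
    intro M hM h
    rw [hexp] at h
    have : rtr M = 0 := by
      have a := rtr_mul_nonneg hσ.1 hM
      have b := rtr_nonneg hM
      have : ε * rtr M = 0 := by nlinarith [mul_nonneg hε'.le b]
      exact (mul_eq_zero.mp this).resolve_left hε'.ne'
    rw [psd_zero_of_rtr hM this]; simp [rtr_zero]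
  exact scalar_gibbs (rtr_mul_nonneg hρ.1 h0) (rtr_mul_nonneg hρ.1 h1)
    (rtr_mul_nonneg hpd.posSemidef h0) (rtr_mul_nonneg hpd.posSemidef h1)
    (by rw [hsum, rtr_density hρ]; ring) (hz _ h0) (hz _ h1)

lemma le_of_psd_sub {A B : Matrix ι ι ℂ} (h : (B - A).PosSemidef) : A ≤ B := Matrix.le_iff.mpr h

lemma psd_nonneg {A : Matrix ι ι ℂ} (h : A.PosSemidef) : 0 ≤ A := Matrix.nonneg_iff_posSemidef.mpr h

lemma avg_density {κ : Type*} [Fintype κ] {ρ : κ → Matrix ι ι ℂ} (hρ : ∀ k, IsDensity (ρ k))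
    {c : ℝ} (hc : c * Fintype.card κ = 1) : IsDensity ((c : ℂ) • ∑ k, ρ k) := by
  have hc0 : 0 ≤ c := by
    by_contra hcon
    push Not at hcon
    have : c * (Fintype.card κ : ℝ) ≤ 0 := mul_nonpos_of_nonpos_of_nonneg hcon.le (by positivity)
    linarith
  refine ⟨psd_ofReal_smul hc0 (psd_sum' _ fun k _ => (hρ k).1), ?_⟩
  rw [Matrix.trace_smul, Matrix.trace_sum, Finset.sum_congr rfl (fun k _ => (hρ k).2)]
  simp only [Finset.sum_const, Finset.card_univ, nsmul_eq_mul, mul_one, smul_eq_mul]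
  exact_mod_cast hc

lemma suppLE_avg {κ : Type*} [Fintype κ] {ρ : κ → Matrix ι ι ℂ} (hρ : ∀ k, (ρ k).PosSemidef)
    {c : ℝ} (hc : c ≠ 0) (k : κ) : SuppLE (ρ k) ((c : ℂ) • ∑ k, ρ k) := by
  apply suppLE_smul_right hc
  exact suppLE_of_le (hρ k) (psd_sum' _ fun k _ => hρ k)
    (Finset.single_le_sum (f := ρ) (fun j _ => psd_nonneg (hρ j)) (Finset.mem_univ k))

lemma fano {κ : Type*} [Fintype κ] {ρ Λ : κ → Matrix ι ι ℂ} (hρ : ∀ k, IsDensity (ρ k))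
    (hΛ : ∀ k, (Λ k).PosSemidef) (hΛs : (1 - ∑ k, Λ k).PosSemidef) {c ε : ℝ}
    (hc : c * Fintype.card κ = 1) (herr : c * ∑ k, (1 - rtr (Λ k * ρ k)) ≤ ε) :
    (1 - ε) * Real.log (Fintype.card κ) - Real.log 2 ≤
      vnEnt ((c : ℂ) • ∑ k, ρ k) - c * ∑ k, vnEnt (ρ k) := by
  have hN0 : (0:ℝ) ≤ Fintype.card κ := by positivity
  have hNne : (Fintype.card κ : ℝ) ≠ 0 := fun h => by rw [h] at hc; simp at hc
  have hN1 : (1:ℝ) ≤ Fintype.card κ := by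
    have : Fintype.card κ ≠ 0 := by exact_mod_cast hNne
    exact_mod_cast Nat.one_le_iff_ne_zero.mpr this
  have hce : c = (Fintype.card κ : ℝ)⁻¹ := by field_simp; linarith
  have hc0 : 0 < c := by rw [hce]; positivity
  set N : ℝ := (Fintype.card κ : ℝ) with hN
  set T := (c : ℂ) • ∑ k, ρ k with hT
  have hTd : IsDensity T := avg_density hρ hc
  have hle : ∀ k, (1 - Λ k).PosSemidef := by
    intro k
    apply Matrix.le_iff.mp
    refine le_trans (Finset.single_le_sum (f := Λ) (fun j _ => psd_nonneg (hΛ j))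
      (Finset.mem_univ k)) (Matrix.le_iff.mpr hΛs)
  have hN0' : 0 < N := by linarith
  have h1 : ∀ k, Real.log N * rtr (ρ k * Λ k) - (Real.log 2 + (1 + (N - 1) * rtr (T * Λ k)) / 2 - 1)
      ≤ - vnEnt (ρ k) - rtr (ρ k * matLog T) := by
    intro k
    refine le_trans ?_ (linear_dpi (hρ k) hTd (suppLE_avg (fun k => (hρ k).1) hc0.ne' k) (hΛ k) (hle k)
      (Real.log_nonneg hN1))
    rw [Real.exp_log hN0']
    set z := 1 + (N - 1) * rtr (T * Λ k) with hz
    have hz0 : 0 < z := by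
      have := mul_nonneg (sub_nonneg.mpr hN1) (rtr_mul_nonneg hTd.1 (hΛ k))
      linarith
    have := Real.log_le_sub_one_of_pos (div_pos hz0 two_pos)
    rw [Real.log_div hz0.ne' two_ne_zero] at this
    linarith
  have h2 := mul_le_mul_of_nonneg_left (Finset.sum_le_sum fun k (_ : k ∈ Finset.univ) => h1 k) hc0.le
  have hq : ∑ k, rtr (T * Λ k) ≤ 1 := by
    rw [← rtr_sum, ← Matrix.mul_sum]
    refine (rtr_mul_mono hTd.1 (Matrix.le_iff.mpr hΛs)).trans ?_
    rw [Matrix.mul_one, rtr_density hTd]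
  have hv : vnEnt T = - (c * ∑ k, rtr (ρ k * matLog T)) := by
    rw [vnEnt_eq]; conv_lhs => rw [hT, Matrix.smul_mul, rtr_smul, Finset.sum_mul, rtr_sum]
  have e1 : c * ∑ k, (Real.log N * rtr (ρ k * Λ k)
      - (Real.log 2 + (1 + (N - 1) * rtr (T * Λ k)) / 2 - 1))
      = Real.log N * (c * ∑ k, rtr (ρ k * Λ k)) - (c * N) * (Real.log 2 - 1 / 2)
        - c * (N - 1) * (∑ k, rtr (T * Λ k)) / 2 := by
    simp only [Finset.sum_sub_distrib, Finset.sum_add_distrib, ← Finset.sum_div, ← Finset.mul_sum,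
      Finset.sum_const, Finset.card_univ, nsmul_eq_mul, ← hN]
    ring
  rw [e1, Finset.sum_sub_distrib, Finset.sum_neg_distrib, hc] at h2
  have e2 : c * ∑ k, rtr (ρ k * Λ k) ≥ 1 - ε := by
    rw [Finset.sum_sub_distrib, Finset.sum_const, Finset.card_univ, nsmul_eq_mul, mul_one, ← hN,
      mul_sub, hc] at herr
    simp only [rtr_comm (ρ _)]
    linarith
  have e3 : c * (N - 1) * (∑ k, rtr (T * Λ k)) ≤ 1 := by
    have a : c * (N - 1) ≤ 1 := by nlinarith
    have b : 0 ≤ c * (N - 1) := mul_nonneg hc0.le (by linarith)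
    nlinarith
  have e4 := mul_le_mul_of_nonneg_left e2 (Real.log_nonneg hN1)
  rw [hv]
  nlinarith

end Fano

end CovertPaper

end

end

section
open Matrix Filter
open scoped Kronecker Classical ComplexOrder MatrixOrder

noncomputable section
set_option linter.unusedSectionVars false
set_option linter.unusedVariables false

namespace CovertPaper

section Tensor
variable {β : Type*} [Fintype β] [DecidableEq β] {n : ℕ}

/-- Tensor product of a family of matrices. -/
def tens {β : Type*} {n : ℕ} (A : Fin n → Matrix β β ℂ) : Matrix (Fin n → β) (Fin n → β) ℂ :=
  of fun a b => ∏ i, A i (a i) (b i)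

lemma stringState_eq {d : ℕ} (ω : Fin d → Matrix β β ℂ) (x : Fin n → Fin d) :
    stringState ω x = tens (fun i => ω (x i)) := rfl

lemma tpow_eq (ω : Matrix β β ℂ) (n : ℕ) : tpow ω n = tens (fun _ : Fin n => ω) := rfl

lemma tens_apply (A : Fin n → Matrix β β ℂ) (a b : Fin n → β) :
    tens A a b = ∏ i, A i (a i) (b i) := rfl

lemma prod_sum_fun {γ R : Type*} [Fintype γ] [CommSemiring R] (f : Fin n → γ → R) :
    ∏ i, ∑ c, f i c = ∑ c : Fin n → γ, ∏ i, f i (c i) := by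
  rw [Finset.prod_univ_sum]; simp

lemma tens_mul (A B : Fin n → Matrix β β ℂ) : tens A * tens B = tens (fun i => A i * B i) := by
  ext a b
  simp only [Matrix.mul_apply, tens_apply, ← Finset.prod_mul_distrib]
  rw [prod_sum_fun]

lemma tens_ct (A : Fin n → Matrix β β ℂ) : (tens A)ᴴ = tens (fun i => (A i)ᴴ) := by
  ext a b
  simp [tens_apply, conjTranspose_apply]

lemma tens_diagonal (d : Fin n → β → ℂ) :
    tens (fun i => diagonal (d i)) = diagonal (fun a => ∏ i, d i (a i)) := by
  ext a b
  rw [tens_apply]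
  by_cases h : a = b
  · subst h; simp
  · rw [diagonal_apply_ne _ h]
    obtain ⟨i, hi⟩ := Function.ne_iff.mp h
    exact Finset.prod_eq_zero (Finset.mem_univ i) (diagonal_apply_ne _ hi)

lemma tens_one : tens (fun _ : Fin n => (1 : Matrix β β ℂ)) = 1 := by
  have := tens_diagonal (n := n) (fun _ (_ : β) => (1:ℂ))
  simpa using this

lemma tens_trace (A : Fin n → Matrix β β ℂ) : (tens A).trace = ∏ i, (A i).trace := by
  simp only [Matrix.trace, diag_apply, tens_apply]
  rw [prod_sum_fun]

lemma tens_unitary {U : Fin n → Matrix β β ℂ} (hU : ∀ i, U i ∈ unitaryGroup β ℂ) :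
    tens U ∈ unitaryGroup (Fin n → β) ℂ := by
  rw [Matrix.mem_unitaryGroup_iff, star_eq_conjTranspose, tens_ct, tens_mul]
  simp only [uni_r (hU _), tens_one]

lemma tens_ud (U : Fin n → Matrix β β ℂ) (d : Fin n → β → ℝ) :
    tens (fun i => ud (U i) (d i)) = ud (tens U) (fun a => ∏ i, d i (a i)) := by
  unfold ud
  rw [tens_ct, ← tens_mul, ← tens_mul, tens_diagonal]
  simp

lemma tens_psd {A : Fin n → Matrix β β ℂ} (hA : ∀ i, (A i).PosSemidef) : (tens A).PosSemidef := by
  choose U hU d hd he using fun i => exists_ud_psd (hA i)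
  have : A = fun i => ud (U i) (d i) := funext he
  rw [this, tens_ud]
  exact ud_psd _ fun a => Finset.prod_nonneg fun i _ => hd i _

lemma tens_density {A : Fin n → Matrix β β ℂ} (hA : ∀ i, IsDensity (A i)) : IsDensity (tens A) :=
  ⟨tens_psd fun i => (hA i).1, by rw [tens_trace]; simp [(hA _).2]⟩

lemma tens_sum {γ : Type*} [Fintype γ] (F : Fin n → γ → Matrix β β ℂ) :
    tens (fun i => ∑ y, F i y) = ∑ x : Fin n → γ, tens (fun i => F i (x i)) := by
  ext a b
  rw [Matrix.sum_apply]
  simp only [tens_apply, Matrix.sum_apply]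
  rw [prod_sum_fun]

lemma tens_smul (c : Fin n → ℝ) (A : Fin n → Matrix β β ℂ) :
    tens (fun i => (c i : ℂ) • A i) = ((∏ i, c i : ℝ) : ℂ) • tens A := by
  ext a b
  simp only [tens_apply, Matrix.smul_apply, smul_eq_mul, Finset.prod_mul_distrib]
  push_cast
  rfl

lemma tens_mono {A B : Fin n → Matrix β β ℂ} (hA : ∀ i, (A i).PosSemidef) (h : ∀ i, A i ≤ B i) :
    tens A ≤ tens B := by
  have e : B = fun i => ∑ y : Bool, (if y then A i else B i - A i) := by
    funext i; simp
  conv_rhs => rw [e, tens_sum]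
  have hp : ∀ x : Fin n → Bool, (tens fun i => (if x i then A i else B i - A i)).PosSemidef := by
    intro x
    apply tens_psd
    intro i
    split_ifs
    · exact hA i
    · exact Matrix.le_iff.mp (h i)
  have := Finset.single_le_sum (f := fun x : Fin n → Bool =>
    tens fun i => (if x i then A i else B i - A i)) (fun x _ => psd_nonneg (hp x))
    (Finset.mem_univ (fun _ => true))
  simpa using this

/-- measurement distribution in the basis `V` -/
def mdist (V A : Matrix β β ℂ) (b : β) : ℝ := ((Vᴴ * A * V) b b).re

lemma mdist_eq {V A : Matrix β β ℂ} (hA : A.PosSemidef) (b : β) :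
    (Vᴴ * A * V) b b = (mdist V A b : ℂ) := by
  have := (hA.conjTranspose_mul_mul_same V).diag_nonneg (i := b)
  rw [Complex.le_def] at this
  apply Complex.ext
  · simp [mdist]
  · simpa using this.2.symm

lemma mdist_nonneg {V A : Matrix β β ℂ} (hA : A.PosSemidef) (b : β) : 0 ≤ mdist V A b := by
  have := (hA.conjTranspose_mul_mul_same V).diag_nonneg (i := b)
  rw [Complex.le_def] at this
  exact this.1

lemma mdist_sum {V : Matrix β β ℂ} (hV : V ∈ unitaryGroup β ℂ) (A : Matrix β β ℂ) :
    ∑ b, mdist V A b = rtr A := by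
  have : rtr A = rtr (Vᴴ * A * V) := by
    rw [rtr_comm, ← Matrix.mul_assoc, uni_r hV, Matrix.one_mul]
  rw [this]; simp [rtr, Matrix.trace, mdist]

lemma rtr_mul_ud (V : Matrix β β ℂ) (A : Matrix β β ℂ) (f : β → ℝ) :
    rtr (A * ud V f) = ∑ b, mdist V A b * f b := by
  rw [rtr_comm, rtr_ud_mul]
  refine Finset.sum_congr rfl fun i _ => ?_
  rw [mul_comm]; rfl

lemma mdist_self {V : Matrix β β ℂ} (hV : V ∈ unitaryGroup β ℂ) (q : β → ℝ) (b : β) :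
    mdist V (ud V q) b = q b := by
  unfold mdist ud
  have : Vᴴ * (V * diagonal (fun i => (q i : ℂ)) * Vᴴ) * V
     = (Vᴴ * V) * diagonal (fun i => (q i : ℂ)) * (Vᴴ * V) := by simp only [Matrix.mul_assoc]
  rw [this, uni_l hV, Matrix.one_mul, Matrix.mul_one]
  simp

lemma mdist_tens {V A : Fin n → Matrix β β ℂ} (hA : ∀ i, (A i).PosSemidef) (b : Fin n → β) :
    mdist (tens V) (tens A) b = ∏ i, mdist (V i) (A i) (b i) := by
  unfold mdist
  rw [tens_ct, tens_mul, tens_mul, tens_apply, Finset.prod_congr rfl fun i _ => mdist_eq (hA i) (b i),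
    ← Complex.ofReal_prod, Complex.ofReal_re]
  rfl

/-- columns of `A V` vanish on the kernel of `ud V q` -/
lemma suppLE_col {V A : Matrix β β ℂ} (hV : V ∈ unitaryGroup β ℂ) {q : β → ℝ}
    (h : SuppLE A (ud V q)) {b : β} (hq : q b = 0) (a : β) : (A * V) a b = 0 := by
  have h1 : (ud V q).mulVec (V.mulVec (Pi.single b 1)) = 0 := by
    unfold ud
    rw [Matrix.mulVec_mulVec, Matrix.mul_assoc, uni_l hV, Matrix.mul_one, ← Matrix.mulVec_mulVec]
    have : (diagonal (fun i => (q i : ℂ))).mulVec (Pi.single b 1) = 0 := by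
      ext k
      rw [mulVec_diagonal]
      by_cases hk : k = b
      · subst hk; simp [hq]
      · simp [hk]
    rw [this, Matrix.mulVec_zero]
  have h2 := congrFun (h _ h1) a
  rw [Matrix.mulVec_mulVec, Matrix.mulVec_single_one] at h2
  simpa using h2

lemma mdist_zero {V A : Matrix β β ℂ} (hV : V ∈ unitaryGroup β ℂ) {q : β → ℝ}
    (h : SuppLE A (ud V q)) {b : β} (hq : q b = 0) : mdist V A b = 0 := by
  unfold mdist
  rw [Matrix.mul_assoc, Matrix.mul_apply, Finset.sum_eq_zero]
  · simp
  · intro a _; rw [suppLE_col hV h hq, mul_zero]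

/-- marginalisation -/
lemma sum_marginal {γ : Type*} [Fintype γ] (r : Fin n → γ → ℝ) (hr : ∀ i, ∑ c, r i c = 1)
    (i : Fin n) (g : γ → ℝ) :
    ∑ a : Fin n → γ, (∏ j, r j (a j)) * g (a i) = ∑ c, r i c * g c := by
  have e : ∀ a : Fin n → γ, (∏ j, r j (a j)) * g (a i)
      = ∏ j, (r j (a j) * if j = i then g (a j) else 1) := by
    intro a
    rw [Finset.prod_mul_distrib]
    congr 1
    rw [Finset.prod_ite_eq' Finset.univ i (fun j => g (a j))]
    simp
  simp only [e]
  rw [← prod_sum_fun (fun j c => r j c * if j = i then g c else 1), Finset.prod_eq_single i]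
  · simp
  · intro j _ hj; simp [hj, hr]
  · simp

lemma sum_prod_log {γ : Type*} [Fintype γ] (r q : Fin n → γ → ℝ) (hr : ∀ i, ∑ c, r i c = 1)
    (hrq : ∀ i c, q i c = 0 → r i c = 0) :
    ∑ a : Fin n → γ, (∏ j, r j (a j)) * Real.log (∏ j, q j (a j))
      = ∑ i, ∑ c, r i c * Real.log (q i c) := by
  have : ∀ a : Fin n → γ, (∏ j, r j (a j)) * Real.log (∏ j, q j (a j))
     = ∑ i, (∏ j, r j (a j)) * Real.log (q i (a i)) := by
    intro a
    by_cases h : ∀ j, q j (a j) ≠ 0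
    · rw [Real.log_prod (fun j _ => h j), Finset.mul_sum]
    · push Not at h
      obtain ⟨j, hj⟩ := h
      have : ∏ j, r j (a j) = 0 := Finset.prod_eq_zero (Finset.mem_univ j) (hrq _ _ hj)
      simp [this]
  simp only [this]
  rw [Finset.sum_comm]
  exact Finset.sum_congr rfl fun i _ => sum_marginal r hr i (fun c => Real.log (q i c))

lemma cross_tens {A θ : Fin n → Matrix β β ℂ} (hA : ∀ i, IsDensity (A i))
    (hθ : ∀ i, (θ i).PosSemidef) (hs : ∀ i, SuppLE (A i) (θ i)) :
    rtr (tens A * matLog (tens θ)) = ∑ i, rtr (A i * matLog (θ i)) := by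
  choose V hV q hq he using fun i => exists_ud_psd (hθ i)
  have : θ = fun i => ud (V i) (q i) := funext he
  subst this
  rw [tens_ud, matLog_ud (tens_unitary hV), rtr_mul_ud]
  simp only [mdist_tens (fun i => (hA i).1), matLog_ud (hV _), rtr_mul_ud]
  exact sum_prod_log _ _ (fun i => by rw [mdist_sum (hV i), rtr_density (hA i)])
    (fun i c h => mdist_zero (hV i) (hs i) h)

lemma vnEnt_tens {A : Fin n → Matrix β β ℂ} (hA : ∀ i, IsDensity (A i)) :
    vnEnt (tens A) = ∑ i, vnEnt (A i) := by
  simp only [vnEnt_eq]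
  rw [cross_tens hA (fun i => (hA i).1) (fun i => suppLE_self _), Finset.sum_neg_distrib]

lemma le_rtr_smul_one {A : Matrix β β ℂ} (hA : A.PosSemidef) : A ≤ ((rtr A : ℝ) : ℂ) • 1 := by
  obtain ⟨U, hU, p, hp, rfl⟩ := exists_ud_psd hA
  rw [← ud_const hU]
  exact ud_le fun i => eig_le_of_rtr_le hU hp le_rfl i

lemma conj_le {A B : Matrix β β ℂ} (h : A ≤ B) (K : Matrix β β ℂ) : K * A * Kᴴ ≤ K * B * Kᴴ := by
  rw [Matrix.le_iff] at h ⊢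
  have := h.mul_mul_conjTranspose_same K
  rwa [Matrix.mul_sub, Matrix.sub_mul] at this

lemma smul_le_smul_psd {A : Matrix β β ℂ} (hA : A.PosSemidef) {c d : ℝ} (h : c ≤ d) :
    (c : ℂ) • A ≤ (d : ℂ) • A := by
  rw [Matrix.le_iff, ← sub_smul]
  have := psd_ofReal_smul (sub_nonneg.mpr h) hA
  rwa [Complex.ofReal_sub] at this

lemma smul_mono_mat {A B : Matrix β β ℂ} (h : A ≤ B) {c : ℝ} (hc : 0 ≤ c) :
    (c : ℂ) • A ≤ (c : ℂ) • B := by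
  rw [Matrix.le_iff, ← smul_sub]
  exact psd_ofReal_smul hc (Matrix.le_iff.mp h)

lemma exists_le_of_suppLE {A θ : Matrix β β ℂ} (hA : A.PosSemidef) (hθ : θ.PosSemidef)
    (h : SuppLE A θ) : ∃ C : ℝ, 0 ≤ C ∧ A ≤ (C : ℂ) • θ := by
  obtain ⟨V, hV, q, hq, rfl⟩ := exists_ud_psd hθ
  set Pi0 := ud V (fun b => if q b = 0 then 0 else 1) with hPi
  have hAP : A * Pi0 = A := by
    have hc : Pi0 = 1 - ud V (fun b => if q b = 0 then 1 else 0) := by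
      rw [← ud_one hV, ud_sub, hPi]
      congr 1; funext b; split_ifs <;> simp
    rw [hc, Matrix.mul_sub, Matrix.mul_one, sub_eq_self]
    unfold ud
    rw [← Matrix.mul_assoc, ← Matrix.mul_assoc]
    have : A * V * diagonal (fun i => (((if q i = 0 then 1 else 0 : ℝ)) : ℂ)) = 0 := by
      ext a b
      rw [mul_diagonal]
      by_cases hb : q b = 0
      · rw [suppLE_col hV h hb]; simp
      · simp [hb]
    rw [this, Matrix.zero_mul]
  have hPh : Pi0ᴴ = Pi0 := (ud_isHermitian _ _).eq
  have hPA : Pi0 * A = A := by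
    have := congrArg conjTranspose hAP
    rwa [conjTranspose_mul, hPh, hA.1.eq] at this
  have hPP : Pi0 * Pi0 = Pi0 := by
    rw [hPi, ud_mul hV]; congr 1; funext b; split_ifs <;> simp
  have h1 := conj_le (le_rtr_smul_one hA) Pi0
  rw [hPh, hPA, hAP, Matrix.mul_smul, Matrix.mul_one, Matrix.smul_mul, hPP] at h1
  have ha := rtr_nonneg hA
  have hsum : 0 ≤ ∑ b, (q b)⁻¹ := Finset.sum_nonneg fun b _ => inv_nonneg.mpr (hq b)
  refine ⟨rtr A * ∑ b, (q b)⁻¹, mul_nonneg ha hsum, h1.trans ?_⟩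
  rw [hPi, ud_smul, ud_smul]
  apply ud_le
  intro b
  rw [mul_assoc]
  apply mul_le_mul_of_nonneg_left _ ha
  split_ifs with hb
  · rw [hb, mul_zero]
  · have hb' : 0 < q b := lt_of_le_of_ne (hq b) (Ne.symm hb)
    calc (1:ℝ) = (q b)⁻¹ * q b := by field_simp
      _ ≤ _ := mul_le_mul_of_nonneg_right (Finset.single_le_sum
          (fun j _ => inv_nonneg.mpr (hq j)) (Finset.mem_univ b)) hb'.le

lemma suppLE_tens {A θ : Fin n → Matrix β β ℂ} (hA : ∀ i, (A i).PosSemidef)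
    (hθ : ∀ i, (θ i).PosSemidef) (hs : ∀ i, SuppLE (A i) (θ i)) : SuppLE (tens A) (tens θ) := by
  choose C hC hle using fun i => exists_le_of_suppLE (hA i) (hθ i) (hs i)
  have h1 := tens_mono hA hle
  rw [tens_smul] at h1
  exact suppLE_trans (suppLE_of_le (tens_psd hA) (psd_ofReal_smul
    (Finset.prod_nonneg fun i _ => hC i) (tens_psd hθ)) h1)
    (by intro v hv; rw [Matrix.smul_mulVec, hv, smul_zero])

end Tensor

section Outputs
variable {B W : Type*} [Fintype B] [DecidableEq B] [Fintype W] [DecidableEq W]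

lemma bobOut_density {π : Fin 2 → Matrix (B × W) (B × W) ℂ} (hπ : ∀ x, IsDensity (π x)) (x : Fin 2) :
    IsDensity (bobOut π x) := by
  refine ⟨?_, ?_⟩
  · have : bobOut π x = ∑ b, (π x).submatrix (fun a => (a, b)) (fun a => (a, b)) := by
      ext a a'
      simp [bobOut, ptraceRight, Matrix.sum_apply]
    rw [this]
    exact psd_sum' _ fun b _ => (hπ x).1.submatrix _
  · rw [← (hπ x).2]
    simp [bobOut, ptraceRight, Matrix.trace, Fintype.sum_prod_type]

lemma willieOut_density {π : Fin 2 → Matrix (B × W) (B × W) ℂ} (hπ : ∀ x, IsDensity (π x))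
    (x : Fin 2) : IsDensity (willieOut π x) := by
  refine ⟨?_, ?_⟩
  · have : willieOut π x = ∑ b, (π x).submatrix (fun a => (b, a)) (fun a => (b, a)) := by
      ext a a'
      simp [willieOut, ptraceLeft, Matrix.sum_apply]
    rw [this]
    exact psd_sum' _ fun b _ => (hπ x).1.submatrix _
  · rw [← (hπ x).2]
    simp only [willieOut, ptraceLeft, Matrix.trace, Fintype.sum_prod_type, diag_apply, of_apply]
    rw [Finset.sum_comm]

end Outputs

end CovertPaper

end

end

section
open Matrix Filter
open scoped Kronecker Classical ComplexOrder MatrixOrder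

noncomputable section
set_option linter.unusedSectionVars false
set_option linter.unusedVariables false

namespace CovertPaper

variable {ι : Type*} [Fintype ι] [DecidableEq ι]

lemma mul_pow_proj {A P : Matrix ι ι ℂ} (h1 : A * P = A) (k : ℕ) :
    A * (1 - A) ^ k = A * (P - A) ^ k := by
  induction k with
  | zero => simp
  | succ k ih =>
    have hc : Commute A ((1 - A) ^ k) :=
      ((Commute.one_right A).sub_right (Commute.refl A)).pow_right k
    rw [pow_succ, pow_succ, ← mul_assoc, ← mul_assoc, ← ih, hc.eq, mul_assoc, mul_assoc]
    congr 1
    rw [mul_sub, mul_sub, mul_one, h1]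

lemma ud_pow {U : Matrix ι ι ℂ} (hU : U ∈ unitaryGroup ι ℂ) (d : ι → ℝ) (k : ℕ) :
    ud U d ^ k = ud U (fun i => d i ^ k) := by
  induction k with
  | zero => simp only [pow_zero]; rw [ud_const hU]; simp
  | succ k ih => rw [pow_succ, ih, ud_mul hU]; rfl

lemma series_log (x : ℝ) (h0 : 0 ≤ x) (h1 : x ≤ 1) :
    HasSum (fun k : ℕ => x * (1 - x) ^ (k + 1) / (k + 1)) (-(x * Real.log x)) := by
  rcases h0.eq_or_lt with rfl | hx
  · simp
  · have := (Real.hasSum_pow_div_log_of_abs_lt_one (x := 1 - x) (by rw [abs_lt]; constructor <;> linarith)).mul_left x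
    simp only [sub_sub_cancel] at this
    rw [mul_neg] at this
    simpa only [mul_div_assoc] using this

lemma eig_le_one {V : Matrix ι ι ℂ} (hV : V ∈ unitaryGroup ι ℂ) {p : ι → ℝ} (hp : ∀ i, 0 ≤ p i)
    (h : (ud V p).trace = 1) (i : ι) : p i ≤ 1 := by
  rw [trace_ud hV] at h
  have h2 : ∑ i, p i = 1 := by exact_mod_cast h
  rw [← h2]
  exact Finset.single_le_sum (fun j _ => hp j) (Finset.mem_univ i)

lemma vnEnt_series {A : Matrix ι ι ℂ} (hA : IsDensity A) :
    HasSum (fun k : ℕ => ((A * (1 - A) ^ (k + 1)).trace / ((k : ℂ) + 1))) ((vnEnt A : ℝ) : ℂ) := by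
  obtain ⟨V, hV, p, hp, rfl⟩ := exists_ud_psd hA.1
  have h1 : ∀ i, p i ≤ 1 := eig_le_one hV hp hA.2
  have hk : ∀ k : ℕ, (ud V p * (1 - ud V p) ^ (k + 1)).trace / ((k : ℂ) + 1)
      = ((∑ i, p i * (1 - p i) ^ (k + 1) / (k + 1) : ℝ) : ℂ) := by
    intro k
    have : (1 : Matrix ι ι ℂ) = ud V (fun _ => 1) := by rw [ud_const hV]; simp
    rw [this, ud_sub, ud_pow hV, ud_mul hV, trace_ud hV, ← Finset.sum_div]
    push_cast; rfl
  simp only [hk]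
  rw [vnEnt_ud hV, ← Finset.sum_neg_distrib]
  have := hasSum_sum (s := Finset.univ) (fun i _ => series_log (p i) (hp i) (h1 i))
  exact (Complex.hasSum_ofReal).2 this

attribute [local instance] Matrix.linftyOpNormedRing Matrix.linftyOpNormedAlgebra

lemma entry_le_norm (A : Matrix ι ι ℂ) (i j : ι) : ‖A i j‖ ≤ ‖A‖ := by
  rw [linfty_opNorm_def]
  have h1 : ‖A i j‖₊ ≤ ∑ j, ‖A i j‖₊ := Finset.single_le_sum (f := fun j => ‖A i j‖₊) (fun _ _ => zero_le) (Finset.mem_univ j)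
  have h2 := Finset.le_sup (f := fun i => ∑ j, ‖A i j‖₊) (Finset.mem_univ i)
  exact_mod_cast h1.trans h2

lemma trace_le_norm (A : Matrix ι ι ℂ) : ‖A.trace‖ ≤ Fintype.card ι * ‖A‖ := by
  refine (norm_sum_le _ _).trans ?_
  refine (Finset.sum_le_sum (fun i _ => entry_le_norm A i i)).trans ?_
  simp

lemma analytic_entropy [Nonempty ι] {D H P : Matrix ι ι ℂ} (hn : ‖P - D‖ < 1) :
    ∃ F : ℂ → ℂ, AnalyticAt ℂ F 0 ∧ ∀ᶠ z in nhds (0:ℂ),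
      HasSum (fun k : ℕ => ((D + z • H) * (P - (D + z • H)) ^ (k + 1)).trace / ((k : ℂ) + 1)) (F z) := by
  obtain ⟨q, hq1, hq2⟩ := exists_between hn
  have hq0 : 0 ≤ q := (norm_nonneg _).trans hq1.le
  have hc : Continuous fun z : ℂ => ‖P - (D + z • H)‖ := by fun_prop
  have hc2 : Continuous fun z : ℂ => ‖D + z • H‖ := by fun_prop
  have ho : IsOpen {z : ℂ | ‖P - (D + z • H)‖ < q ∧ ‖D + z • H‖ < ‖D‖ + 1} :=
    (isOpen_lt hc continuous_const).inter (isOpen_lt hc2 continuous_const)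
  have hm : (0 : ℂ) ∈ {z : ℂ | ‖P - (D + z • H)‖ < q ∧ ‖D + z • H‖ < ‖D‖ + 1} := by simp [hq1]
  have hb : ∀ (k : ℕ) (z : ℂ), z ∈ {z : ℂ | ‖P - (D + z • H)‖ < q ∧ ‖D + z • H‖ < ‖D‖ + 1} →
      ‖((D + z • H) * (P - (D + z • H)) ^ (k + 1)).trace / ((k : ℂ) + 1)‖ ≤
        (Fintype.card ι * (‖D‖ + 1)) * q ^ (k + 1) := by
    intro k z hz
    rw [norm_div]
    have h1 : (1:ℝ) ≤ ‖(k : ℂ) + 1‖ := by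
      have : ((k : ℂ) + 1) = ((k + 1 : ℕ) : ℂ) := by push_cast; rfl
      rw [this, Complex.norm_natCast]; push_cast; linarith [(Nat.cast_nonneg k : (0:ℝ) ≤ k)]
    refine (div_le_self (norm_nonneg _) h1).trans ?_
    refine (trace_le_norm _).trans ?_
    rw [mul_assoc]
    gcongr
    refine (norm_mul_le _ _).trans ?_
    gcongr
    · exact hz.2.le
    · exact (norm_pow_le' _ (Nat.succ_pos k)).trans (by gcongr; exact hz.1.le)
  have hs : Summable fun k : ℕ => (Fintype.card ι * (‖D‖ + 1)) * q ^ (k + 1) := by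
    apply Summable.mul_left
    exact (summable_nat_add_iff 1).2 (summable_geometric_of_lt_one hq0 hq2)
  refine ⟨fun z => ∑' k : ℕ, ((D + z • H) * (P - (D + z • H)) ^ (k + 1)).trace / ((k : ℂ) + 1), ?_, ?_⟩
  · have := Complex.differentiableOn_tsum_of_summable_norm (F := fun (k : ℕ) (z : ℂ) => ((D + z • H) * (P - (D + z • H)) ^ (k + 1)).trace / ((k : ℂ) + 1)) hs ?_ ho hb
    · exact this.analyticAt (ho.mem_nhds hm)
    · intro k
      have h1 : Differentiable ℂ fun z : ℂ => (D + z • H) * (P - (D + z • H)) ^ (k + 1) := by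
        fun_prop
      have h2 : Differentiable ℂ fun z : ℂ => ((D + z • H) * (P - (D + z • H)) ^ (k + 1)).trace := by
        let T : Matrix ι ι ℂ →L[ℂ] ℂ := LinearMap.toContinuousLinearMap (Matrix.traceLinearMap ι ℂ ℂ)
        exact T.differentiable.comp h1
      exact (h2.div_const _).differentiableOn
  · filter_upwards [ho.mem_nhds hm] with z hz
    exact (Summable.of_norm_bounded hs (fun k => hb k z hz)).hasSum


lemma analytic_real {F : ℂ → ℂ} (hF : AnalyticAt ℂ F 0) :
    ContDiffAt ℝ 2 (fun α : ℝ => (F (α : ℂ)).re) 0 := by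
  have h1 : ContDiffAt ℝ 2 F ((0 : ℝ) : ℂ) := by
    rw [Complex.ofReal_zero]
    exact (hF.contDiffAt (n := 2)).restrict_scalars ℝ
  have h2 : ContDiffAt ℝ 2 (fun α : ℝ => F (α : ℂ)) 0 :=
    ContDiffAt.comp (0 : ℝ) h1 Complex.ofRealCLM.contDiff.contDiffAt
  exact ContDiffAt.comp (0 : ℝ) Complex.reCLM.contDiff.contDiffAt h2

lemma vnEnt_conj {A U : Matrix ι ι ℂ} (hA : IsDensity A) (hU : U ∈ unitaryGroup ι ℂ) :
    IsDensity (Uᴴ * A * U) ∧ vnEnt (Uᴴ * A * U) = vnEnt A := by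
  obtain ⟨V, hV, p, hp, rfl⟩ := exists_ud_psd hA.1
  have h : Uᴴ * ud V p * U = ud (Uᴴ * V) p := by
    simp only [ud, conjTranspose_mul, conjTranspose_conjTranspose, mul_assoc]
  have hW := uni_ct_mul hU hV
  rw [h]
  refine ⟨⟨ud_psd _ hp, ?_⟩, ?_⟩
  · rw [trace_ud hW]; have := hA.2; rwa [trace_ud hV] at this
  · rw [vnEnt_ud hW, vnEnt_ud hV]

lemma entropy_contDiff [Nonempty ι] {ω H : Matrix ι ι ℂ} (hω : IsDensity ω) (hH : SuppLE H ω)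
    (hd : ∀ᶠ α : ℝ in nhds 0, IsDensity (ω + (α : ℂ) • H)) :
    ContDiffAt ℝ 2 (fun α : ℝ => vnEnt (ω + (α : ℂ) • H)) 0 := by
  obtain ⟨U, hU, q, hq, rfl⟩ := exists_ud_psd hω.1
  have hq1 := eig_le_one hU hq hω.2
  set P : Matrix ι ι ℂ := diagonal fun i => if q i = 0 then 0 else 1 with hP
  set D : Matrix ι ι ℂ := diagonal fun i => (q i : ℂ) with hD
  have hDU : Uᴴ * ud U q * U = D := by
    simp only [ud, ← mul_assoc, uni_l hU, one_mul]
    rw [mul_assoc, uni_l hU, mul_one]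
  have hn : ‖P - D‖ < 1 := by
    rw [hP, hD, diagonal_sub, linfty_opNorm_diagonal, pi_norm_lt_iff one_pos]
    intro i
    split_ifs with h
    · simp [h]
    · have : (1 : ℂ) - (q i : ℂ) = ((1 - q i : ℝ) : ℂ) := by push_cast; rfl
      rw [this, Complex.norm_real, Real.norm_eq_abs, abs_lt]
      have := lt_of_le_of_ne (hq i) (Ne.symm h)
      constructor <;> linarith [hq1 i]
  obtain ⟨F, hF, hs⟩ := analytic_entropy (H := Uᴴ * H * U) hn
  refine (analytic_real hF).congr_of_eventuallyEq ?_
  have hs' : ∀ᶠ α : ℝ in nhds 0, HasSum (fun k : ℕ => ((D + (α:ℂ) • (Uᴴ * H * U)) * (P - (D + (α:ℂ) • (Uᴴ * H * U))) ^ (k + 1)).trace / ((k : ℂ) + 1)) (F α) := by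
    have hc : Tendsto (fun α : ℝ => (α : ℂ)) (nhds 0) (nhds 0) := by
      have := Complex.continuous_ofReal.tendsto 0
      simpa using this
    exact hc.eventually hs
  filter_upwards [hd, hs'] with α h1 h2
  have hA : Uᴴ * (ud U q + (α : ℂ) • H) * U = D + (α:ℂ) • (Uᴴ * H * U) := by
    rw [mul_add, add_mul, hDU]; simp
  obtain ⟨h3, h4⟩ := vnEnt_conj h1 hU
  rw [hA] at h3 h4
  have h5 : (D + (α:ℂ) • (Uᴴ * H * U)) * P = D + (α:ℂ) • (Uᴴ * H * U) := by
    ext a b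
    rw [hP, mul_diagonal]
    split_ifs with hb
    · rw [← hA, mul_zero, mul_assoc, mul_apply]
      symm
      apply Finset.sum_eq_zero
      intro c _
      rw [suppLE_col hU (q := q) (A := ud U q + (α : ℂ) • H) ?_ hb, mul_zero]
      intro v hv
      rw [add_mulVec, hv, smul_mulVec, hH v hv]; simp
    · rw [mul_one]
  have h6 := vnEnt_series h3
  simp only [mul_pow_proj h5] at h6
  have := h2.unique h6
  rw [this, ← h4]; simp

/-- The mixture `α ω₁ + (1 - α) ω₀`. -/
def mixS (ω₁ ω₀ : Matrix ι ι ℂ) (α : ℝ) : Matrix ι ι ℂ := (α : ℂ) • ω₁ + ((1 - α : ℝ) : ℂ) • ω₀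

lemma mixS_eq (ω₁ ω₀ : Matrix ι ι ℂ) (α : ℝ) : mixS ω₁ ω₀ α = ω₀ + (α : ℂ) • (ω₁ - ω₀) := by
  unfold mixS; push_cast; module

lemma mixS_trace {ω₁ ω₀ : Matrix ι ι ℂ} (h1 : ω₁.trace = 1) (h0 : ω₀.trace = 1) (α : ℝ) :
    (mixS ω₁ ω₀ α).trace = 1 := by
  unfold mixS; rw [trace_add, trace_smul, trace_smul, h1, h0]; simp

lemma mixS_density {ω₁ ω₀ : Matrix ι ι ℂ} (h1 : IsDensity ω₁) (h0 : IsDensity ω₀) {α : ℝ}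
    (ha : 0 ≤ α) (hb : α ≤ 1) : IsDensity (mixS ω₁ ω₀ α) :=
  ⟨(psd_ofReal_smul ha h1.1).add (psd_ofReal_smul (by linarith) h0.1), mixS_trace h1.2 h0.2 α⟩

lemma mixS_suppLE {ω₁ ω₀ : Matrix ι ι ℂ} (h : SuppLE ω₁ ω₀) (α : ℝ) : SuppLE (mixS ω₁ ω₀ α) ω₀ := by
  intro v hv
  unfold mixS
  rw [add_mulVec, smul_mulVec, smul_mulVec, h v hv, hv]; simp

lemma mixS_density_near {ω₁ ω₀ : Matrix ι ι ℂ} (h1 : IsDensity ω₁) (h0 : IsDensity ω₀)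
    (h : SuppLE ω₁ ω₀) : ∀ᶠ α : ℝ in nhds 0, IsDensity (mixS ω₁ ω₀ α) := by
  obtain ⟨C, hC, hle⟩ := exists_le_of_suppLE h1.1 h0.1 h
  have hr : (0:ℝ) < (C + 1)⁻¹ := by positivity
  filter_upwards [Metric.ball_mem_nhds (0:ℝ) hr, Metric.ball_mem_nhds (0:ℝ) one_pos] with α ha hb
  rw [mem_ball_zero_iff, Real.norm_eq_abs] at ha hb
  rcases le_or_gt 0 α with h' | h'
  · exact mixS_density h1 h0 h' (by rw [abs_of_nonneg h'] at hb; exact hb.le)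
  · refine ⟨?_, mixS_trace h1.2 h0.2 α⟩
    rw [abs_of_neg h'] at ha
    have e : mixS ω₁ ω₀ α = ((-α : ℝ) : ℂ) • ((C : ℂ) • ω₀ - ω₁) + ((1 - α + α * C : ℝ) : ℂ) • ω₀ := by
      unfold mixS; push_cast; module
    rw [e]
    refine (psd_ofReal_smul (by linarith) ?_).add (psd_ofReal_smul ?_ h0.1)
    · exact Matrix.le_iff.1 hle
    · have : -α * (C + 1) < 1 := by
        have := mul_lt_mul_of_pos_right ha (show 0 < C + 1 by linarith)
        rwa [inv_mul_cancel₀ (by linarith)] at this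
      nlinarith

lemma relEnt_nonneg {A B : Matrix ι ι ℂ} (hA : IsDensity A) (hB : IsDensity B) (h : SuppLE A B) :
    0 ≤ relEnt A B := by
  have := klein hA.1 hB.1 h
  rw [relEnt_eq]
  have e1 : rtr A = 1 := rtr_density hA
  have e2 : rtr B = 1 := rtr_density hB
  unfold rtr at *
  linarith

lemma relEnt_self (A : Matrix ι ι ℂ) : relEnt A A = 0 := by
  unfold relEnt; simp

lemma chi_taylor [Nonempty ι] {ω₁ ω₀ : Matrix ι ι ℂ} (h1 : IsDensity ω₁) (h0 : IsDensity ω₀)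
    (h : SuppLE ω₁ ω₀) :
    Tendsto (fun α : ℝ => relEnt (mixS ω₁ ω₀ α) ω₀ / α ^ 2) (nhdsWithin 0 {0}ᶜ)
      (nhds (2⁻¹ * chiSq ω₁ ω₀)) := by
  set g : ℝ → ℝ := fun α => relEnt (mixS ω₁ ω₀ α) ω₀ with hg
  have hden := mixS_density_near h1 h0 h
  have hcd : ContDiffAt ℝ 2 g 0 := by
    have e : g = fun α : ℝ => -vnEnt (ω₀ + (α : ℂ) • (ω₁ - ω₀)) -
        (α * rtr (ω₁ * matLog ω₀) + (1 - α) * rtr (ω₀ * matLog ω₀)) := by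
      ext α
      rw [hg]
      simp only
      rw [relEnt_eq, ← mixS_eq]
      congr 1
      change rtr _ = _
      unfold mixS
      rw [add_mul, rtr_add, smul_mul_assoc, smul_mul_assoc, rtr_smul, rtr_smul]
    rw [e]
    have : ContDiffAt ℝ 2 (fun α : ℝ => vnEnt (ω₀ + (α : ℂ) • (ω₁ - ω₀))) 0 := by
      apply entropy_contDiff h0
      · intro v hv; rw [sub_mulVec, h v hv, hv, sub_zero]
      · simpa only [mixS_eq] using hden
    fun_prop
  have hg0 : g 0 = 0 := by
    simp [hg, mixS, relEnt_self]
  have hd0 : deriv g 0 = 0 := by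
    apply IsLocalMin.deriv_eq_zero
    filter_upwards [hden] with α hα
    rw [hg0]
    exact relEnt_nonneg hα h0 (mixS_suppLE h α)
  obtain ⟨u, hu, hcu⟩ := hcd.contDiffOn (m := 2) le_rfl (by simp)
  have hu' : u ∈ nhds (0:ℝ) := by simpa using hu
  obtain ⟨r, hr, hru⟩ := Metric.mem_nhds_iff.1 hu'
  have hmem : (0:ℝ) ∈ Metric.ball (0:ℝ) r := Metric.mem_ball_self hr
  have ht := taylor_isLittleO (n := 2) (convex_ball (0:ℝ) r) hmem (hcu.mono hru)
  have he : ∀ x, taylorWithinEval g 2 (Metric.ball (0:ℝ) r) 0 x = 2⁻¹ * chiSq ω₁ ω₀ * x ^ 2 := by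
    intro x
    rw [taylorWithinEval_succ, taylorWithinEval_succ, taylor_within_zero_eval,
      iteratedDerivWithin_of_isOpen Metric.isOpen_ball hmem,
      iteratedDerivWithin_of_isOpen Metric.isOpen_ball hmem]
    have e2 : iteratedDeriv (1 + 1) g 0 = chiSq ω₁ ω₀ := rfl
    rw [e2, zero_add, iteratedDeriv_one, hd0, hg0]
    simp; ring
  simp only [he, sub_zero] at ht
  rw [Metric.isOpen_ball.nhdsWithin_eq hmem] at ht
  have h3 := (ht.tendsto_div_nhds_zero).mono_left (nhdsWithin_le_nhds (s := {0}ᶜ))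
  have h4 := h3.add_const (2⁻¹ * chiSq ω₁ ω₀)
  rw [zero_add] at h4
  refine h4.congr' ?_
  filter_upwards [self_mem_nhdsWithin] with x hx
  have : x ≠ 0 := hx
  field_simp
  ring

lemma mixS_lower [Nonempty ι] {ω₁ ω₀ : Matrix ι ι ℂ} (h1 : IsDensity ω₁) (h0 : IsDensity ω₀)
    (h : SuppLE ω₁ ω₀) {α : ℝ} (ha : 0 ≤ α) (hb : α ≤ 1) :
    rtr ((ω₁ - ω₀) * (ω₁ - ω₀)) / 2 * α ^ 2 ≤ relEnt (mixS ω₁ ω₀ α) ω₀ := by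
  have := klein_sq (mixS_density h1 h0 ha hb) h0 (mixS_suppLE h α)
  rw [mixS_eq] at this ⊢
  refine le_trans (le_of_eq ?_) this
  rw [add_sub_cancel_left, smul_mul_smul_comm, ← Complex.ofReal_mul, rtr_smul]
  ring

lemma sq_pos {ω₁ ω₀ : Matrix ι ι ℂ} (h1 : IsDensity ω₁) (h0 : IsDensity ω₀) (hne : ω₁ ≠ ω₀) :
    0 < rtr ((ω₁ - ω₀) * (ω₁ - ω₀)) := by
  have hh : (ω₁ - ω₀)ᴴ = ω₁ - ω₀ := (h1.1.1.sub h0.1.1)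
  have hp : ((ω₁ - ω₀) * (ω₁ - ω₀)).PosSemidef := by
    have := posSemidef_conjTranspose_mul_self (ω₁ - ω₀)
    rwa [hh] at this
  refine lt_of_le_of_ne (rtr_nonneg hp) fun he => hne ?_
  have := psd_zero_of_rtr hp he.symm
  have h2 : (ω₁ - ω₀)ᴴ * (ω₁ - ω₀) = 0 := by rwa [hh]
  exact sub_eq_zero.1 (conjTranspose_mul_self_eq_zero.1 h2)

lemma chi_pos [Nonempty ι] {ω₁ ω₀ : Matrix ι ι ℂ} (h1 : IsDensity ω₁) (h0 : IsDensity ω₀)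
    (h : SuppLE ω₁ ω₀) (hne : ω₁ ≠ ω₀) : 0 < 2⁻¹ * chiSq ω₁ ω₀ := by
  have ht := (chi_taylor h1 h0 h).mono_left (nhdsWithin_mono 0 (s := Set.Ioi 0) (by intro x hx; exact ne_of_gt hx))
  have : rtr ((ω₁ - ω₀) * (ω₁ - ω₀)) / 2 ≤ 2⁻¹ * chiSq ω₁ ω₀ := by
    refine ge_of_tendsto ht ?_
    filter_upwards [Ioo_mem_nhdsGT (show (0:ℝ) < 1 by norm_num)] with α hα
    have h2 := mixS_lower h1 h0 h hα.1.le hα.2.le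
    have : 0 < α ^ 2 := pow_pos hα.1 2
    rwa [le_div_iff₀ this]
  linarith [sq_pos h1 h0 hne]

end CovertPaper

end

end

section
open Matrix Filter
open scoped Kronecker Classical ComplexOrder MatrixOrder

noncomputable section
set_option linter.unusedSectionVars false
set_option linter.unusedVariables false

namespace CovertPaper

variable {β : Type*} [Fintype β] [DecidableEq β]
variable {κ : Type*} [Fintype κ]

/-- Hamming weight. -/
def wt {n : ℕ} (x : Fin n → Fin 2) : ℝ := ∑ i, if x i = 1 then (1 : ℝ) else 0

lemma wt_nonneg {n : ℕ} (x : Fin n → Fin 2) : 0 ≤ wt x :=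
  Finset.sum_nonneg fun i _ => by split_ifs <;> norm_num

lemma wt_le {n : ℕ} (x : Fin n → Fin 2) : wt x ≤ n := by
  unfold wt
  refine (Finset.sum_le_sum (g := fun _ => (1:ℝ)) fun i _ => by split_ifs <;> norm_num).trans ?_
  simp

lemma sum_two {n : ℕ} (F : Fin 2 → ℝ) (x : Fin n → Fin 2) :
    ∑ i, F (x i) = wt x * F 1 + (n - wt x) * F 0 := by
  have : ∀ i, F (x i) = (if x i = 1 then (1 : ℝ) else 0) * F 1 +
      (1 - (if x i = 1 then (1 : ℝ) else 0)) * F 0 := by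
    intro i
    have h : x i = 0 ∨ x i = 1 := by
      generalize x i = y
      fin_cases y <;> simp
    rcases h with h | h <;> simp [h]
  rw [Finset.sum_congr rfl fun i _ => this i, Finset.sum_add_distrib, ← Finset.sum_mul,
    ← Finset.sum_mul, Finset.sum_sub_distrib]
  simp [wt]

/-- average weight -/
def awt {n : ℕ} (c : ℝ) (x : κ → Fin n → Fin 2) : ℝ := c * ∑ k, wt (x k)

lemma awt_sum {n : ℕ} {c : ℝ} (hc : c * Fintype.card κ = 1) (x : κ → Fin n → Fin 2) (a b : ℝ) :
    c * ∑ k, (wt (x k) * a + (n - wt (x k)) * b) = awt c x * a + (n - awt c x) * b := by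
  unfold awt
  simp only [Finset.sum_add_distrib, ← Finset.sum_mul, Finset.sum_sub_distrib]
  simp only [Finset.sum_const, Finset.card_univ, nsmul_eq_mul]
  linear_combination (n * b) * hc

lemma c_pos {c : ℝ} (hc : c * Fintype.card κ = 1) : 0 < c := by
  by_contra h
  push Not at h
  have : c * Fintype.card κ ≤ 0 := mul_nonpos_of_nonpos_of_nonneg h (Nat.cast_nonneg _)
  linarith

lemma awt_pos {n : ℕ} {c : ℝ} (hc : c * Fintype.card κ = 1) (x : κ → Fin n → Fin 2) {k : κ} {i : Fin n}
    (h : x k i = 1) : 0 < awt c x := by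
  refine mul_pos (c_pos hc) ?_
  refine lt_of_lt_of_le ?_ (Finset.single_le_sum (fun k _ => wt_nonneg (x k)) (Finset.mem_univ k))
  refine lt_of_lt_of_le ?_ (Finset.single_le_sum (f := fun i => if x k i = 1 then (1 : ℝ) else 0) (fun i _ => by split_ifs <;> norm_num) (Finset.mem_univ i))
  simp [h]

lemma awt_nonneg {n : ℕ} {c : ℝ} (hc : c * Fintype.card κ = 1) (x : κ → Fin n → Fin 2) : 0 ≤ awt c x :=
  mul_nonneg (c_pos hc).le (Finset.sum_nonneg fun k _ => wt_nonneg _)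

lemma awt_le {n : ℕ} {c : ℝ} (hc : c * Fintype.card κ = 1) (x : κ → Fin n → Fin 2) : awt c x ≤ n := by
  unfold awt
  have : ∑ k, wt (x k) ≤ ∑ k : κ, (n : ℝ) := Finset.sum_le_sum fun k _ => wt_le _
  calc c * ∑ k, wt (x k) ≤ c * ∑ k : κ, (n : ℝ) := mul_le_mul_of_nonneg_left this (c_pos hc).le
    _ = (c * Fintype.card κ) * n := by simp; ring
    _ = n := by rw [hc, one_mul]

lemma awt_lt {n : ℕ} {c : ℝ} (hc : c * Fintype.card κ = 1) (x : κ → Fin n → Fin 2) {k : κ} {i : Fin n}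
    (h : x k i = 0) : awt c x < n := by
  have h1 : ∑ k, wt (x k) < ∑ k : κ, (n : ℝ) := by
    refine Finset.sum_lt_sum (fun k _ => wt_le _) ⟨k, Finset.mem_univ k, ?_⟩
    unfold wt
    refine lt_of_lt_of_le (Finset.sum_lt_sum (g := fun _ => (1:ℝ)) (fun i _ => by split_ifs <;> norm_num) ⟨i, Finset.mem_univ i, ?_⟩) ?_
    · simp [h]
    · simp
  calc c * ∑ k, wt (x k) < c * ∑ k : κ, (n : ℝ) := mul_lt_mul_of_pos_left h1 (c_pos hc)
    _ = (c * Fintype.card κ) * n := by simp; ring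
    _ = n := by rw [hc, one_mul]

variable {ω : Fin 2 → Matrix β β ℂ}

lemma str_density (hω : ∀ x, IsDensity (ω x)) {n : ℕ} (x : Fin n → Fin 2) : IsDensity (stringState ω x) := by
  rw [stringState_eq]; exact tens_density fun i => hω _

lemma str_ent (hω : ∀ x, IsDensity (ω x)) {n : ℕ} (x : Fin n → Fin 2) :
    vnEnt (stringState ω x) = wt x * vnEnt (ω 1) + (n - wt x) * vnEnt (ω 0) := by
  rw [stringState_eq, vnEnt_tens fun i => hω _]
  exact sum_two (fun y => vnEnt (ω y)) x

lemma str_cross (hω : ∀ x, IsDensity (ω x)) {n : ℕ} (x : Fin n → Fin 2) {θ : Matrix β β ℂ}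
    (hθ : θ.PosSemidef) (h : ∀ i, SuppLE (ω (x i)) θ) :
    rtr (stringState ω x * matLog (tpow θ n)) = wt x * rtr (ω 1 * matLog θ) + (n - wt x) * rtr (ω 0 * matLog θ) := by
  rw [stringState_eq, tpow_eq, cross_tens (fun i => hω _) (fun _ => hθ) h]
  exact sum_two (fun y => rtr (ω y * matLog θ)) x

lemma avg_cross (hω : ∀ x, IsDensity (ω x)) {n : ℕ} {c : ℝ} (hc : c * Fintype.card κ = 1)
    (x : κ → Fin n → Fin 2) {θ : Matrix β β ℂ}
    (hθ : θ.PosSemidef) (h : ∀ k i, SuppLE (ω (x k i)) θ) :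
    rtr (((c : ℂ) • ∑ k, stringState ω (x k)) * matLog (tpow θ n)) =
      awt c x * rtr (ω 1 * matLog θ) + (n - awt c x) * rtr (ω 0 * matLog θ) := by
  rw [smul_mul_assoc, rtr_smul, Finset.sum_mul, rtr_sum, Finset.sum_congr rfl fun k _ => str_cross hω (x k) hθ (h k),
    awt_sum hc]

lemma supp_all {ω : Fin 2 → Matrix β β ℂ} (h : SuppLE (ω 1) (ω 0)) (y : Fin 2) : SuppLE (ω y) (ω 0) := by
  fin_cases y
  · exact suppLE_self _
  · exact h

lemma holevo_eq (hω : ∀ x, IsDensity (ω x)) (h : SuppLE (ω 1) (ω 0)) {n : ℕ} {c : ℝ} (hc : c * Fintype.card κ = 1)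
    (x : κ → Fin n → Fin 2) :
    vnEnt ((c : ℂ) • ∑ k, stringState ω (x k)) - c * ∑ k, vnEnt (stringState ω (x k)) =
      awt c x * relEnt (ω 1) (ω 0) - relEnt ((c : ℂ) • ∑ k, stringState ω (x k)) (tpow (ω 0) n) := by
  rw [Finset.sum_congr rfl fun k _ => str_ent hω (x k), awt_sum hc]
  rw [relEnt_eq, relEnt_eq]
  have := avg_cross hω hc x (hω 0).1 (fun k i => supp_all h _)
  have e := vnEnt_eq (ω 0)
  unfold rtr at this e
  rw [this, e]
  ring

lemma tpow_density {θ : Matrix β β ℂ} (hθ : IsDensity θ) (n : ℕ) : IsDensity (tpow θ n) := by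
  rw [tpow_eq]; exact tens_density fun _ => hθ

lemma supp_avg_str (hω : ∀ x, IsDensity (ω x)) {n : ℕ} {c : ℝ} 
    (x : κ → Fin n → Fin 2) {θ : Matrix β β ℂ}
    (hθ : θ.PosSemidef) (h : ∀ k i, SuppLE (ω (x k i)) θ) :
    SuppLE ((c : ℂ) • ∑ k, stringState ω (x k)) (tpow θ n) := by
  apply suppLE_smul_left
  apply suppLE_sum_left
  intro k
  intros
  rw [stringState_eq, tpow_eq]
  exact suppLE_tens (fun i => (hω _).1) (fun _ => hθ) (h k)

lemma holevo_le (hω : ∀ x, IsDensity (ω x)) (h : SuppLE (ω 1) (ω 0)) {n : ℕ} {c : ℝ} (hc : c * Fintype.card κ = 1)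
    (x : κ → Fin n → Fin 2) :
    vnEnt ((c : ℂ) • ∑ k, stringState ω (x k)) - c * ∑ k, vnEnt (stringState ω (x k)) ≤
      awt c x * relEnt (ω 1) (ω 0) := by
  rw [holevo_eq hω h hc]
  have := relEnt_nonneg (avg_density (fun k => str_density hω (x k)) hc) (tpow_density (hω 0) n)
    (supp_avg_str hω x (hω 0).1 (fun k i => supp_all h _))
  linarith

lemma relEnt_lower (hω : ∀ x, IsDensity (ω x)) (h : SuppLE (ω 1) (ω 0)) {n : ℕ} (hn : 0 < n) {c : ℝ} (hc : c * Fintype.card κ = 1)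
    (x : κ → Fin n → Fin 2) :
    n * relEnt (mixS (ω 1) (ω 0) (awt c x / n)) (ω 0) ≤
      relEnt ((c : ℂ) • ∑ k, stringState ω (x k)) (tpow (ω 0) n) := by
  have hn' : (0:ℝ) < n := by exact_mod_cast hn
  obtain ⟨α, hα⟩ : ∃ α, α = awt c x / n := ⟨_, rfl⟩
  have hαn : awt c x = α * n := by rw [hα]; field_simp
  have ha0 : 0 ≤ α := by rw [hα]; exact div_nonneg (awt_nonneg hc x) hn'.le
  have ha1 : α ≤ 1 := by rw [hα, div_le_one hn']; exact awt_le hc x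
  rw [← hα]
  have hθ := mixS_density (hω 1) (hω 0) ha0 ha1
  have hs : ∀ k i, SuppLE (ω (x k i)) (mixS (ω 1) (ω 0) α) := by
    intro k i
    have hx : x k i = 0 ∨ x k i = 1 := by
      generalize x k i = y
      fin_cases y <;> simp
    rcases hx with hx | hx
    · rw [hx]
      have h2 : α < 1 := by rw [hα, div_lt_one hn']; exact awt_lt hc x hx
      have : SuppLE (ω 0) (((1 - α : ℝ) : ℂ) • ω 0) :=
        suppLE_smul_right (by exact_mod_cast (sub_pos.2 h2).ne') (suppLE_self _)
      refine suppLE_trans this ?_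
      refine suppLE_of_le (psd_ofReal_smul (by linarith) (hω 0).1) hθ.1 ?_
      unfold mixS; rw [add_comm]
      exact le_add_right_psd (psd_ofReal_smul ha0 (hω 1).1)
    · rw [hx]
      have h2 : 0 < α := by rw [hα]; exact div_pos (awt_pos hc x hx) hn'
      have : SuppLE (ω 1) ((α : ℂ) • ω 1) :=
        suppLE_smul_right (by exact_mod_cast h2.ne') (suppLE_self _)
      refine suppLE_trans this ?_
      refine suppLE_of_le (psd_ofReal_smul ha0 (hω 1).1) hθ.1 ?_
      exact le_add_right_psd (psd_ofReal_smul (by linarith) (hω 0).1)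
  have hk := klein (avg_density (fun k => str_density hω (x k)) hc).1 (tpow_density hθ n).1 (supp_avg_str hω x hθ.1 hs)
  rw [rtr_density (avg_density (fun k => str_density hω (x k)) hc), rtr_density (tpow_density hθ n), avg_cross hω hc x hθ.1 hs] at hk
  have hc0 := avg_cross hω hc x (hω 0).1 (fun k i => supp_all h _)
  rw [relEnt_eq, relEnt_eq, vnEnt_eq (mixS _ _ _)]
  change _ * (- -rtr _ - rtr (_ * _)) ≤ _ - rtr (_ * _)
  rw [hc0]
  have e : ∀ X, rtr (mixS (ω 1) (ω 0) α * X) = α * rtr (ω 1 * X) + (1 - α) * rtr (ω 0 * X) := by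
    intro X
    unfold mixS
    rw [add_mul, rtr_add, smul_mul_assoc, smul_mul_assoc, rtr_smul, rtr_smul]
  rw [e, e]
  rw [hαn] at hk ⊢
  linarith

variable {ι : Type*} [Fintype ι] [DecidableEq ι]

lemma vnEnt_avg_le {A : κ → Matrix ι ι ℂ} (hA : ∀ k, (A k).PosSemidef) {c : ℝ} (hc : c * Fintype.card κ = 1) :
    vnEnt ((c : ℂ) • ∑ k, A k) ≤ c * ∑ k, vnEnt (A k) + Real.log (Fintype.card κ) * (c * ∑ k, rtr (A k)) := by
  have h0 := c_pos hc
  rw [Finset.smul_sum]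
  refine (vnEnt_sum_le _ fun k => psd_ofReal_smul h0.le (hA k)).trans (le_of_eq ?_)
  rw [Finset.sum_congr rfl fun k _ => vnEnt_smul (hA k).1 h0, Finset.sum_sub_distrib, ← Finset.mul_sum, ← Finset.mul_sum]
  have : Real.log (Fintype.card κ) = - Real.log c := by
    rw [← Real.log_inv]; congr 1
    exact eq_inv_of_mul_eq_one_right hc
  rw [this]; ring

lemma h_bound {p : ℝ} (hp : 0 ≤ p) :
    (1 + p) * Real.log (1 + p) - 1 * Real.log 1 - p * Real.log p ≤ 1 + p := by
  rcases hp.eq_or_lt with rfl | h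
  · simp
  · have h1 : Real.log (1 + p) ≤ p := by
      have := Real.log_le_sub_one_of_pos (show 0 < 1 + p by linarith); linarith
    have h2 : Real.log ((1 + p) / p) ≤ 1 / p := by
      have := Real.log_le_sub_one_of_pos (show 0 < (1 + p) / p by positivity)
      refine this.trans (le_of_eq ?_); field_simp; ring
    rw [Real.log_div (by linarith) h.ne'] at h2
    have h3 : p * (Real.log (1 + p) - Real.log p) ≤ 1 := by
      have := mul_le_mul_of_nonneg_left h2 hp
      rwa [mul_one_div_cancel h.ne'] at this
    rw [Real.log_one]
    linarith

lemma secrecy_bound {ρ : κ → Matrix ι ι ℂ} {ρ' : Matrix ι ι ℂ} (hρ : ∀ k, IsDensity (ρ k)) (hρ' : IsDensity ρ')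
    {c δ : ℝ} (hc : c * Fintype.card κ = 1) (hcard : 1 ≤ Fintype.card κ)
    (hs : c * ∑ k, traceNorm (ρ k - ρ') ≤ δ) :
    vnEnt ((c : ℂ) • ∑ k, ρ k) - c * ∑ k, vnEnt (ρ k) ≤ 2 + 2 * δ + δ * Real.log (Fintype.card κ) := by
  have h0 := c_pos hc
  choose P N hP hN hPN hT using fun k => exists_parts ((hρ k).1.1.sub hρ'.1.1)
  have e1 : ∀ k, ρ k + N k = ρ' + P k := by
    intro k
    have := hPN k
    rw [sub_eq_sub_iff_add_eq_add] at this
    rw [this, add_comm]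
  have hrt : ∀ k, rtr (P k) = rtr (N k) := by
    intro k
    have := congrArg rtr (e1 k)
    rw [rtr_add, rtr_add, rtr_density (hρ k), rtr_density hρ'] at this
    linarith
  obtain ⟨t, ht⟩ : ∃ t, t = c * ∑ k, rtr (P k) := ⟨_, rfl⟩
  have htn : t = c * ∑ k, rtr (N k) := by rw [ht]; congr 1; exact Finset.sum_congr rfl fun k _ => hrt k
  have ht0 : 0 ≤ t := by rw [ht]; exact mul_nonneg h0.le (Finset.sum_nonneg fun k _ => rtr_nonneg (hP k))
  have htδ : 2 * t ≤ δ := by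
    refine le_trans (le_of_eq ?_) hs
    simp only [← hT, Finset.sum_add_distrib]
    rw [mul_add, ← ht, ← htn]; ring
  have hPb := psd_ofReal_smul h0.le (psd_sum' Finset.univ fun k _ => hP k)
  have hNb := psd_ofReal_smul h0.le (psd_sum' Finset.univ fun k _ => hN k)
  have hρb := avg_density hρ hc
  have e2 : (c : ℂ) • ∑ k, ρ k + (c : ℂ) • ∑ k, N k = ρ' + (c : ℂ) • ∑ k, P k := by
    rw [← smul_add, ← Finset.sum_add_distrib, Finset.sum_congr rfl fun k _ => e1 k, Finset.sum_add_distrib, smul_add]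
    congr 1
    simp only [Finset.sum_const, Finset.card_univ]
    rw [← Nat.cast_smul_eq_nsmul ℂ, smul_smul]
    have : (c : ℂ) * (Fintype.card κ : ℂ) = 1 := by exact_mod_cast hc
    rw [this, one_smul]
  -- lower bound on each term
  have hlow : ∀ k, vnEnt ρ' + vnEnt (P k) - vnEnt (N k) - (1 + rtr (P k)) ≤ vnEnt (ρ k) := by
    intro k
    have a1 := vnEnt_add_le (hρ k).1 (hN k)
    have a2 := vnEnt_add_ge hρ'.1 (hP k)
    rw [rtr_density hρ'] at a2
    have a3 := h_bound (rtr_nonneg (hP k))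
    rw [e1 k] at a1
    linarith
  have hup : vnEnt ((c : ℂ) • ∑ k, ρ k) ≤ vnEnt ρ' + vnEnt ((c : ℂ) • ∑ k, P k) - vnEnt ((c : ℂ) • ∑ k, N k) + (1 + t) := by
    have a1 := vnEnt_add_ge hρb.1 hNb
    have a2 := vnEnt_add_le hρ'.1 hPb
    have e3 : rtr ((c : ℂ) • ∑ k, N k) = t := by rw [rtr_smul, rtr_sum, htn]
    rw [rtr_density hρb, e3, e2] at a1
    have a3 := h_bound ht0
    linarith
  have hsum : vnEnt ρ' + c * ∑ k, vnEnt (P k) - c * ∑ k, vnEnt (N k) - (1 + t) ≤ c * ∑ k, vnEnt (ρ k) := by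
    have := mul_le_mul_of_nonneg_left (Finset.sum_le_sum fun k (_ : k ∈ Finset.univ) => hlow k) h0.le
    refine le_trans (le_of_eq ?_) this
    simp only [Finset.sum_sub_distrib, Finset.sum_add_distrib, Finset.sum_const, Finset.card_univ, nsmul_eq_mul, mul_one]
    rw [ht]
    linear_combination (1 - vnEnt ρ') * hc
  have b1 := vnEnt_avg_le hP hc
  have b2 := vnEnt_concave N hN hc
  rw [← ht] at b1
  have hl : 0 ≤ Real.log (Fintype.card κ) := Real.log_nonneg (by exact_mod_cast hcard)
  have : Real.log (Fintype.card κ) * t ≤ δ * Real.log (Fintype.card κ) := by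
    rw [mul_comm]; exact mul_le_mul_of_nonneg_right (by linarith) hl
  linarith

end CovertPaper

end

end

section
open Matrix Filter
open scoped Kronecker Classical ComplexOrder MatrixOrder

noncomputable section
set_option linter.unusedSectionVars false
set_option linter.unusedVariables false

namespace CovertPaper

variable {B W : Type*} [Fintype B] [DecidableEq B] [Fintype W] [DecidableEq W]

lemma traceNorm_ge {ι : Type*} [Fintype ι] [DecidableEq ι] {A : Matrix ι ι ℂ} (hA : A.IsHermitian) :
    -rtr A ≤ traceNorm A := by
  obtain ⟨P, N, hP, hN, h1, h2⟩ := exists_parts hA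
  rw [← h2]
  nth_rewrite 1 [h1]
  rw [rtr_sub]
  have := rtr_nonneg hP
  have := rtr_nonneg hN
  linarith

lemma converse_oneshot {π : Fin 2 → Matrix (B × W) (B × W) ℂ} (hπ : ∀ x, IsDensity (π x))
    (hσ : SuppLE (bobOut π 1) (bobOut π 0)) (hω : SuppLE (willieOut π 1) (willieOut π 0))
    {n M L : ℕ} {ε δcov δsec : ℝ} (hn : 0 < n) (hM : 1 ≤ M) (hε : ε < 1) (hδ : 0 < δsec) (hδ1 : δsec < 1)
    (hcode : CodeExists π n M L 1 ε δcov δsec) :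
    ∃ w : ℝ, 0 ≤ w ∧ w ≤ n ∧
      n * relEnt (mixS (willieOut π 1) (willieOut π 0) (w / n)) (willieOut π 0) ≤ δcov ∧
      (1 - ε) * ((1 - δsec) * Real.log M + w * relEnt (willieOut π 1) (willieOut π 0) - δcov - 2 - 2 * δsec)
        ≤ w * relEnt (bobOut π 1) (bobOut π 0) + Real.log 2 := by
  obtain ⟨f, Λ, hΛ, herr, hcov, ρ', hρ', hsec⟩ := hcode
  have hMr : (1:ℝ) ≤ M := by exact_mod_cast hM
  have hMne : (M:ℝ) ≠ 0 := by positivity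
  -- L is positive
  have hL : 1 ≤ L := by
    by_contra hL
    have hL0 : L = 0 := by omega
    subst hL0
    have : ∀ m, 1 ≤ traceNorm (willieMsg π f m - ρ') := by
      intro m
      have e : willieMsg π f m - ρ' = -ρ' := by unfold willieMsg; simp
      rw [e]
      have := traceNorm_ge hρ'.1.1.neg
      rwa [rtr_neg, neg_neg, rtr_density hρ'] at this
    have h2 : (M:ℝ)⁻¹ * ∑ m : Fin M, (1:ℝ) ≤ (M : ℝ)⁻¹ * ∑ m, traceNorm (willieMsg π f m - ρ') := by
      gcongr with m; exact this m
    simp [hMne] at h2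
    linarith
  have hLr : (1:ℝ) ≤ L := by exact_mod_cast hL
  have hLne : (L:ℝ) ≠ 0 := by positivity
  have hB := bobOut_density hπ
  have hW := willieOut_density hπ
  obtain ⟨c, hc⟩ : ∃ c : ℝ, c = ((M : ℝ) * L * (1 : ℕ))⁻¹ := ⟨_, rfl⟩
  have hc' : c = (M:ℝ)⁻¹ * (L:ℝ)⁻¹ := by rw [hc]; push_cast; rw [mul_one, mul_inv]
  have hcard : c * Fintype.card (Fin M × Fin L) = 1 := by
    rw [hc']; simp; field_simp
  have hcM : (M:ℝ)⁻¹ * Fintype.card (Fin M) = 1 := by simp [hMne]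
  have hcL : (L:ℝ)⁻¹ * Fintype.card (Fin L) = 1 := by simp [hLne]
  set x : Fin M × Fin L → Fin n → Fin 2 := fun k => f k.1 k.2 0 with hx
  have hmsg : ∀ m, willieMsg π f m = (((L:ℝ)⁻¹ : ℝ) : ℂ) • ∑ ℓ, stringState (willieOut π) (x (m, ℓ)) := by
    intro m; unfold willieMsg willieWord; simp [hx]
  have havg : willieAvg π f = (c : ℂ) • ∑ k, stringState (willieOut π) (x k) := by
    unfold willieAvg willieWord
    rw [Fintype.sum_prod_type, ← hc]; simp [hx]
  have havg2 : willieAvg π f = (((M:ℝ)⁻¹ : ℝ) : ℂ) • ∑ m, willieMsg π f m := by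
    rw [havg, Fintype.sum_prod_type, hc', Complex.ofReal_mul, mul_smul]
    congr 1
    rw [Finset.smul_sum]
    exact Finset.sum_congr rfl fun m _ => (hmsg m).symm
  have hmsgd : ∀ m, IsDensity (willieMsg π f m) := by
    intro m; rw [hmsg]; exact avg_density (fun ℓ => str_density hW _) hcL
  refine ⟨awt c x, awt_nonneg hcard x, awt_le hcard x, ?_, ?_⟩
  · refine (relEnt_lower hW hω hn hcard x).trans ?_
    rw [← havg]; exact hcov
  -- Bob
  have hF : (1 - ε) * (Real.log M + Real.log L) - Real.log 2 ≤ awt c x * relEnt (bobOut π 1) (bobOut π 0) := by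
    have hfano := fano (ρ := fun k => stringState (bobOut π) (x k)) (Λ := fun k : Fin M × Fin L => Λ 0 k.1 k.2)
      (fun k => str_density hB _) (fun k => hΛ.1 _ _ _) (by rw [Fintype.sum_prod_type]; exact hΛ.2 0) hcard (ε := ε) ?_
    · have := hfano.trans (holevo_le hB hσ hcard x)
      have e : Real.log ((Fintype.card (Fin M × Fin L) : ℕ) : ℝ) = Real.log M + Real.log L := by
        simp only [Fintype.card_prod, Fintype.card_fin, Nat.cast_mul]
        exact Real.log_mul hMne hLne
      rwa [e] at this
    · refine le_trans (le_of_eq ?_) herr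
      unfold avgErr bobWord rtr
      rw [Fintype.sum_prod_type, ← hc]; simp [hx]
  -- Willie
  have hH := holevo_eq hW hω hcard x
  rw [← havg] at hH
  have hS := secrecy_bound hmsgd hρ' hcM (by simpa using hM) hsec
  rw [← havg2] at hS
  have hLl : (M:ℝ)⁻¹ * ∑ m, vnEnt (willieMsg π f m) ≤ c * ∑ k, vnEnt (stringState (willieOut π) (x k)) + Real.log L := by
    have h1 : ∀ m, vnEnt (willieMsg π f m) ≤ (L:ℝ)⁻¹ * ∑ ℓ, vnEnt (stringState (willieOut π) (x (m, ℓ))) + Real.log L := by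
      intro m
      rw [hmsg]
      refine (vnEnt_avg_le (fun ℓ => (str_density hW _).1) hcL).trans (le_of_eq ?_)
      have : (L:ℝ)⁻¹ * ∑ ℓ, rtr (stringState (willieOut π) (x (m, ℓ))) = 1 := by
        rw [Finset.sum_congr rfl fun ℓ _ => rtr_density (str_density hW _)]; simp [hLne]
      rw [this]; simp
    have := mul_le_mul_of_nonneg_left (Finset.sum_le_sum fun m (_ : m ∈ Finset.univ) => h1 m) (inv_nonneg.2 (zero_le_one.trans hMr))
    refine this.trans (le_of_eq ?_)
    rw [Fintype.sum_prod_type, Finset.sum_add_distrib, ← Finset.mul_sum, hc']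
    simp
    field_simp
  have hcov' : relEnt (willieAvg π f) (tpow (willieOut π 0) n) ≤ δcov := hcov
  simp only [Fintype.card_fin] at hS
  have key : (1 - δsec) * Real.log M + awt c x * relEnt (willieOut π 1) (willieOut π 0) - δcov - 2 - 2 * δsec ≤ Real.log M + Real.log L := by
    linarith
  have := mul_le_mul_of_nonneg_left key (show 0 ≤ 1 - ε by linarith)
  linarith

lemma sqrt_tendsto : Tendsto (fun n : ℕ => Real.sqrt (n : ℝ)) atTop atTop :=
  Real.tendsto_sqrt_atTop.comp tendsto_natCast_atTop_atTop

lemma weight_bound [Nonempty W] {ω₁ ω₀ : Matrix W W ℂ} (h1 : IsDensity ω₁) (h0 : IsDensity ω₀)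
    (h : SuppLE ω₁ ω₀) (hne : ω₁ ≠ ω₀) {c : ℝ} (hc0 : 0 < c) (hc : c < 2⁻¹ * chiSq ω₁ ω₀) :
    ∀ᶠ n : ℕ in atTop, ∀ w : ℝ, 0 ≤ w → w ≤ n → n * relEnt (mixS ω₁ ω₀ (w / n)) ω₀ ≤ 1 →
      w ≤ Real.sqrt n / Real.sqrt c := by
  have ha := sq_pos h1 h0 hne
  obtain ⟨a, haa⟩ : ∃ a, a = rtr ((ω₁ - ω₀) * (ω₁ - ω₀)) / 2 := ⟨_, rfl⟩
  have ha' : 0 < a := by rw [haa]; linarith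
  have ht := (chi_taylor h1 h0 h).eventually (lt_mem_nhds hc)
  rw [eventually_nhdsWithin_iff] at ht
  obtain ⟨r, hr, hball⟩ := Metric.eventually_nhds_iff.1 ht
  have hbig : ∀ᶠ n : ℕ in atTop, 1 / (a * r ^ 2) < (n : ℝ) := tendsto_natCast_atTop_atTop.eventually_gt_atTop _
  filter_upwards [hbig, eventually_gt_atTop 0] with n hn hn0 w hw0 hwn hrel
  have hn' : (0:ℝ) < n := by exact_mod_cast hn0
  obtain ⟨α, hα⟩ : ∃ α, α = w / n := ⟨_, rfl⟩
  have hwα : w = n * α := by rw [hα]; field_simp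
  have hα0 : 0 ≤ α := by rw [hα]; positivity
  have hα1 : α ≤ 1 := by rw [hα, div_le_one hn']; exact hwn
  rw [← hα] at hrel
  have hlow := mixS_lower h1 h0 h hα0 hα1
  rw [← haa] at hlow
  have hαr : α < r := by
    by_contra hcon
    push Not at hcon
    have : r ^ 2 ≤ α ^ 2 := by gcongr
    rw [div_lt_iff₀ (by positivity)] at hn
    have : n * (a * r ^ 2) ≤ n * (a * α ^ 2) := by gcongr
    have : n * (a * α ^ 2) ≤ n * relEnt (mixS ω₁ ω₀ α) ω₀ := by gcongr
    linarith
  have hg : c * α ^ 2 ≤ relEnt (mixS ω₁ ω₀ α) ω₀ := by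
    rcases hα0.eq_or_lt with he | hpos
    · rw [← he]; simp [mixS, relEnt_self]
    · have := hball (by rw [Real.dist_eq, sub_zero, abs_of_pos hpos]; exact hαr) (by simpa using hpos.ne')
      rw [lt_div_iff₀ (by positivity)] at this
      exact this.le
  have h3 : n * (c * α ^ 2) ≤ 1 := (mul_le_mul_of_nonneg_left hg hn'.le).trans hrel
  rw [← Real.sqrt_div' _ hc0.le]
  apply Real.le_sqrt_of_sq_le
  rw [hwα, le_div_iff₀ hc0]
  nlinarith

lemma converse_aux {π : Fin 2 → Matrix (B × W) (B × W) ℂ} (hπ : ∀ x, IsDensity (π x))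
    (hσ : SuppLE (bobOut π 1) (bobOut π 0)) (hω : SuppLE (willieOut π 1) (willieOut π 0))
    (hne : willieOut π 1 ≠ willieOut π 0) [Nonempty W] {LS : ℝ} (hLS : AchievableNoKey π LS)
    {t : ℝ} (ht0 : 0 < t) (ht1 : t < 1) :
    (1 - t) * (1 - t) * LS ≤ max 0 (relEnt (bobOut π 1) (bobOut π 0) - (1 - t) * relEnt (willieOut π 1) (willieOut π 0)) /
        Real.sqrt ((1 - t) * (2⁻¹ * chiSq (willieOut π 1) (willieOut π 0))) := by
  have hW := willieOut_density hπ
  have hχ := chi_pos (hW 1) (hW 0) hω hne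
  have hev := hLS.2 t 1 t ht0 one_pos ht0
  have hc0 : 0 < (1 - t) * (2⁻¹ * chiSq (willieOut π 1) (willieOut π 0)) := mul_pos (by linarith) hχ
  have hw := weight_bound (hW 1) (hW 0) hω hne hc0 (by nlinarith)
  obtain ⟨X, hX⟩ : ∃ X, X = relEnt (bobOut π 1) (bobOut π 0) - (1 - t) * relEnt (willieOut π 1) (willieOut π 0) := ⟨_, rfl⟩
  obtain ⟨s, hs⟩ : ∃ s, s = Real.sqrt ((1 - t) * (2⁻¹ * chiSq (willieOut π 1) (willieOut π 0))) := ⟨_, rfl⟩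
  rw [← hs] at hw ⊢
  rw [← hX]
  have hmain : ∀ᶠ n : ℕ in atTop, (1 - t) * (1 - t) * LS - max 0 X / s ≤ 6 * (Real.sqrt n)⁻¹ := by
    filter_upwards [hev, hw, eventually_gt_atTop 0] with n ⟨M, L, hM, hcode⟩ hwn hn0
    have hn' : (0:ℝ) < n := by exact_mod_cast hn0
    have hsn : 0 < Real.sqrt n := Real.sqrt_pos.2 hn'
    rw [mul_one] at hM
    have hM1 : 1 ≤ M := by
      rcases Nat.eq_zero_or_pos M with h | h
      · rw [h] at hM; simp at hM
        have := mul_pos hsn hLS.1; linarith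
      · exact h
    obtain ⟨w, hw0, hw1, hrel, hfin⟩ := converse_oneshot hπ hσ hω hn0 hM1 ht1 ht0 ht1 hcode
    have hwb := hwn w hw0 hw1 hrel
    have h2 : w * X ≤ Real.sqrt n / s * max 0 X :=
      (mul_le_mul_of_nonneg_left (le_max_right 0 X) hw0).trans (mul_le_mul_of_nonneg_right hwb (le_max_left _ _))
    have hlog2 : Real.log 2 ≤ 1 := by
      have := Real.log_le_sub_one_of_pos (show (0:ℝ) < 2 by norm_num); linarith
    have h3 : (1 - t) * (1 - t) * (Real.sqrt n * LS) ≤ (1 - t) * (1 - t) * Real.log M :=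
      mul_le_mul_of_nonneg_left hM (mul_nonneg (by linarith) (by linarith))
    have h4 : (1 - t) * (1 - t) * (Real.sqrt n * LS) ≤ Real.sqrt n / s * max 0 X + 6 := by
      have : (1 - t) * (1 - t) * Real.log M ≤ w * X + Real.log 2 + (1 - t) * (3 + 2 * t) := by
        rw [hX]; linarith
      nlinarith
    rw [← div_eq_mul_inv, le_div_iff₀ hsn]
    have : Real.sqrt n / s * max 0 X = max 0 X / s * Real.sqrt n := by ring
    linarith
  have hlim : Tendsto (fun n : ℕ => 6 * (Real.sqrt n)⁻¹) atTop (nhds 0) := by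
    have := (sqrt_tendsto.inv_tendsto_atTop).const_mul 6
    simpa using this
  have := ge_of_tendsto hlim hmain
  linarith

lemma converse {π : Fin 2 → Matrix (B × W) (B × W) ℂ} (hπ : ∀ x, IsDensity (π x))
    (hσ : SuppLE (bobOut π 1) (bobOut π 0)) (hω : SuppLE (willieOut π 1) (willieOut π 0))
    (hne : willieOut π 1 ≠ willieOut π 0) [Nonempty W] {LS : ℝ} (hLS : AchievableNoKey π LS) :
    LS ≤ max 0 (relEnt (bobOut π 1) (bobOut π 0) - relEnt (willieOut π 1) (willieOut π 0)) /
        Real.sqrt (2⁻¹ * chiSq (willieOut π 1) (willieOut π 0)) := by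
  have hW := willieOut_density hπ
  have hχ := chi_pos (hW 1) (hW 0) hω hne
  have hs := (Real.sqrt_pos.2 hχ).ne'
  obtain ⟨χ, hχe⟩ : ∃ χ, χ = 2⁻¹ * chiSq (willieOut π 1) (willieOut π 0) := ⟨_, rfl⟩
  have haux := fun t : ℝ => fun h0 h1 => converse_aux hπ hσ hω hne hLS (t := t) h0 h1
  rw [← hχe] at haux hs ⊢
  obtain ⟨DB, hDB⟩ : ∃ χ, χ = relEnt (bobOut π 1) (bobOut π 0) := ⟨_, rfl⟩
  obtain ⟨DW, hDW⟩ : ∃ χ, χ = relEnt (willieOut π 1) (willieOut π 0) := ⟨_, rfl⟩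
  rw [← hDB, ← hDW] at haux ⊢
  have c1 : Tendsto (fun t : ℝ => (1 - t) * (1 - t) * LS) (nhdsWithin 0 (Set.Ioi 0)) (nhds LS) := by
    have : Continuous fun t : ℝ => (1 - t) * (1 - t) * LS := by fun_prop
    have := this.tendsto 0
    simp only [sub_zero, one_mul] at this
    exact this.mono_left nhdsWithin_le_nhds
  have c2 : Tendsto (fun t : ℝ => max 0 (DB - (1 - t) * DW) / Real.sqrt ((1 - t) * χ)) (nhdsWithin 0 (Set.Ioi 0))
      (nhds (max 0 (DB - DW) / Real.sqrt χ)) := by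
    have a1 : Continuous fun t : ℝ => max 0 (DB - (1 - t) * DW) := by fun_prop
    have a2 : Continuous fun t : ℝ => Real.sqrt ((1 - t) * χ) := by fun_prop
    have := (a1.tendsto 0).div (a2.tendsto 0) (by simpa using hs)
    simp only [sub_zero, one_mul] at this
    exact this.mono_left nhdsWithin_le_nhds
  refine le_of_tendsto_of_tendsto c1 c2 ?_
  filter_upwards [Ioo_mem_nhdsGT (show (0:ℝ) < 1 by norm_num)] with t ht
  exact haux t ht.1 ht.2

end CovertPaper

end

end

section
open Matrix Filter
open scoped Kronecker Classical ComplexOrder MatrixOrder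

noncomputable section
set_option linter.unusedSectionVars false
set_option linter.unusedVariables false

namespace CovertPaper

variable {B W : Type*} [Fintype B] [DecidableEq B] [Fintype W] [DecidableEq W]

lemma relEnt_zero_left {ι : Type*} [Fintype ι] [DecidableEq ι] (σ : Matrix ι ι ℂ) : relEnt 0 σ = 0 := by
  unfold relEnt; simp

lemma degenerate_covert {π : Fin 2 → Matrix (B × W) (B × W) ℂ} (he : willieOut π 1 = willieOut π 0)
    {n M L K : ℕ} (f : Fin M → Fin L → Fin K → Fin n → Fin 2) {δ : ℝ} (hδ : 0 < δ) : Covert π f δ := by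
  unfold Covert
  have h1 : ∀ x : Fin n → Fin 2, willieWord π x = tpow (willieOut π 0) n := by
    intro x
    unfold willieWord
    rw [stringState_eq, tpow_eq]
    congr 1
    ext1 i
    have h : x i = 0 ∨ x i = 1 := by
      generalize x i = y
      fin_cases y <;> simp
    rcases h with h | h <;> rw [h]
    exact he
  have h2 : willieAvg π f = tpow (willieOut π 0) n ∨ willieAvg π f = 0 := by
    unfold willieAvg
    simp only [h1, Finset.sum_const, Finset.card_univ, Fintype.card_fin]
    by_cases h : ((M:ℝ) * L * K) = 0
    · right; rw [h]; simp
    · left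
      have hM : (M:ℂ) ≠ 0 := by
        intro h'; apply h; have : (M:ℝ) = 0 := by exact_mod_cast h'
        rw [this]; simp
      have hL : (L:ℂ) ≠ 0 := by
        intro h'; apply h; have : (L:ℝ) = 0 := by exact_mod_cast h'
        rw [this]; simp
      have hK : (K:ℂ) ≠ 0 := by
        intro h'; apply h; have : (K:ℝ) = 0 := by exact_mod_cast h'
        rw [this]; simp
      simp only [← Nat.cast_smul_eq_nsmul ℂ, smul_smul]
      push_cast
      have : ((M:ℂ) * L * K)⁻¹ * (M * (L * K)) = 1 := by field_simp
      rw [this, one_smul]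
  rcases h2 with h | h <;> rw [h]
  · rw [relEnt_self]; exact hδ.le
  · rw [relEnt_zero_left]; exact hδ.le

lemma degenerate {π : Fin 2 → Matrix (B × W) (B × W) ℂ} (he : willieOut π 1 = willieOut π 0) :
    covertSecrecyCapacity π = 0 := by
  unfold covertSecrecyCapacity
  by_cases hemp : {LS : ℝ | AchievableNoKey π LS} = ∅
  · rw [hemp, Real.sSup_empty]
  obtain ⟨LS, hLS⟩ := Set.nonempty_iff_ne_empty.2 hemp
  apply Real.sSup_of_not_bddAbove
  rintro ⟨b, hb⟩
  have hbig : ∀ LS' : ℝ, 0 < LS' → AchievableNoKey π LS' := by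
    intro LS' h'
    refine ⟨h', fun ε δcov δsec h1 h2 h3 => ?_⟩
    have hr : 0 < LS' / LS := div_pos h' hLS.1
    filter_upwards [hLS.2 ε (δcov * (LS' / LS) ^ 2) δsec h1 (by positivity) h3] with n ⟨M, L, hM, f, Λ, c1, c2, c3, c4⟩
    refine ⟨M, L, ?_, f, Λ, c1, c2, degenerate_covert he f h2, c4⟩
    refine le_trans (le_of_eq ?_) hM
    rw [← mul_assoc, Real.sqrt_mul (by positivity) ((LS' / LS) ^ 2), Real.sqrt_sq hr.le, mul_assoc, div_mul_cancel₀ _ hLS.1.ne']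
  have := hb (hbig (max b 0 + 1) (by positivity))
  have := le_max_left b 0
  linarith

lemma degenerate_chi {ι : Type*} [Fintype ι] [DecidableEq ι] (ω : Matrix ι ι ℂ) : chiSq ω ω = 0 := by
  unfold chiSq
  have : (fun α : ℝ => relEnt ((α : ℂ) • ω + ((1 - α : ℝ) : ℂ) • ω) ω) = fun _ => 0 := by
    ext α
    have : (α : ℂ) • ω + ((1 - α : ℝ) : ℂ) • ω = ω := by push_cast; module
    rw [this, relEnt_self]
  rw [this]
  simp [iteratedDeriv_const]

section Prob
variable {X κ : Type*} [Fintype X] [DecidableEq X] [Fintype κ] [DecidableEq κ]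

lemma sum_prod_all (G : κ → X → ℝ) : ∑ c : κ → X, ∏ k, G k (c k) = ∏ k, ∑ x, G k x := by
  rw [Finset.prod_univ_sum, Fintype.piFinset_univ]

/-- codebook weight -/
def cb (p : X → ℝ) (c : κ → X) : ℝ := ∏ k, p (c k)

lemma cb_nonneg {p : X → ℝ} (hp : ∀ x, 0 ≤ p x) (c : κ → X) : 0 ≤ cb p c :=
  Finset.prod_nonneg fun k _ => hp _

lemma cb_sum {p : X → ℝ} (h1 : ∑ x, p x = 1) : ∑ c : κ → X, cb p c = 1 := by
  unfold cb; rw [sum_prod_all (fun _ => p)]; simp [h1]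

lemma cb_two {p : X → ℝ} (h1 : ∑ x, p x = 1) {k j : κ} (hkj : k ≠ j) (F G : X → ℝ) :
    ∑ c : κ → X, cb p c * (F (c k) * G (c j)) = (∑ x, p x * F x) * ∑ x, p x * G x := by
  have e : ∀ c : κ → X, cb p c * (F (c k) * G (c j)) =
      ∏ i, (p (c i) * ((if i = k then F (c i) else 1) * (if i = j then G (c i) else 1))) := by
    intro c
    rw [Finset.prod_mul_distrib, Finset.prod_mul_distrib]
    simp [cb]
  rw [Finset.sum_congr rfl fun c _ => e c,
    sum_prod_all (fun i x => p x * ((if i = k then F x else 1) * (if i = j then G x else 1)))]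
  have e2 : ∀ i, ∑ x, p x * ((if i = k then F x else 1) * (if i = j then G x else 1)) =
      (if i = k then ∑ x, p x * F x else 1) * (if i = j then ∑ x, p x * G x else 1) := by
    intro i
    by_cases hk : i = k
    · have : i ≠ j := fun h => hkj (hk.symm.trans h)
      simp [hk, hkj]
    · by_cases hj : i = j
      · simp [hj, hkj.symm]
      · simp [hk, hj, h1]
  rw [Finset.prod_congr rfl fun i _ => e2 i, Finset.prod_mul_distrib]
  simp

lemma cb_marg {p : X → ℝ} (h1 : ∑ x, p x = 1) (k : κ) (F : X → ℝ) :
    ∑ c : κ → X, cb p c * F (c k) = ∑ x, p x * F x := by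
  have e : ∀ c : κ → X, cb p c * F (c k) =
      ∏ i, (p (c i) * (if i = k then F (c i) else 1)) := by
    intro c
    rw [Finset.prod_mul_distrib]
    simp [cb]
  rw [Finset.sum_congr rfl fun c _ => e c,
    sum_prod_all (fun i x => p x * (if i = k then F x else 1))]
  have e2 : ∀ i, ∑ x, p x * (if i = k then F x else 1) =
      (if i = k then ∑ x, p x * F x else 1) := by
    intro i
    by_cases hk : i = k
    · simp [hk]
    · simp [hk, h1]
  rw [Finset.prod_congr rfl fun i _ => e2 i]
  simp

lemma cb_pair {p : X → ℝ} (h1 : ∑ x, p x = 1) {k j : κ} (hkj : k ≠ j) (F : X → X → ℝ) :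
    ∑ c : κ → X, cb p c * F (c k) (c j) = ∑ x, p x * ∑ y, p y * F x y := by
  have e : ∀ c : κ → X, cb p c * F (c k) (c j) = ∑ z, cb p c * ((if c k = z then 1 else 0) * F z (c j)) := by
    intro c
    rw [← Finset.mul_sum]; simp
  rw [Finset.sum_congr rfl fun c _ => e c, Finset.sum_comm]
  refine Finset.sum_congr rfl fun z _ => ?_
  rw [cb_two h1 hkj (fun x => if x = z then 1 else 0) (fun y => F z y)]
  simp

lemma exists_le_avg {Y : Type*} [Fintype Y] {p : Y → ℝ} (hp : ∀ y, 0 ≤ p y) (h1 : ∑ y, p y = 1) (F : Y → ℝ) :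
    ∃ y, F y ≤ ∑ y, p y * F y := by
  by_contra hcon
  push Not at hcon
  have hs : ∑ y, p y * (∑ z, p z * F z) < ∑ y, p y * F y := by
    apply Finset.sum_lt_sum
    · intro y _; exact mul_le_mul_of_nonneg_left (hcon y).le (hp y)
    · by_contra h2
      push Not at h2
      have : ∀ y, p y = 0 := by
        intro y
        by_contra hy
        have hpos := lt_of_le_of_ne (hp y) (Ne.symm hy)
        have := mul_lt_mul_of_pos_left (hcon y) hpos
        linarith [h2 y (Finset.mem_univ y)]
      simp [this] at h1
  rw [← Finset.sum_mul, h1, one_mul] at hs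
  exact lt_irrefl _ hs

end Prob

end CovertPaper

end

end

section
open Matrix Filter
open scoped Kronecker Classical ComplexOrder MatrixOrder

noncomputable section
set_option linter.unusedSectionVars false
set_option linter.unusedVariables false

namespace CovertPaper

variable {ι : Type*} [Fintype ι] [DecidableEq ι]

lemma psd_conj {A : Matrix ι ι ℂ} (hA : A.PosSemidef) (K : Matrix ι ι ℂ) : (K * A * Kᴴ).PosSemidef :=
  hA.mul_mul_conjTranspose_same K

lemma psd_of_ge {A : Matrix ι ι ℂ} (h : 0 ≤ A) : A.PosSemidef := by
  have := Matrix.le_iff.1 h; rwa [sub_zero] at this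

lemma sqrt_ge {U : Matrix ι ι ℂ} (hU : U ∈ unitaryGroup ι ℂ) {s : ι → ℝ} (hs : ∀ i, 0 < s i)
    {A : Matrix ι ι ℂ} (hA : A.PosSemidef) (h : A * A ≤ ud U s * ud U s) : A ≤ ud U s := by
  have hSp : (ud U s).PosSemidef := ud_psd U fun i => (hs i).le
  have hE : (ud U s - A).IsHermitian := hSp.1.sub hA.1
  obtain ⟨V, hV, e, he⟩ := exists_ud hE
  refine le_of_psd_sub ?_
  rw [he]
  apply ud_psd
  intro i
  by_contra hi
  push Not at hi
  have h1 : ud U s * ud U s - A * A = ud U s * (ud U s - A) + (ud U s - A) * A := by noncomm_ring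
  have h2 : 0 ≤ mdist V (ud U s * ud U s - A * A) i := mdist_nonneg (Matrix.le_iff.1 h) i
  have hc : Vᴴ * ud V e = diagonal (fun i => (e i : ℂ)) * Vᴴ := by
    unfold ud; rw [← mul_assoc, ← mul_assoc, uni_l hV, one_mul]
  have hc2 : ud V e * V = V * diagonal (fun i => (e i : ℂ)) := by
    unfold ud; rw [mul_assoc, uni_l hV, mul_one]
  have h3 : mdist V (ud U s * ud U s - A * A) i = e i * mdist V (ud U s) i + e i * mdist V A i := by
    rw [h1, he]
    unfold mdist
    have e1 : Vᴴ * (ud U s * ud V e + ud V e * A) * V =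
        (Vᴴ * ud U s * V) * diagonal (fun i => (e i : ℂ)) + diagonal (fun i => (e i : ℂ)) * (Vᴴ * A * V) := by
      rw [mul_add, add_mul]
      congr 1
      · rw [mul_assoc, mul_assoc, hc2]; simp only [mul_assoc]
      · rw [← mul_assoc, hc]; simp only [mul_assoc]
    rw [e1, Matrix.add_apply, mul_diagonal, diagonal_mul]
    simp only [Complex.add_re, Complex.re_mul_ofReal, Complex.re_ofReal_mul]
    ring
  have h4 : 0 < mdist V (ud U s) i := by
    obtain ⟨m, hm, hml⟩ : ∃ m : ℝ, 0 < m ∧ ∀ j, m ≤ s j := by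
      have hne : (Finset.univ : Finset ι).Nonempty := ⟨i, Finset.mem_univ i⟩
      exact ⟨Finset.univ.inf' hne s, (Finset.lt_inf'_iff _).2 fun j _ => hs j, fun j => Finset.inf'_le _ (Finset.mem_univ j)⟩
    have h5 : mdist V (ud U s - ((m:ℝ):ℂ) • 1) i ≥ 0 := by
      apply mdist_nonneg
      rw [← ud_const hU, ud_sub]
      apply ud_psd; intro j; linarith [hml j]
    have h6 : mdist V (ud U s - ((m:ℝ):ℂ) • 1) i = mdist V (ud U s) i - m := by
      unfold mdist
      rw [mul_sub, sub_mul]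
      simp [uni_l hV]
    linarith
  have h5 := mdist_nonneg (V := V) hA i
  nlinarith

lemma psd_le_one_sq {A : Matrix ι ι ℂ} (hA : A.PosSemidef) (h1 : A ≤ 1) : A * A ≤ A := by
  obtain ⟨U, hU, d, hd, rfl⟩ := exists_ud_psd hA
  rw [ud_mul hU]
  apply le_of_psd_sub
  rw [ud_sub]
  apply ud_psd
  intro i
  have h2 : 0 ≤ mdist U (1 - ud U d) i := mdist_nonneg (Matrix.le_iff.1 h1) i
  have h3 : mdist U (1 - ud U d) i = 1 - d i := by
    have : (1 : Matrix ι ι ℂ) = ud U fun _ => 1 := by rw [ud_const hU]; simp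
    rw [this, ud_sub, mdist_self hU]
  have := hd i
  nlinarith

lemma hn_one {A B X R G : Matrix ι ι ℂ} (hA : A.PosSemidef) (hB : B.PosSemidef) (hX : Xᴴ = X)
    (hG : G = A + B) (hXG : X * G = R) (hGX : G * X = R) (hXGX : X * G * X = 1) (hR : A ≤ R) :
    1 - X * A * X ≤ (2 : ℂ) • (1 - A) + (4 : ℂ) • B := by
  apply le_of_psd_sub
  have hXB : X * B = R - X * A := by rw [← hXG, hG]; noncomm_ring
  have hBX : B * X = R - A * X := by rw [← hGX, hG]; noncomm_ring
  have hXBX : X * B * X = 1 - X * A * X := by rw [← hXGX, hG]; noncomm_ring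
  have e : (2 : ℂ) • (1 - A) + (4 : ℂ) • B - (1 - X * A * X) =
      (X - (2:ℂ) • 1) * B * (X - (2:ℂ) • 1) + (((2:ℝ):ℂ) • ((X - 1) * A * (X - 1)) + ((4:ℝ):ℂ) • (R - A)) := by
    have e1 : (X - (2:ℂ) • 1) * B * (X - (2:ℂ) • 1) = X * B * X - (2:ℂ) • (X * B) - (2:ℂ) • (B * X) + (4:ℂ) • B := by
      simp only [sub_mul, mul_sub, smul_mul_assoc, mul_smul_comm, one_mul, mul_one, smul_sub, smul_smul]
      norm_num; abel
    have e2 : (X - 1) * A * (X - 1) = X * A * X - X * A - A * X + A := by noncomm_ring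
    rw [e1, e2, hXBX, hXB, hBX]
    push_cast
    module
  rw [e]
  have hX2 : (X - (2:ℂ) • (1 : Matrix ι ι ℂ))ᴴ = X - (2:ℂ) • 1 := by
    rw [conjTranspose_sub, hX, conjTranspose_smul, conjTranspose_one]; simp
  have hX1 : (X - 1 : Matrix ι ι ℂ)ᴴ = X - 1 := by
    rw [conjTranspose_sub, hX, conjTranspose_one]
  have p1 := psd_conj hB (X - (2:ℂ) • 1)
  have p2 := psd_conj hA (X - 1)
  rw [hX2] at p1
  rw [hX1] at p2
  exact p1.add ((psd_ofReal_smul (by norm_num) p2).add (psd_ofReal_smul (by norm_num) (Matrix.le_iff.1 hR)))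

lemma hayashi_nagaoka {κ : Type*} [Fintype κ] [DecidableEq κ] {T : κ → Matrix ι ι ℂ} (hT : ∀ k, (T k).PosSemidef)
    (hT1 : ∀ k, T k ≤ 1) {z : ℝ} (hz : 0 < z) :
    ∃ Λ : κ → Matrix ι ι ℂ, (∀ k, (Λ k).PosSemidef) ∧ (1 - ∑ k, Λ k).PosSemidef ∧
      ∀ k, 1 - Λ k ≤ (2 : ℂ) • (1 - T k) + (4 : ℂ) • (∑ j ∈ Finset.univ.erase k, T j + ((z:ℝ):ℂ) • 1) := by
  have hS : (∑ k, T k).PosSemidef := psd_sum' _ fun k _ => hT k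
  obtain ⟨U, hU, d, hd, hSd⟩ := exists_ud_psd hS
  have hG : ∑ k, T k + ((z:ℝ):ℂ) • 1 = ud U fun i => d i + z := by
    rw [hSd, ← ud_const hU, ud_add]
  have hpos : ∀ i, 0 < d i + z := fun i => by linarith [hd i]
  set X := ud U fun i => (Real.sqrt (d i + z))⁻¹ with hXd
  set R := ud U fun i => Real.sqrt (d i + z) with hRd
  set G := ud U fun i => d i + z with hGd
  have hsq : ∀ i, Real.sqrt (d i + z) ≠ 0 := fun i => (Real.sqrt_pos.2 (hpos i)).ne'
  have hX : Xᴴ = X := (ud_isHermitian U _)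
  have hXG : X * G = R := by
    rw [hXd, hGd, hRd, ud_mul hU]; congr 1; ext i
    have := Real.mul_self_sqrt (hpos i).le
    nth_rewrite 2 [← this]
    rw [← mul_assoc, inv_mul_cancel₀ (hsq i), one_mul]
  have hGX : G * X = R := by
    rw [← hXG, hXd, hGd, ud_mul hU, ud_mul hU]; congr 1; ext i; ring
  have hone : (1 : Matrix ι ι ℂ) = ud U fun _ => 1 := by rw [ud_const hU]; simp
  have hXGX : X * G * X = 1 := by
    rw [hXG, hXd, hRd, ud_mul hU, hone]; congr 1; ext i; exact mul_inv_cancel₀ (hsq i)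
  refine ⟨fun k => X * T k * X, fun k => ?_, ?_, fun k => ?_⟩
  · have := psd_conj (hT k) X; rwa [hX] at this
  · have e : ∑ k, X * T k * X = X * (∑ k, T k) * X := by rw [Finset.mul_sum, Finset.sum_mul]
    have e2 : ∑ k, T k = G - ((z:ℝ):ℂ) • 1 := by rw [← hG]; simp
    have e3 : 1 - ∑ k, X * T k * X = ((z:ℝ):ℂ) • (X * 1 * Xᴴ) := by
      rw [e, e2, mul_sub, sub_mul, hXGX, hX]
      simp
    rw [e3]
    exact psd_ofReal_smul hz.le (psd_conj PosSemidef.one X)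
  · have hsplit : G = T k + (∑ j ∈ Finset.univ.erase k, T j + ((z:ℝ):ℂ) • 1) := by
      rw [← hG, ← add_assoc, Finset.add_sum_erase _ _ (Finset.mem_univ k)]
    have hB : (∑ j ∈ Finset.univ.erase k, T j + ((z:ℝ):ℂ) • (1 : Matrix ι ι ℂ)).PosSemidef :=
      (psd_sum' _ fun k _ => hT k).add (psd_ofReal_smul hz.le PosSemidef.one)
    refine hn_one (hT k) hB hX hsplit hXG hGX hXGX ?_
    refine sqrt_ge hU (fun i => Real.sqrt_pos.2 (hpos i)) (hT k) ?_
    refine (psd_le_one_sq (hT k) (hT1 k)).trans ?_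
    have : R * R = G := by
      rw [hRd, hGd, ud_mul hU]; congr 1; ext i; exact Real.mul_self_sqrt (hpos i).le
    rw [← hRd, this, hsplit]
    exact le_add_right_psd hB

section Bob
variable {X κ : Type*} [Fintype X] [DecidableEq X] [Fintype κ] [DecidableEq κ]

/-- One-shot random coding bound for the receiver. -/
lemma bob_oneshot {p : X → ℝ} (hp : ∀ x, 0 ≤ p x) (h1 : ∑ x, p x = 1) {ρ T : X → Matrix ι ι ℂ}
    (hρ : ∀ x, IsDensity (ρ x)) (hT : ∀ x, (T x).PosSemidef) (hT1 : ∀ x, T x ≤ 1)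
    {e1 e2 z c : ℝ} (hz : 0 < z) (hc : c * Fintype.card κ = 1)
    (he1 : ∑ x, p x * rtr (ρ x * (1 - T x)) ≤ e1)
    (he2 : ∑ x, p x * ∑ y, p y * rtr (ρ x * T y) ≤ e2) :
    ∃ Λ : (κ → X) → κ → Matrix ι ι ℂ, (∀ C k, (Λ C k).PosSemidef) ∧ (∀ C, (1 - ∑ k, Λ C k).PosSemidef) ∧
      ∑ C : κ → X, cb p C * (c * ∑ k, (1 - rtr (Λ C k * ρ (C k)))) ≤ 2 * e1 + 4 * Fintype.card κ * e2 + 4 * z := by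
  have hc0 := c_pos hc
  choose Λ hΛ1 hΛ2 hΛ3 using fun C : κ → X => hayashi_nagaoka (T := fun k => T (C k)) (fun k => hT _) (fun k => hT1 _) hz
  refine ⟨Λ, hΛ1, hΛ2, ?_⟩
  have hpt : ∀ C k, 1 - rtr (Λ C k * ρ (C k)) ≤ 2 * rtr (ρ (C k) * (1 - T (C k))) +
      4 * ∑ j ∈ Finset.univ.erase k, rtr (ρ (C k) * T (C j)) + 4 * z := by
    intro C k
    have := rtr_mul_mono (hρ (C k)).1 (hΛ3 C k)
    rw [mul_sub, mul_one, rtr_sub, rtr_density (hρ _), rtr_comm] at this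
    refine this.trans (le_of_eq ?_)
    have e2' : (2:ℂ) = ((2:ℝ):ℂ) := by norm_num
    have e4' : (4:ℂ) = ((4:ℝ):ℂ) := by norm_num
    rw [mul_add, rtr_add, mul_smul_comm, mul_smul_comm, e2', e4', rtr_smul, rtr_smul, mul_add, rtr_add,
      Finset.mul_sum, rtr_sum, mul_smul_comm, rtr_smul, mul_one, rtr_density (hρ _)]
    ring
  have hk : ∀ k, ∑ C : κ → X, cb p C * (1 - rtr (Λ C k * ρ (C k))) ≤ 2 * e1 + 4 * Fintype.card κ * e2 + 4 * z := by
    intro k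
    have he2' : 0 ≤ e2 := le_trans (Finset.sum_nonneg fun x _ => mul_nonneg (hp x) (Finset.sum_nonneg fun y _ => mul_nonneg (hp y) (rtr_mul_nonneg (hρ x).1 (hT y)))) he2
    calc ∑ C : κ → X, cb p C * (1 - rtr (Λ C k * ρ (C k)))
        ≤ ∑ C : κ → X, cb p C * (2 * rtr (ρ (C k) * (1 - T (C k))) +
      4 * ∑ j ∈ Finset.univ.erase k, rtr (ρ (C k) * T (C j)) + 4 * z) :=
          Finset.sum_le_sum fun C _ => mul_le_mul_of_nonneg_left (hpt C k) (cb_nonneg hp C)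
      _ = 2 * ∑ C : κ → X, cb p C * rtr (ρ (C k) * (1 - T (C k))) +
          4 * ∑ j ∈ Finset.univ.erase k, ∑ C : κ → X, cb p C * rtr (ρ (C k) * T (C j)) + 4 * z * ∑ C : κ → X, cb p C := by
          rw [Finset.sum_comm (s := Finset.univ.erase k)]
          simp only [Finset.mul_sum, mul_add, Finset.sum_add_distrib]
          congr 1
          · congr 1
            · exact Finset.sum_congr rfl fun _ _ => by ring
            · exact Finset.sum_congr rfl fun _ _ => Finset.sum_congr rfl fun _ _ => by ring
          · exact Finset.sum_congr rfl fun _ _ => by ring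
      _ ≤ 2 * e1 + 4 * ∑ j ∈ Finset.univ.erase k, e2 + 4 * z := by
          rw [cb_sum h1, mul_one, cb_marg h1 k (fun x => rtr (ρ x * (1 - T x)))]
          gcongr with j hj
          rw [cb_pair h1 (Finset.ne_of_mem_erase hj).symm (fun x y => rtr (ρ x * T y))]
          exact he2
      _ ≤ 2 * e1 + 4 * Fintype.card κ * e2 + 4 * z := by
          rw [Finset.sum_const, nsmul_eq_mul, ← mul_assoc]
          gcongr
          exact Finset.card_le_univ _
  calc ∑ C : κ → X, cb p C * (c * ∑ k, (1 - rtr (Λ C k * ρ (C k))))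
      = c * ∑ k, ∑ C : κ → X, cb p C * (1 - rtr (Λ C k * ρ (C k))) := by
        rw [Finset.sum_comm, Finset.mul_sum]
        refine Finset.sum_congr rfl fun C _ => ?_
        rw [← Finset.mul_sum]; ring
    _ ≤ c * ∑ k : κ, (2 * e1 + 4 * Fintype.card κ * e2 + 4 * z) := by
        gcongr with k; exact hk k
    _ = 2 * e1 + 4 * Fintype.card κ * e2 + 4 * z := by
        rw [Finset.sum_const, nsmul_eq_mul, Finset.card_univ, ← mul_assoc, hc, one_mul]

end Bob

end CovertPaper

end

end

section
open Matrix Filter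
open scoped Kronecker Classical ComplexOrder MatrixOrder

noncomputable section
set_option linter.unusedSectionVars false
set_option linter.unusedVariables false

namespace CovertPaper

section Gentle
variable {ι : Type*} [Fintype ι] [DecidableEq ι]

lemma one_add_sign_psd {S : Matrix ι ι ℂ} (hS : S.IsHermitian) (hS2 : S * S = 1) : (1 + S).PosSemidef := by
  have h := psd_conj (A := (1 : Matrix ι ι ℂ)) PosSemidef.one (1 + S)
  have e : (1 + S) = (((2:ℝ)⁻¹ : ℝ) : ℂ) • ((1 + S) * 1 * (1 + S)ᴴ) := by
    rw [conjTranspose_add, conjTranspose_one, hS.eq, mul_one, add_mul, mul_add, mul_add, hS2]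
    push_cast
    simp only [one_mul, mul_one]
    module
  rw [e]
  exact psd_ofReal_smul (by norm_num) h

lemma sign_bound {S Y ρ : Matrix ι ι ℂ} (hS : S.IsHermitian) (hS2 : S * S = 1) (hρ : IsDensity ρ)
    {s : ℝ} (hs : 0 < s) : 2 * rtr (S * Y * ρ) ≤ s + rtr (Y * ρ * Yᴴ) / s := by
  have h := rtr_nonneg (psd_conj hρ.1 ((s:ℂ) • S - Y))
  have e : ((s:ℂ) • S - Y) * ρ * ((s:ℂ) • S - Y)ᴴ =
      ((s*s:ℝ):ℂ) • (S * ρ * S) - (s:ℂ) • (S * ρ * Yᴴ) - (s:ℂ) • (Y * ρ * S) + Y * ρ * Yᴴ := by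
    rw [conjTranspose_sub, conjTranspose_smul, hS.eq]
    simp only [sub_mul, mul_sub, smul_mul_assoc, mul_smul_comm, smul_smul, Complex.star_def, Complex.conj_ofReal]
    push_cast
    simp only [smul_sub, smul_smul]
    abel
  rw [e, rtr_add, rtr_sub, rtr_sub, rtr_smul, rtr_smul, rtr_smul] at h
  have h1 : rtr (S * ρ * S) = 1 := by
    rw [rtr_comm, ← mul_assoc, hS2, one_mul, rtr_density hρ]
  have h2 : rtr (Y * ρ * S) = rtr (S * Y * ρ) := by rw [rtr_comm, mul_assoc S]
  have h3 : rtr (S * ρ * Yᴴ) = rtr (S * Y * ρ) := by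
    rw [← h2, ← rtr_ct (Y * ρ * S)]
    simp only [conjTranspose_mul, hS.eq, hρ.1.1.eq, mul_assoc]
  rw [h1, h2, h3] at h
  have : s * (2 * rtr (S * Y * ρ)) ≤ s * (s + rtr (Y * ρ * Yᴴ) / s) := by
    rw [mul_add, mul_div_cancel₀ _ hs.ne']; linarith
  exact le_of_mul_le_mul_left this hs

/-- Gentle operator bound for a product of two projections. -/
lemma gentle {S ρ P Q : Matrix ι ι ℂ} (hS : S.IsHermitian) (hS2 : S * S = 1) (hρ : IsDensity ρ)
    (hP : P.IsHermitian) (hP2 : P * P = P) (hQ : Q.IsHermitian) (hQ2 : Q * Q = Q)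
    {s : ℝ} (hs : 0 < s) :
    rtr (S * (ρ - (Q * P) * ρ * (Q * P)ᴴ)) ≤
      s + (rtr (ρ * (1 - P)) + rtr (ρ * (1 - Q))) / s + (rtr (ρ * (1 - P)) + rtr (ρ * (1 - Q))) := by
  obtain ⟨Y, hY⟩ : ∃ Y, Y = 1 - Q * P := ⟨_, rfl⟩
  have hK : Q * P = 1 - Y := by rw [hY]; abel
  have hYY : Yᴴ * Y ≤ (1 - P) + (1 - Q) := by
    apply le_of_psd_sub
    have e : (1 - P) + (1 - Q) - Yᴴ * Y = (1 - P) * (1 - Q) * (1 - P)ᴴ := by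
      rw [hY, conjTranspose_sub, conjTranspose_mul, conjTranspose_sub, conjTranspose_one, hP.eq, hQ.eq]
      have e1 : (1 - P * Q) * (1 - Q * P) = 1 - P * Q - Q * P + P * (Q * Q) * P := by noncomm_ring
      have e2 : (1 - P) * (1 - Q) * (1 - P) = 1 - P - P + P * P - Q + P * Q + Q * P - P * Q * P := by noncomm_ring
      rw [e1, e2, hQ2, hP2]; abel
    rw [e]
    apply psd_conj
    have := psd_conj (A := (1 : Matrix ι ι ℂ)) PosSemidef.one (1 - Q)
    rwa [mul_one, conjTranspose_sub, conjTranspose_one, hQ.eq, sub_mul, mul_sub, mul_sub, hQ2, one_mul, mul_one, one_mul, sub_self, sub_zero] at this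
  have hy : rtr (Y * ρ * Yᴴ) ≤ rtr (ρ * (1 - P)) + rtr (ρ * (1 - Q)) := by
    have := rtr_mul_mono hρ.1 hYY
    rw [mul_add, rtr_add] at this
    rw [mul_assoc, rtr_comm, mul_assoc]
    exact this
  have e : ρ - (1 - Y) * ρ * (1 - Y)ᴴ = Y * ρ + ρ * Yᴴ - Y * ρ * Yᴴ := by
    rw [conjTranspose_sub, conjTranspose_one]; noncomm_ring
  have h3 : rtr (S * (ρ * Yᴴ)) = rtr (S * Y * ρ) := by
    rw [mul_assoc S Y, ← rtr_comm (Y * ρ) S, ← rtr_ct (Y * ρ * S)]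
    simp only [conjTranspose_mul, hS.eq, hρ.1.1.eq, mul_assoc]
  have h4 := rtr_mul_nonneg (one_add_sign_psd hS hS2) (psd_conj hρ.1 Y)
  rw [add_mul, one_mul, rtr_add] at h4
  have h5 := sign_bound (Y := Y) hS hS2 hρ hs
  have h6 : rtr (Y * ρ * Yᴴ) / s ≤ (rtr (ρ * (1 - P)) + rtr (ρ * (1 - Q))) / s := by gcongr
  rw [hK, e, mul_sub, mul_add, rtr_sub, rtr_add, h3, ← mul_assoc S Y ρ]
  linarith

lemma second_moment_norm {S A U : Matrix ι ι ℂ} {d : ι → ℝ} (hS : S.IsHermitian) (hS2 : S * S = 1)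
    (hA : A.IsHermitian) (hU : U ∈ unitaryGroup ι ℂ) (hd : ∀ i, 0 < d i) {t : ℝ} (ht : 0 < t) :
    2 * rtr (S * A) ≤ t * rtr (ud U d) + rtr (A * ud U (fun i => (d i)⁻¹) * A) / t := by
  obtain ⟨R, hR⟩ : ∃ R, R = ud U fun i => Real.sqrt (d i) := ⟨_, rfl⟩
  obtain ⟨Z, hZ⟩ : ∃ Z, Z = ud U fun i => (Real.sqrt (d i))⁻¹ := ⟨_, rfl⟩
  have hsq : ∀ i, Real.sqrt (d i) ≠ 0 := fun i => (Real.sqrt_pos.2 (hd i)).ne'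
  have hone : (1 : Matrix ι ι ℂ) = ud U fun _ => 1 := by rw [ud_const hU]; simp
  have hRR : R * R = ud U d := by
    rw [hR, ud_mul hU]; congr 1; ext i; exact Real.mul_self_sqrt (hd i).le
  have hZZ : Z * Z = ud U fun i => (d i)⁻¹ := by
    rw [hZ, ud_mul hU]; congr 1; ext i; rw [← mul_inv, Real.mul_self_sqrt (hd i).le]
  have hRZ : R * Z = 1 := by
    rw [hR, hZ, ud_mul hU, hone]; congr 1; ext i; exact mul_inv_cancel₀ (hsq i)
  have hZR : Z * R = 1 := by
    rw [hR, hZ, ud_mul hU, hone]; congr 1; ext i; exact inv_mul_cancel₀ (hsq i)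
  have hRh : Rᴴ = R := by rw [hR]; exact ud_isHermitian U _
  have hZh : Zᴴ = Z := by rw [hZ]; exact ud_isHermitian U _
  have h := rtr_nonneg (psd_conj (A := (1 : Matrix ι ι ℂ)) PosSemidef.one ((t:ℂ) • (S * R) - A * Z))
  have e : ((t:ℂ) • (S * R) - A * Z) * 1 * ((t:ℂ) • (S * R) - A * Z)ᴴ =
      ((t*t:ℝ):ℂ) • (S * (R * R) * S) - (t:ℂ) • (S * (R * Z) * A) - (t:ℂ) • (A * (Z * R) * S) + A * (Z * Z) * A := by
    rw [conjTranspose_sub, conjTranspose_smul, conjTranspose_mul, conjTranspose_mul, hS.eq, hA.eq, hRh, hZh]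
    simp only [sub_mul, mul_sub, smul_mul_assoc, mul_smul_comm, smul_smul, Complex.star_def, Complex.conj_ofReal, mul_one, mul_assoc]
    push_cast
    simp only [smul_sub, smul_smul]
    abel
  rw [e, hRR, hRZ, hZR, hZZ, mul_one, mul_one, rtr_add, rtr_sub, rtr_sub, rtr_smul, rtr_smul, rtr_smul, rtr_comm A S] at h
  have h1 : rtr (S * ud U d * S) = rtr (ud U d) := by
    rw [rtr_comm, ← mul_assoc, hS2, one_mul]
  rw [h1] at h
  have : t * (2 * rtr (S * A)) ≤ t * (t * rtr (ud U d) + rtr (A * ud U (fun i => (d i)⁻¹) * A) / t) := by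
    rw [mul_add, mul_div_cancel₀ _ ht.ne']; linarith
  exact le_of_mul_le_mul_left this ht

lemma second_moment_le {A U : Matrix ι ι ℂ} {d : ι → ℝ} 
    (hA : A.PosSemidef) (hU : U ∈ unitaryGroup ι ℂ) (hd : ∀ i, 0 < d i) (hle : A ≤ ud U d) :
    rtr (A * ud U (fun i => (d i)⁻¹) * A) ≤ rtr A := by
  obtain ⟨R, hR⟩ : ∃ R, R = ud U fun i => Real.sqrt (d i) := ⟨_, rfl⟩
  obtain ⟨Z, hZ⟩ : ∃ Z, Z = ud U fun i => (Real.sqrt (d i))⁻¹ := ⟨_, rfl⟩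
  have hsq : ∀ i, Real.sqrt (d i) ≠ 0 := fun i => (Real.sqrt_pos.2 (hd i)).ne'
  have hone : (1 : Matrix ι ι ℂ) = ud U fun _ => 1 := by rw [ud_const hU]; simp
  have hRR : R * R = ud U d := by
    rw [hR, ud_mul hU]; congr 1; ext i; exact Real.mul_self_sqrt (hd i).le
  have hZZ : Z * Z = ud U fun i => (d i)⁻¹ := by
    rw [hZ, ud_mul hU]; congr 1; ext i; rw [← mul_inv, Real.mul_self_sqrt (hd i).le]
  have hRZ : R * Z = 1 := by
    rw [hR, hZ, ud_mul hU, hone]; congr 1; ext i; exact mul_inv_cancel₀ (hsq i)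
  have hZR : Z * R = 1 := by
    rw [hR, hZ, ud_mul hU, hone]; congr 1; ext i; exact inv_mul_cancel₀ (hsq i)
  have hRh : Rᴴ = R := by rw [hR]; exact ud_isHermitian U _
  have hZh : Zᴴ = Z := by rw [hZ]; exact ud_isHermitian U _
  have hT : (Z * A * Zᴴ).PosSemidef := psd_conj hA Z
  have hT1 : Z * A * Zᴴ ≤ 1 := by
    refine (conj_le hle Z).trans (le_of_eq ?_)
    rw [← hRR, hZh]
    calc Z * (R * R) * Z = (Z * R) * (R * Z) := by noncomm_ring
      _ = 1 := by rw [hZR, hRZ, mul_one]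
  have h := conj_le (psd_le_one_sq hT hT1) R
  have h2 := rtr_mono h
  rw [hZh, hRh] at h2
  have e1 : R * (Z * A * Z) * R = A := by
    calc R * (Z * A * Z) * R = (R * Z) * A * (Z * R) := by noncomm_ring
      _ = A := by rw [hRZ, hZR, one_mul, mul_one]
  have e2 : R * (Z * A * Z * (Z * A * Z)) * R = A * (Z * Z) * A := by
    calc R * (Z * A * Z * (Z * A * Z)) * R = (R * Z) * A * (Z * Z) * A * (Z * R) := by noncomm_ring
      _ = A * (Z * Z) * A := by rw [hRZ, hZR, one_mul, mul_one]
  rw [e1, e2, hZZ] at h2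
  exact h2

end Gentle
end CovertPaper

end

end

section
open Matrix Filter
open scoped Kronecker Classical ComplexOrder MatrixOrder

noncomputable section
set_option linter.unusedSectionVars false
set_option linter.unusedVariables false

namespace CovertPaper

section Cover
variable {ι : Type*} [Fintype ι] [DecidableEq ι]
variable {X κ η : Type*} [Fintype X] [DecidableEq X] [Fintype κ] [DecidableEq κ] [Fintype η] [DecidableEq η]

/-- Second-moment computation for i.i.d. samples. -/
lemma cover_second {p : X → ℝ} (hp : ∀ x, 0 ≤ p x) (h1 : ∑ x, p x = 1) {R : X → Matrix ι ι ℂ}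
    {J : Matrix ι ι ℂ} (hJ : J.PosSemidef) (hR : ∀ x, (R x).IsHermitian)
    (hb : ∀ x, rtr (R x * J * R x) ≤ 1) {e : η → κ} (he : Function.Injective e) {c : ℝ}
    (hc : c * Fintype.card η = 1) :
    ∑ C : κ → X, cb p C * rtr (((c:ℂ) • ∑ l, (R (C (e l)) - ∑ x, (p x : ℂ) • R x)) * J *
      ((c:ℂ) • ∑ l, (R (C (e l)) - ∑ x, (p x : ℂ) • R x))) ≤ c := by
  have hc0 := c_pos hc
  obtain ⟨m, hm⟩ : ∃ m, m = ∑ x, (p x : ℂ) • R x := ⟨_, rfl⟩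
  rw [← hm]
  have hmh : m.IsHermitian := by
    rw [hm, Matrix.IsHermitian, conjTranspose_sum]
    refine Finset.sum_congr rfl fun x _ => ?_
    rw [conjTranspose_smul, (hR x).eq]; simp
  have hz : ∑ y, (p y : ℂ) • (R y - m) = 0 := by
    simp only [smul_sub, Finset.sum_sub_distrib]
    rw [← hm, ← Finset.sum_smul]
    have : ∑ y, (p y : ℂ) = 1 := by exact_mod_cast h1
    rw [this, one_smul, sub_self]
  have hexp : ∀ C : κ → X, rtr (((c:ℂ) • ∑ l, (R (C (e l)) - m)) * J * ((c:ℂ) • ∑ l, (R (C (e l)) - m)))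
      = c * (c * ∑ l, ∑ l', rtr ((R (C (e l)) - m) * J * (R (C (e l')) - m))) := by
    intro C
    rw [smul_mul_assoc, smul_mul_assoc, mul_smul_comm, rtr_smul, rtr_smul, Finset.sum_mul, Finset.sum_mul, rtr_sum]
    congr 2
    refine Finset.sum_congr rfl fun l _ => ?_
    rw [Finset.mul_sum, rtr_sum]
  have hcross : ∀ l l', l ≠ l' → ∑ C : κ → X, cb p C * rtr ((R (C (e l)) - m) * J * (R (C (e l')) - m)) = 0 := by
    intro l l' hl
    rw [cb_pair h1 (fun h => hl (he h)) (fun x y => rtr ((R x - m) * J * (R y - m)))]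
    refine Finset.sum_eq_zero fun x _ => ?_
    have : ∑ y, p y * rtr ((R x - m) * J * (R y - m)) = rtr ((R x - m) * J * ∑ y, (p y : ℂ) • (R y - m)) := by
      rw [Finset.mul_sum, rtr_sum]
      refine Finset.sum_congr rfl fun y _ => ?_
      rw [mul_smul_comm, rtr_smul]
    rw [this, hz, mul_zero, rtr_zero, mul_zero]
  have hdiag : ∀ l, ∑ C : κ → X, cb p C * rtr ((R (C (e l)) - m) * J * (R (C (e l)) - m)) ≤ 1 := by
    intro l
    rw [cb_marg h1 (e l) (fun x => rtr ((R x - m) * J * (R x - m)))]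
    have e1 : ∀ x, rtr ((R x - m) * J * (R x - m)) = rtr (R x * J * R x) - 2 * rtr ((m * J) * R x) + rtr (m * J * m) := by
      intro x
      have : (R x - m) * J * (R x - m) = R x * J * R x - m * J * R x - R x * J * m + m * J * m := by noncomm_ring
      rw [this, rtr_add, rtr_sub, rtr_sub]
      have : rtr (R x * J * m) = rtr (m * J * R x) := by
        rw [← rtr_ct (R x * J * m)]
        simp only [conjTranspose_mul, (hR x).eq, hmh.eq, hJ.1.eq, mul_assoc]
      rw [this]; ring
    simp only [e1]
    have e2 : ∑ x, p x * rtr (m * J * R x) = rtr (m * J * m) := by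
      nth_rewrite 3 [hm]
      rw [Finset.mul_sum, rtr_sum]
      refine Finset.sum_congr rfl fun y _ => ?_
      rw [mul_smul_comm, rtr_smul]
    have e3 : ∑ x, p x * (rtr (R x * J * R x) - 2 * rtr ((m * J) * R x) + rtr (m * J * m)) =
        ∑ x, p x * rtr (R x * J * R x) - 2 * ∑ x, p x * rtr (m * J * R x) + (∑ x, p x) * rtr (m * J * m) := by
      rw [Finset.mul_sum, Finset.sum_mul, ← Finset.sum_sub_distrib, ← Finset.sum_add_distrib]
      exact Finset.sum_congr rfl fun _ _ => by ring
    rw [e3, e2, h1]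
    have e4 : 0 ≤ rtr (m * J * m) := by
      have := rtr_nonneg (psd_conj hJ m); rwa [hmh.eq] at this
    have e5 : ∑ x, p x * rtr (R x * J * R x) ≤ ∑ x, p x * 1 :=
      Finset.sum_le_sum fun x _ => mul_le_mul_of_nonneg_left (hb x) (hp x)
    simp only [mul_one, h1] at e5
    linarith
  simp only [hexp]
  calc ∑ C : κ → X, cb p C * (c * (c * ∑ l, ∑ l', rtr ((R (C (e l)) - m) * J * (R (C (e l')) - m))))
      = c * (c * ∑ l, ∑ l', ∑ C : κ → X, cb p C * rtr ((R (C (e l)) - m) * J * (R (C (e l')) - m))) := by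
        have : ∀ l, ∑ l', ∑ C : κ → X, cb p C * rtr ((R (C (e l)) - m) * J * (R (C (e l')) - m))
          = ∑ C : κ → X, ∑ l', cb p C * rtr ((R (C (e l)) - m) * J * (R (C (e l')) - m)) := fun l => Finset.sum_comm
        simp only [this]
        rw [Finset.sum_comm, Finset.mul_sum, Finset.mul_sum]
        refine Finset.sum_congr rfl fun C _ => ?_
        simp only [← Finset.mul_sum]; ring
    _ = c * (c * ∑ l, ∑ C : κ → X, cb p C * rtr ((R (C (e l)) - m) * J * (R (C (e l)) - m))) := by
        congr 2
        refine Finset.sum_congr rfl fun l _ => ?_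
        exact Finset.sum_eq_single l (fun l' _ h => hcross l l' h.symm) (fun h => absurd (Finset.mem_univ l) h)
    _ ≤ c * (c * ∑ l : η, 1) := by
        gcongr with l; exact hdiag l
    _ = c := by
        rw [Finset.sum_const, nsmul_eq_mul, Finset.card_univ, mul_one, hc, mul_one]

/-- One-shot covering bound for the eavesdropper. -/
lemma cover_oneshot {p : X → ℝ} (hp : ∀ x, 0 ≤ p x) (h1 : ∑ x, p x = 1) {ρ P Q : X → Matrix ι ι ℂ}
    (hρ : ∀ x, IsDensity (ρ x)) (hP : ∀ x, (P x).IsHermitian) (hP2 : ∀ x, P x * P x = P x)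
    (hQ : ∀ x, (Q x).IsHermitian) (hQ2 : ∀ x, Q x * Q x = Q x) {ω : Matrix ι ι ℂ} (hω : IsDensity ω) [Nonempty ι]
    {a u s t c : ℝ} (ha : 0 < a) (hs : 0 < s) (ht : 0 < t)
    (hle : ∀ x, (Q x * P x) * ρ x * (Q x * P x)ᴴ ≤ (a:ℂ) • ω)
    (hu : ∑ x, p x * (rtr (ρ x * (1 - P x)) + rtr (ρ x * (1 - Q x))) ≤ u)
    {e : η → κ} (he : Function.Injective e) (hc : c * Fintype.card η = 1) :
    ∑ C : κ → X, cb p C * traceNorm ((c:ℂ) • ∑ l, ρ (C (e l)) - ∑ x, (p x : ℂ) • ρ x) ≤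
      2 * (s + u / s + u) + t + a * c / (2 * t) := by
  have hc0 := c_pos hc
  obtain ⟨R, hR⟩ : ∃ R : X → Matrix ι ι ℂ, R = fun x => (Q x * P x) * ρ x * (Q x * P x)ᴴ := ⟨_, rfl⟩
  have hRp : ∀ x, (R x).PosSemidef := fun x => by rw [hR]; exact psd_conj (hρ x).1 _
  obtain ⟨U, hU, d0, hd0, hω0⟩ := exists_ud_psd hω.1
  have hcard : (0:ℝ) < Fintype.card ι := by exact_mod_cast Fintype.card_pos
  obtain ⟨d, hd⟩ : ∃ d : ι → ℝ, d = fun i => a * (d0 i + (Fintype.card ι : ℝ)⁻¹) := ⟨_, rfl⟩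
  have hdpos : ∀ i, 0 < d i := fun i => by
    rw [hd]; have := hd0 i; have := inv_pos.2 hcard; simp only; positivity
  have hΩ : rtr (ud U d) = 2 * a := by
    rw [rtr_ud hU, hd]
    have h3 : ∑ i, d0 i = 1 := by rw [← rtr_ud hU, ← hω0, rtr_density hω]
    rw [← Finset.mul_sum, Finset.sum_add_distrib, h3, Finset.sum_const, nsmul_eq_mul, Finset.card_univ, mul_inv_cancel₀ hcard.ne']
    ring
  have hRle : ∀ x, R x ≤ ud U d := fun x => by
    rw [hR]
    refine (hle x).trans ?_
    rw [hω0, ud_smul]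
    apply ud_le
    intro i; rw [hd]
    have := inv_pos.2 hcard
    simp only
    gcongr; linarith
  have hRtr : ∀ x, rtr (R x) ≤ 1 := fun x => by
    have hPQ : (Q x * P x)ᴴ * (Q x * P x) ≤ 1 := by
      have hpr : ∀ A : Matrix ι ι ℂ, A.IsHermitian → A * A = A → A ≤ 1 := fun A hA hA2 => by
        apply le_of_psd_sub
        have := psd_conj (A := (1 : Matrix ι ι ℂ)) PosSemidef.one (1 - A)
        rwa [mul_one, conjTranspose_sub, conjTranspose_one, hA.eq, sub_mul, mul_sub, mul_sub, hA2, one_mul, mul_one, one_mul, sub_self, sub_zero] at this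
      have e1 : (Q x * P x)ᴴ * (Q x * P x) = P x * Q x * (P x)ᴴ := by
        rw [conjTranspose_mul, (hP x).eq, (hQ x).eq]
        calc P x * Q x * (Q x * P x) = P x * (Q x * Q x) * P x := by noncomm_ring
          _ = _ := by rw [hQ2]
      rw [e1]
      refine (conj_le (hpr _ (hQ x) (hQ2 x)) (P x)).trans ?_
      rw [mul_one, (hP x).eq, hP2]
      exact hpr _ (hP x) (hP2 x)
    have := rtr_mul_mono (hρ x).1 hPQ
    rw [mul_one, rtr_density (hρ x)] at this
    rw [hR]
    simp only
    rw [mul_assoc, rtr_comm, mul_assoc]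
    exact this
  obtain ⟨J, hJ⟩ : ∃ J, J = ud U (fun i => (d i)⁻¹) := ⟨_, rfl⟩
  have hJp : J.PosSemidef := by rw [hJ]; exact ud_psd U fun i => (inv_pos.2 (hdpos i)).le
  have hb : ∀ x, rtr (R x * J * R x) ≤ 1 := fun x => by
    rw [hJ]; exact (second_moment_le (hRp x) hU hdpos (hRle x)).trans (hRtr x)
  have hsec := cover_second hp h1 hJp (fun x => (hRp x).1) hb he hc
  obtain ⟨g, hg⟩ : ∃ g : X → ℝ, g = fun x => s + (rtr (ρ x * (1 - P x)) + rtr (ρ x * (1 - Q x))) / s + (rtr (ρ x * (1 - P x)) + rtr (ρ x * (1 - Q x))) := ⟨_, rfl⟩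
  have hge : ∀ S : Matrix ι ι ℂ, S.IsHermitian → S * S = 1 → ∀ x, rtr (S * (ρ x - R x)) ≤ g x := by
    intro S hS hS2 x
    rw [hR, hg]
    exact gentle hS hS2 (hρ x) (hP x) (hP2 x) (hQ x) (hQ2 x) hs
  have hgE : ∑ x, p x * g x ≤ s + u / s + u := by
    rw [hg]
    have : ∑ x, p x * (s + (rtr (ρ x * (1 - P x)) + rtr (ρ x * (1 - Q x))) / s + (rtr (ρ x * (1 - P x)) + rtr (ρ x * (1 - Q x))))
       = (∑ x, p x) * s + (∑ x, p x * (rtr (ρ x * (1 - P x)) + rtr (ρ x * (1 - Q x)))) / s + ∑ x, p x * (rtr (ρ x * (1 - P x)) + rtr (ρ x * (1 - Q x))) := by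
      rw [Finset.sum_mul, Finset.sum_div, ← Finset.sum_add_distrib, ← Finset.sum_add_distrib]
      exact Finset.sum_congr rfl fun _ _ => by ring
    rw [this, h1, one_mul]
    gcongr
  obtain ⟨A, hA⟩ : ∃ A : (κ → X) → Matrix ι ι ℂ, A = fun C => (c:ℂ) • ∑ l, (R (C (e l)) - ∑ x, (p x : ℂ) • R x) := ⟨_, rfl⟩
  have hmh : ∀ (T : X → Matrix ι ι ℂ), (∀ x, (T x).IsHermitian) → (∑ x, (p x : ℂ) • T x).IsHermitian := by
    intro T hT
    rw [Matrix.IsHermitian, conjTranspose_sum]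
    refine Finset.sum_congr rfl fun x _ => ?_
    rw [conjTranspose_smul, (hT x).eq]; simp
  have hch : ∀ (T : η → Matrix ι ι ℂ), (∀ x, (T x).IsHermitian) → ((c:ℂ) • ∑ x, T x).IsHermitian := by
    intro T hT
    rw [Matrix.IsHermitian, conjTranspose_smul, conjTranspose_sum]
    simp only [(hT _).eq, Complex.star_def, Complex.conj_ofReal]
  have hcc : ∀ m : Matrix ι ι ℂ, (c:ℂ) • ∑ l : η, m = m := by
    intro m
    rw [Finset.sum_const, Finset.card_univ, ← Nat.cast_smul_eq_nsmul ℂ, smul_smul]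
    have : (c:ℂ) * (Fintype.card η : ℂ) = 1 := by exact_mod_cast hc
    rw [this, one_smul]
  have hpt : ∀ C : κ → X, traceNorm ((c:ℂ) • ∑ l, ρ (C (e l)) - ∑ x, (p x : ℂ) • ρ x) ≤
      c * ∑ l, g (C (e l)) + ∑ x, p x * g x + t + a / (2 * t) * rtr (A C * J * A C) := by
    intro C
    obtain ⟨S, hS, hS2, hSt⟩ := exists_sign ((hch (fun l => ρ (C (e l))) fun l => (hρ _).1.1).sub (hmh ρ fun x => (hρ x).1.1))
    have hAh : (A C).IsHermitian := by
      rw [hA]; exact hch _ fun l => (hRp _).1.sub (hmh R fun x => (hRp x).1)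
    have hAeq : A C = (c:ℂ) • ∑ l, R (C (e l)) - ∑ x, (p x : ℂ) • R x := by
      rw [hA]; simp only [Finset.sum_sub_distrib, smul_sub, hcc]
    have hD : (c:ℂ) • ∑ l, ρ (C (e l)) - ∑ x, (p x : ℂ) • ρ x =
        ((c:ℂ) • ∑ l, (ρ (C (e l)) - R (C (e l))) - ∑ x, (p x : ℂ) • (ρ x - R x)) + A C := by
      rw [hAeq]; simp only [Finset.sum_sub_distrib, smul_sub]; abel
    rw [hSt, hD, mul_add, rtr_add, mul_sub, rtr_sub]
    have b1 : rtr (S * ((c:ℂ) • ∑ l, (ρ (C (e l)) - R (C (e l))))) ≤ c * ∑ l, g (C (e l)) := by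
      rw [mul_smul_comm, rtr_smul, Finset.mul_sum, rtr_sum]
      gcongr with l
      exact hge S hS hS2 _
    have b2 : - rtr (S * ∑ x, (p x : ℂ) • (ρ x - R x)) ≤ ∑ x, p x * g x := by
      rw [← rtr_neg, ← neg_mul, Finset.mul_sum, rtr_sum]
      refine Finset.sum_le_sum fun x _ => ?_
      rw [mul_smul_comm, rtr_smul]
      exact mul_le_mul_of_nonneg_left (hge (-S) hS.neg (by rw [neg_mul_neg, hS2]) x) (hp x)
    have b3 := second_moment_norm hS hS2 hAh hU hdpos (t := t / a) (by positivity)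
    rw [hΩ, ← hJ] at b3
    have b4 : t / a * (2 * a) = 2 * t := by field_simp
    have b5 : rtr (A C * J * A C) / (t / a) = 2 * (a / (2 * t) * rtr (A C * J * A C)) := by field_simp
    rw [b4, b5] at b3
    linarith
  calc ∑ C : κ → X, cb p C * traceNorm ((c:ℂ) • ∑ l, ρ (C (e l)) - ∑ x, (p x : ℂ) • ρ x)
      ≤ ∑ C : κ → X, cb p C * (c * ∑ l, g (C (e l)) + ∑ x, p x * g x + t + a / (2 * t) * rtr (A C * J * A C)) :=
        Finset.sum_le_sum fun C _ => mul_le_mul_of_nonneg_left (hpt C) (cb_nonneg hp C)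
    _ = c * ∑ l, (∑ C : κ → X, cb p C * g (C (e l))) + (∑ C : κ → X, cb p C) * (∑ x, p x * g x + t) +
        a / (2 * t) * ∑ C : κ → X, cb p C * rtr (A C * J * A C) := by
        rw [Finset.sum_comm (s := (Finset.univ : Finset η)), Finset.mul_sum, Finset.sum_mul, Finset.mul_sum, ← Finset.sum_add_distrib, ← Finset.sum_add_distrib]
        refine Finset.sum_congr rfl fun C _ => ?_
        rw [← Finset.mul_sum]; ring
    _ ≤ c * ∑ l : η, (s + u / s + u) + 1 * (s + u / s + u + t) + a / (2 * t) * c := by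
        rw [cb_sum h1]
        have : ∀ l, ∑ C : κ → X, cb p C * g (C (e l)) = ∑ x, p x * g x := fun l => cb_marg h1 (e l) g
        simp only [this]
        rw [hA]
        gcongr
    _ = _ := by
        rw [Finset.sum_const, nsmul_eq_mul, Finset.card_univ, ← mul_assoc, hc]; ring

end Cover
end CovertPaper

end

end

section
open Matrix Filter
open scoped Kronecker Classical ComplexOrder MatrixOrder

noncomputable section
set_option linter.unusedSectionVars false
set_option linter.unusedVariables false

namespace CovertPaper

section Tails
variable {β : Type*} [Fintype β] [DecidableEq β]

/-- Bernoulli input distribution. -/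
def pw (α : ℝ) : Fin 2 → ℝ := ![1 - α, α]

lemma pw_nonneg {α : ℝ} (h0 : 0 ≤ α) (h1 : α ≤ 1) (y : Fin 2) : 0 ≤ pw α y := by
  fin_cases y <;> simp [pw] <;> linarith

lemma pw_sum (α : ℝ) : ∑ y, pw α y = 1 := by
  simp [pw, Fin.sum_univ_two]

/-- sum of a letter function over the support of the input string -/
def suppSum {n : ℕ} (l : β → ℝ) (x : Fin n → Fin 2) (b : Fin n → β) : ℝ :=
  ∑ i, (![fun _ => 0, l] (x i)) (b i)

/-- product of a letter function over the support of the input string -/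
def suppProd {n : ℕ} (v : β → ℝ) (x : Fin n → Fin 2) (b : Fin n → β) : ℝ :=
  ∏ i, (![fun _ => 1, v] (x i)) (b i)

lemma mgf {n : ℕ} {α : ℝ} (h0 : 0 ≤ α) (h1 : α ≤ 1) {r : Fin 2 → β → ℝ} (hr1 : ∀ y, ∑ b, r y b = 1)
    {l : β → ℝ} {φ : ℝ} (hφ : ∑ b, r 1 b * Real.exp (l b) = φ) (hφ0 : 0 ≤ φ) :
    ∑ x : Fin n → Fin 2, cb (pw α) x * ∑ b : Fin n → β, (∏ i, r (x i) (b i)) * Real.exp (suppSum l x b)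
      ≤ Real.exp (n * α * (φ - 1)) := by
  have e : ∀ x : Fin n → Fin 2, cb (pw α) x * ∑ b : Fin n → β, (∏ i, r (x i) (b i)) * Real.exp (suppSum l x b) =
      ∏ i, (pw α (x i) * ∑ b, r (x i) b * Real.exp ((![fun _ => 0, l] (x i)) b)) := by
    intro x
    rw [Finset.prod_mul_distrib, prod_sum_fun, cb]
    congr 1
    refine Finset.sum_congr rfl fun b _ => ?_
    rw [Finset.prod_mul_distrib, suppSum, Real.exp_sum]
  simp only [e]
  rw [sum_prod_all (fun _ y => pw α y * ∑ b, r y b * Real.exp ((![fun _ => 0, l] y) b))]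
  rw [Finset.prod_const, Finset.card_univ, Fintype.card_fin, Fin.sum_univ_two]
  simp only [pw, Matrix.cons_val_zero, Matrix.cons_val_one, Real.exp_zero, mul_one, hr1, hφ]
  have : 1 - α + α * φ ≤ Real.exp (α * (φ - 1)) := by
    have := Real.add_one_le_exp (α * (φ - 1)); linarith
  calc (1 - α + α * φ) ^ n ≤ (Real.exp (α * (φ - 1))) ^ n := by
        apply pow_le_pow_left₀ _ this
        have := mul_nonneg h0 hφ0; linarith
    _ = _ := by rw [← Real.exp_nat_mul]; ring_nf

lemma exists_tilt {r : β → ℝ} (hr : ∀ b, 0 ≤ r b) (hr1 : ∑ b, r b = 1) (l : β → ℝ) {η : ℝ} (hη : 0 < η) :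
    ∃ s > 0, ∃ c > 0, ∑ b, r b * Real.exp (s * l b) - 1 - s * (∑ b, r b * l b + η) ≤ - c := by
  obtain ⟨m, hm⟩ : ∃ m : ℝ, m = ∑ b, |l b| + 1 := ⟨_, rfl⟩
  have hm0 : 0 < m := by rw [hm]; have := Finset.sum_nonneg (s := Finset.univ) fun b (_ : b ∈ Finset.univ) => abs_nonneg (l b); linarith
  have hlm : ∀ b, |l b| ≤ m := fun b => by
    rw [hm]; have := Finset.single_le_sum (fun b (_ : b ∈ Finset.univ) => abs_nonneg (l b)) (Finset.mem_univ b); linarith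
  obtain ⟨s, hs⟩ : ∃ s, s = min m⁻¹ (η / (2 * m ^ 2)) := ⟨_, rfl⟩
  have hs0 : 0 < s := by rw [hs]; exact lt_min (inv_pos.2 hm0) (by positivity)
  have hs1 : s * m ≤ 1 := by
    have : s ≤ m⁻¹ := by rw [hs]; exact min_le_left _ _
    calc s * m ≤ m⁻¹ * m := by gcongr
      _ = 1 := inv_mul_cancel₀ hm0.ne'
  have hs2 : s * m ^ 2 ≤ η / 2 := by
    have : s ≤ η / (2 * m ^ 2) := by rw [hs]; exact min_le_right _ _
    calc s * m ^ 2 ≤ η / (2 * m ^ 2) * m ^ 2 := by gcongr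
      _ = η / 2 := by field_simp
  refine ⟨s, hs0, s * η / 2, by positivity, ?_⟩
  have hb : ∀ b, r b * Real.exp (s * l b) ≤ r b * (1 + s * l b + s * (η / 2)) := by
    intro b
    apply mul_le_mul_of_nonneg_left _ (hr b)
    have ha : |s * l b| ≤ 1 := by
      rw [abs_mul, abs_of_pos hs0]; refine le_trans ?_ hs1; gcongr; exact hlm b
    have h1 := (abs_le.1 (Real.abs_exp_sub_one_sub_id_le ha)).2
    have h2 : (s * l b) ^ 2 ≤ s * (η / 2) := by
      calc (s * l b) ^ 2 = s * (s * |l b| ^ 2) := by rw [sq_abs]; ring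
        _ ≤ s * (s * m ^ 2) := by gcongr; exact hlm b
        _ ≤ _ := by gcongr
    linarith
  have h3 := Finset.sum_le_sum fun b (_ : b ∈ Finset.univ) => hb b
  have h4 : ∑ b, r b * (1 + s * l b + s * (η / 2)) = ∑ b, r b + s * ∑ b, r b * l b + (∑ b, r b) * (s * (η / 2)) := by
    rw [Finset.mul_sum, Finset.sum_mul, ← Finset.sum_add_distrib, ← Finset.sum_add_distrib]
    exact Finset.sum_congr rfl fun _ _ => by ring
  rw [h4, hr1] at h3
  linarith

/-- Chernoff bound, uniform in the block length. -/
lemma chernoff {r1 : β → ℝ} (hr : ∀ b, 0 ≤ r1 b) (hr1 : ∑ b, r1 b = 1) (l : β → ℝ) {η : ℝ} (hη : 0 < η) :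
    ∃ c > 0, ∀ (n : ℕ) (α : ℝ), 0 ≤ α → α ≤ 1 → ∀ r : Fin 2 → β → ℝ, (∀ y b, 0 ≤ r y b) → (∀ y, ∑ b, r y b = 1) → r 1 = r1 →
      ∀ f : (Fin n → Fin 2) → (Fin n → β) → ℝ, (∀ x b, f x b ≤ 1) →
      (∀ x b, (∏ i, r (x i) (b i)) ≠ 0 → 0 < f x b → n * α * (∑ b, r1 b * l b + η) < suppSum l x b) →
      ∑ x : Fin n → Fin 2, cb (pw α) x * ∑ b : Fin n → β, (∏ i, r (x i) (b i)) * f x b ≤ Real.exp (-c * (n * α)) := by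
  obtain ⟨s, hs, c, hc, hsc⟩ := exists_tilt hr hr1 l hη
  refine ⟨c, hc, fun n α h0 h1 r hr0 hrs hr1' f hf1 hf => ?_⟩
  obtain ⟨θ, hθ⟩ : ∃ θ : ℝ, θ = n * α := ⟨_, rfl⟩
  have hθ0 : 0 ≤ θ := by rw [hθ]; positivity
  obtain ⟨A, hA⟩ : ∃ A : ℝ, A = θ * (∑ b, r1 b * l b + η) := ⟨_, rfl⟩
  rw [← hθ] at hf ⊢
  rw [← hA] at hf
  have hsum : ∀ (x : Fin n → Fin 2) (b : Fin n → β), suppSum (fun b => s * l b) x b = s * suppSum l x b := by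
    intro x b
    unfold suppSum
    rw [Finset.mul_sum]
    refine Finset.sum_congr rfl fun i _ => ?_
    generalize x i = y
    fin_cases y <;> simp
  have hpt : ∀ x b, (∏ i, r (x i) (b i)) * f x b ≤ Real.exp (-(s * A)) * ((∏ i, r (x i) (b i)) * Real.exp (suppSum (fun b => s * l b) x b)) := by
    intro x b
    have hp : 0 ≤ ∏ i, r (x i) (b i) := Finset.prod_nonneg fun i _ => hr0 _ _
    by_cases hz : ∏ i, r (x i) (b i) = 0
    · rw [hz]; simp
    by_cases hfz : 0 < f x b
    · have h2 := hf x b hz hfz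
      have h3 : 1 ≤ Real.exp (-(s * A)) * Real.exp (suppSum (fun b => s * l b) x b) := by
        rw [← Real.exp_add, hsum]
        apply Real.one_le_exp
        have := mul_lt_mul_of_pos_left h2 hs
        linarith
      calc (∏ i, r (x i) (b i)) * f x b ≤ (∏ i, r (x i) (b i)) * (Real.exp (-(s * A)) * Real.exp (suppSum (fun b => s * l b) x b)) :=
            mul_le_mul_of_nonneg_left ((hf1 x b).trans h3) hp
        _ = _ := by ring
    · push Not at hfz
      calc (∏ i, r (x i) (b i)) * f x b ≤ 0 := mul_nonpos_of_nonneg_of_nonpos hp hfz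
        _ ≤ _ := by positivity
  have hφ0 : 0 ≤ ∑ b, r 1 b * Real.exp (s * l b) := Finset.sum_nonneg fun b _ => mul_nonneg (hr0 _ _) (Real.exp_pos _).le
  have hm := mgf (n := n) h0 h1 hrs (l := fun b => s * l b) rfl hφ0
  calc ∑ x : Fin n → Fin 2, cb (pw α) x * ∑ b : Fin n → β, (∏ i, r (x i) (b i)) * f x b
      ≤ ∑ x : Fin n → Fin 2, cb (pw α) x * ∑ b : Fin n → β, Real.exp (-(s * A)) * ((∏ i, r (x i) (b i)) * Real.exp (suppSum (fun b => s * l b) x b)) :=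
        Finset.sum_le_sum fun x _ => mul_le_mul_of_nonneg_left (Finset.sum_le_sum fun b _ => hpt x b) (cb_nonneg (pw_nonneg h0 h1) x)
    _ = Real.exp (-(s * A)) * ∑ x : Fin n → Fin 2, cb (pw α) x * ∑ b : Fin n → β, ((∏ i, r (x i) (b i)) * Real.exp (suppSum (fun b => s * l b) x b)) := by
        rw [Finset.mul_sum]
        refine Finset.sum_congr rfl fun x _ => ?_
        rw [← Finset.mul_sum]; ring
    _ ≤ Real.exp (-(s * A)) * Real.exp (n * α * (∑ b, r 1 b * Real.exp (s * l b) - 1)) := by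
        gcongr
    _ ≤ Real.exp (-c * θ) := by
        rw [← Real.exp_add, ← hθ, hA, hr1']
        apply Real.exp_le_exp.2
        have := mul_le_mul_of_nonneg_left hsc hθ0
        linarith

lemma suppProd_log {n : ℕ} {v : β → ℝ} (hv : ∀ b, 0 ≤ v b) {r : Fin 2 → β → ℝ} (hz : ∀ b, v b = 0 → r 1 b = 0)
    {x : Fin n → Fin 2} {b : Fin n → β} (h : ∏ i, r (x i) (b i) ≠ 0) :
    0 < suppProd v x b ∧ Real.log (suppProd v x b) = suppSum (fun b => Real.log (v b)) x b := by
  have hpos : ∀ i, 0 < (![fun _ => 1, v] (x i)) (b i) := by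
    intro i
    have hri := Finset.prod_ne_zero_iff.1 h i (Finset.mem_univ i)
    revert hri
    generalize x i = y
    fin_cases y
    · simp
    · intro hri
      exact lt_of_le_of_ne (hv _) (Ne.symm fun h0 => hri (hz _ h0))
  refine ⟨Finset.prod_pos fun i _ => hpos i, ?_⟩
  unfold suppProd suppSum
  rw [Real.log_prod fun i _ => (hpos i).ne']
  refine Finset.sum_congr rfl fun i _ => ?_
  generalize x i = y
  fin_cases y <;> simp

/-- upper-threshold projection -/
def hiT {n : ℕ} (V : Fin 2 → Matrix β β ℂ) (v : β → ℝ) (A : ℝ) (x : Fin n → Fin 2) : Matrix (Fin n → β) (Fin n → β) ℂ :=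
  ud (tens fun i => V (x i)) (fun b => if suppProd v x b ≤ Real.exp A then 1 else 0)

/-- lower-threshold projection -/
def loT {n : ℕ} (V : Fin 2 → Matrix β β ℂ) (v : β → ℝ) (A : ℝ) (x : Fin n → Fin 2) : Matrix (Fin n → β) (Fin n → β) ℂ :=
  ud (tens fun i => V (x i)) (fun b => if Real.exp A ≤ suppProd v x b then 1 else 0)

lemma tail_hi {V1 ρ1 : Matrix β β ℂ} (hV1 : V1 ∈ unitaryGroup β ℂ) (hρ1 : IsDensity ρ1) {v : β → ℝ} (hv : ∀ b, 0 ≤ v b)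
    (hs : SuppLE ρ1 (ud V1 v)) {η : ℝ} (hη : 0 < η) :
    ∃ c > 0, ∀ (n : ℕ) (α : ℝ), 0 ≤ α → α ≤ 1 → ∀ V ρ : Fin 2 → Matrix β β ℂ, (∀ y, V y ∈ unitaryGroup β ℂ) →
      (∀ y, IsDensity (ρ y)) → V 1 = V1 → ρ 1 = ρ1 →
      ∑ x : Fin n → Fin 2, cb (pw α) x * rtr (tens (fun i => ρ (x i)) *
        (1 - hiT V v (n * α * (rtr (ρ1 * matLog (ud V1 v)) + η)) x)) ≤ Real.exp (-c * (n * α)) := by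
  obtain ⟨c, hc, hch⟩ := chernoff (r1 := mdist V1 ρ1) (fun b => mdist_nonneg hρ1.1 b) (by rw [mdist_sum hV1, rtr_density hρ1])
    (fun b => Real.log (v b)) hη
  refine ⟨c, hc, fun n α h0 h1 V ρ hV hρ hV1' hρ1' => ?_⟩
  rw [matLog_ud hV1, rtr_mul_ud]
  obtain ⟨A, hA⟩ : ∃ A : ℝ, A = n * α * (∑ b, mdist V1 ρ1 b * Real.log (v b) + η) := ⟨_, rfl⟩
  have h := hch n α h0 h1 (fun y b => mdist (V y) (ρ y) b) (fun y b => mdist_nonneg (hρ y).1 b)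
    (fun y => by rw [mdist_sum (hV y), rtr_density (hρ y)]) (by rw [hV1', hρ1'])
    (fun x b => 1 - if suppProd v x b ≤ Real.exp A then 1 else 0) (fun x b => by split_ifs <;> norm_num) ?_
  · refine le_trans (le_of_eq ?_) h
    refine Finset.sum_congr rfl fun x _ => ?_
    rw [← hA, hiT, ← ud_one (tens_unitary fun i => hV (x i)), ud_sub, rtr_mul_ud]
    simp only [mdist_tens fun i => (hρ (x i)).1]
  · intro x b hr hf
    rw [← hA]
    obtain ⟨hp, hl⟩ := suppProd_log (r := fun y b => mdist (V y) (ρ y) b) hv (fun b hb => by rw [hV1', hρ1']; exact mdist_zero hV1 hs hb) hr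
    rw [← hl, Real.lt_log_iff_exp_lt hp]
    by_contra hcon
    push Not at hcon
    rw [if_pos hcon] at hf
    norm_num at hf

lemma tail_lo {V1 ρ1 : Matrix β β ℂ} (hV1 : V1 ∈ unitaryGroup β ℂ) (hρ1 : IsDensity ρ1) {v : β → ℝ} (hv : ∀ b, 0 ≤ v b)
    (hs : SuppLE ρ1 (ud V1 v)) {η : ℝ} (hη : 0 < η) :
    ∃ c > 0, ∀ (n : ℕ) (α : ℝ), 0 ≤ α → α ≤ 1 → ∀ V ρ : Fin 2 → Matrix β β ℂ, (∀ y, V y ∈ unitaryGroup β ℂ) →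
      (∀ y, IsDensity (ρ y)) → V 1 = V1 → ρ 1 = ρ1 →
      ∑ x : Fin n → Fin 2, cb (pw α) x * rtr (tens (fun i => ρ (x i)) *
        (1 - loT V v (n * α * (rtr (ρ1 * matLog (ud V1 v)) - η)) x)) ≤ Real.exp (-c * (n * α)) := by
  obtain ⟨c, hc, hch⟩ := chernoff (r1 := mdist V1 ρ1) (fun b => mdist_nonneg hρ1.1 b) (by rw [mdist_sum hV1, rtr_density hρ1])
    (fun b => - Real.log (v b)) hη
  refine ⟨c, hc, fun n α h0 h1 V ρ hV hρ hV1' hρ1' => ?_⟩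
  rw [matLog_ud hV1, rtr_mul_ud]
  obtain ⟨A, hA⟩ : ∃ A : ℝ, A = n * α * (∑ b, mdist V1 ρ1 b * Real.log (v b) - η) := ⟨_, rfl⟩
  have h := hch n α h0 h1 (fun y b => mdist (V y) (ρ y) b) (fun y b => mdist_nonneg (hρ y).1 b)
    (fun y => by rw [mdist_sum (hV y), rtr_density (hρ y)]) (by rw [hV1', hρ1'])
    (fun x b => 1 - if Real.exp A ≤ suppProd v x b then 1 else 0) (fun x b => by split_ifs <;> norm_num) ?_
  · refine le_trans (le_of_eq ?_) h
    refine Finset.sum_congr rfl fun x _ => ?_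
    rw [← hA, loT, ← ud_one (tens_unitary fun i => hV (x i)), ud_sub, rtr_mul_ud]
    simp only [mdist_tens fun i => (hρ (x i)).1]
  · intro x b hr hf
    obtain ⟨hp, hl⟩ := suppProd_log (r := fun y b => mdist (V y) (ρ y) b) hv (fun b hb => by rw [hV1', hρ1']; exact mdist_zero hV1 hs hb) hr
    have e1 : suppSum (fun b => - Real.log (v b)) x b = - suppSum (fun b => Real.log (v b)) x b := by
      unfold suppSum
      rw [← Finset.sum_neg_distrib]
      refine Finset.sum_congr rfl fun i _ => ?_
      generalize x i = y
      fin_cases y <;> simp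
    have e2 : ∑ b, mdist V1 ρ1 b * -Real.log (v b) = - ∑ b, mdist V1 ρ1 b * Real.log (v b) := by
      rw [← Finset.sum_neg_distrib]; exact Finset.sum_congr rfl fun _ _ => by ring
    have e3 : n * α * (∑ b, mdist V1 ρ1 b * -Real.log (v b) + η) = - A := by rw [e2, hA]; ring
    rw [e3, e1, neg_lt_neg_iff, ← hl, Real.log_lt_iff_lt_exp hp]
    by_contra hcon
    push Not at hcon
    rw [if_pos hcon] at hf
    norm_num at hf

lemma ind_proj {ι : Type*} [Fintype ι] [DecidableEq ι] {U : Matrix ι ι ℂ} (hU : U ∈ unitaryGroup ι ℂ) (E : ι → Prop) [DecidablePred E] :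
    (ud U fun i => if E i then 1 else 0) * (ud U fun i => if E i then 1 else 0) = ud U fun i => if E i then 1 else 0 := by
  rw [ud_mul hU]; congr 1; ext i; split_ifs <;> norm_num

end Tails
end CovertPaper

end

end

section
open Matrix Filter
open scoped Kronecker Classical ComplexOrder MatrixOrder

noncomputable section
set_option linter.unusedSectionVars false
set_option linter.unusedVariables false

namespace CovertPaper

section Tests
variable {β : Type*} [Fintype β] [DecidableEq β] {n : ℕ}

lemma tens_ud2 (V : Fin 2 → Matrix β β ℂ) (d : Fin 2 → β → ℝ) (x : Fin n → Fin 2) :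
    tens (fun i => ud (V (x i)) (d (x i))) = ud (tens fun i => V (x i)) (fun b => ∏ i, d (x i) (b i)) :=
  tens_ud (fun i => V (x i)) (fun i => d (x i))

lemma split_prod (w v : β → ℝ) (x : Fin n → Fin 2) (b : Fin n → β) :
    ∏ i, (![w, v] (x i)) (b i) = suppProd v x b * ∏ i, (![w, fun _ => 1] (x i)) (b i) := by
  unfold suppProd
  rw [← Finset.prod_mul_distrib]
  refine Finset.prod_congr rfl fun i _ => ?_
  generalize x i = y
  fin_cases y <;> simp

lemma fam_nonneg {w v : β → ℝ} (hw : ∀ b, 0 ≤ w b) (hv : ∀ b, 0 ≤ v b) (x : Fin n → Fin 2) (b : Fin n → β) :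
    0 ≤ ∏ i, (![w, v] (x i)) (b i) := by
  refine Finset.prod_nonneg fun i _ => ?_
  generalize x i = y
  fin_cases y
  · exact hw _
  · exact hv _

lemma suppProd_nonneg {v : β → ℝ} (hv : ∀ b, 0 ≤ v b) (x : Fin n → Fin 2) (b : Fin n → β) : 0 ≤ suppProd v x b :=
  fam_nonneg (w := fun _ => 1) (fun _ => zero_le_one) hv x b

/-- Compressing a commuting operator by an upper-threshold projection. -/
lemma hi_compress {V : Fin 2 → Matrix β β ℂ} (hV : ∀ y, V y ∈ unitaryGroup β ℂ) {w v : β → ℝ} (hw : ∀ b, 0 ≤ w b)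
    (hv : ∀ b, 0 ≤ v b) (A : ℝ) (x : Fin n → Fin 2) :
    hiT V v A x * tens (fun i => ud (V (x i)) (![w, v] (x i))) * (hiT V v A x)ᴴ ≤
      ((Real.exp A : ℝ) : ℂ) • tens (fun i => ud (V (x i)) (![w, fun _ => 1] (x i))) := by
  have hU := tens_unitary fun i => hV (x i)
  rw [tens_ud2 V, tens_ud2 V, hiT, (ud_isHermitian _ _).eq, ud_mul hU, ud_mul hU, ud_smul]
  apply ud_le
  intro b
  rw [split_prod]
  have h1 := fam_nonneg (v := fun _ => 1) hw (fun _ => zero_le_one) x b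
  have h2 := suppProd_nonneg hv x b
  split_ifs with h
  · rw [one_mul, mul_one]; gcongr
  · simp only [zero_mul]; positivity

/-- Compressing a commuting operator by a lower-threshold projection. -/
lemma lo_compress {V : Fin 2 → Matrix β β ℂ} (hV : ∀ y, V y ∈ unitaryGroup β ℂ) {w v : β → ℝ} (hw : ∀ b, 0 ≤ w b)
    (hv : ∀ b, 0 ≤ v b) (A : ℝ) (x : Fin n → Fin 2) :
    loT V v A x * tens (fun i => ud (V (x i)) (![w, fun _ => 1] (x i))) * (loT V v A x)ᴴ ≤
      ((Real.exp (-A) : ℝ) : ℂ) • tens (fun i => ud (V (x i)) (![w, v] (x i))) := by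
  have hU := tens_unitary fun i => hV (x i)
  rw [tens_ud2 V, tens_ud2 V, loT, (ud_isHermitian _ _).eq, ud_mul hU, ud_mul hU, ud_smul]
  apply ud_le
  intro b
  rw [split_prod w v]
  have h1 := fam_nonneg (v := fun _ => 1) hw (fun _ => zero_le_one) x b
  have h2 := suppProd_nonneg hv x b
  split_ifs with h
  · rw [one_mul, mul_one, ← mul_assoc]
    apply le_mul_of_one_le_left h1
    rw [Real.exp_neg, inv_mul_eq_div, one_le_div (Real.exp_pos _)]
    exact h
  · simp only [zero_mul]; positivity

lemma hiT_herm (V : Fin 2 → Matrix β β ℂ) (v : β → ℝ) (A : ℝ) (x : Fin n → Fin 2) : (hiT V v A x).IsHermitian :=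
  ud_isHermitian _ _
lemma loT_herm (V : Fin 2 → Matrix β β ℂ) (v : β → ℝ) (A : ℝ) (x : Fin n → Fin 2) : (loT V v A x).IsHermitian :=
  ud_isHermitian _ _
lemma hiT_idem {V : Fin 2 → Matrix β β ℂ} (hV : ∀ y, V y ∈ unitaryGroup β ℂ) (v : β → ℝ) (A : ℝ) (x : Fin n → Fin 2) :
    hiT V v A x * hiT V v A x = hiT V v A x := ind_proj (tens_unitary fun i => hV (x i)) _
lemma loT_idem {V : Fin 2 → Matrix β β ℂ} (hV : ∀ y, V y ∈ unitaryGroup β ℂ) (v : β → ℝ) (A : ℝ) (x : Fin n → Fin 2) :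
    loT V v A x * loT V v A x = loT V v A x := ind_proj (tens_unitary fun i => hV (x i)) _

/-- Willie: the smoothed output is dominated by the innocent output. -/
lemma willie_compress {ω : Fin 2 → Matrix β β ℂ} {U0 U1 : Matrix β β ℂ} (hU0 : U0 ∈ unitaryGroup β ℂ) (hU1 : U1 ∈ unitaryGroup β ℂ)
    {q p : β → ℝ} (hq : ∀ b, 0 ≤ q b) (hp : ∀ b, 0 ≤ p b) (h0 : ω 0 = ud U0 q) (h1 : ω 1 = ud U1 p) (A A' : ℝ) (x : Fin n → Fin 2) :
    (loT ![U0, U0] q A' x * hiT ![U0, U1] p A x) * tens (fun i => ω (x i)) * (loT ![U0, U0] q A' x * hiT ![U0, U1] p A x)ᴴ ≤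
      ((Real.exp (A - A') : ℝ) : ℂ) • tens (fun _ => ω 0) := by
  have hV : ∀ y, (![U0, U1] : Fin 2 → Matrix β β ℂ) y ∈ unitaryGroup β ℂ := by
    intro y; fin_cases y
    · exact hU0
    · exact hU1
  have hV' : ∀ y, (![U0, U0] : Fin 2 → Matrix β β ℂ) y ∈ unitaryGroup β ℂ := by
    intro y; fin_cases y
    · exact hU0
    · exact hU0
  have e1 : (fun i => ω (x i)) = fun i => ud ((![U0, U1] : Fin 2 → Matrix β β ℂ) (x i)) (![q, p] (x i)) := by
    funext i; generalize x i = y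
    fin_cases y
    · simpa using h0
    · simpa using h1
  have e2 : (fun i => ud ((![U0, U1] : Fin 2 → Matrix β β ℂ) (x i)) (![q, fun _ => 1] (x i))) =
      fun i => ud ((![U0, U0] : Fin 2 → Matrix β β ℂ) (x i)) (![q, fun _ => 1] (x i)) := by
    funext i; generalize x i = y
    fin_cases y
    · simp
    · simp [ud_one hU0, ud_one hU1]
  have e3 : (fun i => ud ((![U0, U0] : Fin 2 → Matrix β β ℂ) (x i)) (![q, q] (x i))) = fun _ => ω 0 := by
    funext i; generalize x i = y
    fin_cases y <;> simp [h0]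
  have h2 := hi_compress hV hq hp A x
  rw [← e1, e2] at h2
  have h3 := lo_compress hV' hq hq A' x
  rw [e3] at h3
  have h4 := conj_le h2 (loT ![U0, U0] q A' x)
  rw [mul_smul_comm, smul_mul_assoc] at h4
  have h5 := smul_mono_mat h3 (Real.exp_pos A).le
  rw [smul_smul, ← Complex.ofReal_mul, ← Real.exp_add, ← sub_eq_add_neg] at h5
  refine le_trans (le_of_eq ?_) (h4.trans h5)
  rw [conjTranspose_mul]; simp only [mul_assoc]

lemma seq_test {ι : Type*} [Fintype ι] [DecidableEq ι] {P Q : Matrix ι ι ℂ} 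
    (hP : P.IsHermitian) (hP2 : P * P = P) (hQ : Q.IsHermitian) (hQ2 : Q * Q = Q) :
    (Q * P * Q).PosSemidef ∧ Q * P * Q ≤ 1 ∧ 1 - Q * P * Q ≤ (3:ℂ) • (1 - Q) + (2:ℂ) • (1 - P) := by
  have hp1 : ∀ A : Matrix ι ι ℂ, A.IsHermitian → A * A = A → (1 - A).PosSemidef := fun A hA hA2 => by
    have := psd_conj (A := (1 : Matrix ι ι ℂ)) PosSemidef.one (1 - A)
    rwa [mul_one, conjTranspose_sub, conjTranspose_one, hA.eq, sub_mul, mul_sub, mul_sub, hA2, one_mul, mul_one, one_mul, sub_self, sub_zero] at this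
  have hp0 : ∀ A : Matrix ι ι ℂ, A.IsHermitian → A * A = A → (A).PosSemidef := fun A hA hA2 => by
    have := psd_conj (A := (1 : Matrix ι ι ℂ)) PosSemidef.one A
    rwa [mul_one, hA.eq, hA2] at this
  refine ⟨?_, ?_, ?_⟩
  · have := psd_conj (hp0 P hP hP2) Q; rwa [hQ.eq] at this
  · have h1 := conj_le (le_of_psd_sub (hp1 P hP hP2)) Q
    rw [mul_one, hQ.eq, hQ2] at h1
    exact h1.trans (le_of_psd_sub (hp1 Q hQ hQ2))
  · apply le_of_psd_sub
    obtain ⟨Y, hY⟩ : ∃ Y, Y = 1 - Q := ⟨_, rfl⟩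
    have hYh : Yᴴ = Y := by rw [hY, conjTranspose_sub, conjTranspose_one, hQ.eq]
    have hQY : Q = 1 - Y := by rw [hY]; abel
    have hY2 : Y * Y = Y := by
      rw [hY, sub_mul, mul_sub, mul_sub, hQ2]; simp
    have e : (3:ℂ) • (1 - Q) + (2:ℂ) • (1 - P) - (1 - Q * P * Q) =
        (1 + Y) * (1 - P) * (1 + Y)ᴴ + ((2:ℝ):ℂ) • (Y * P * Yᴴ) := by
      rw [conjTranspose_add, conjTranspose_one, hYh, hQY]
      have e1 : (1 - Y) * P * (1 - Y) = P - Y * P - P * Y + Y * P * Y := by noncomm_ring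
      have e2 : (1 + Y) * (1 - P) * (1 + Y) = 1 + Y + Y + Y * Y - P - Y * P - P * Y - Y * P * Y := by noncomm_ring
      rw [e1, e2, hY2]
      push_cast
      module
    rw [e]
    exact (psd_conj (hp1 P hP hP2) _).add (psd_ofReal_smul (by norm_num) (psd_conj (hp0 P hP hP2) _))

/-- Bob: the second kind error of the sequential test. -/
lemma bob_second {τ σ0 σ1 U0 U1 Ut : Matrix β β ℂ} (hU0 : U0 ∈ unitaryGroup β ℂ) (hU1 : U1 ∈ unitaryGroup β ℂ) (hUt : Ut ∈ unitaryGroup β ℂ)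
    {q p r : β → ℝ} (hq : ∀ b, 0 ≤ q b) (hp : ∀ b, 0 ≤ p b) (hr : ∀ b, 0 ≤ r b) (h0 : σ0 = ud U0 q) (h1 : σ1 = ud U1 p) (ht : τ = ud Ut r)
    (hσ1 : IsDensity σ1) (hτ : IsDensity τ) {D : ℝ} (hD : 0 ≤ D) (hle : τ ≤ (D:ℂ) • σ0) (A A' : ℝ) (x : Fin n → Fin 2) :
    rtr (tens (fun _ => τ) * (hiT ![Ut, U0] q A x * loT ![1, U1] p A' x * hiT ![Ut, U0] q A x)) ≤
      (∏ i, ![1, D] (x i)) * Real.exp (A - A') := by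
  have hV : ∀ y, (![Ut, U0] : Fin 2 → Matrix β β ℂ) y ∈ unitaryGroup β ℂ := by
    intro y; fin_cases y
    · exact hUt
    · exact hU0
  have hV' : ∀ y, (![1, U1] : Fin 2 → Matrix β β ℂ) y ∈ unitaryGroup β ℂ := by
    intro y; fin_cases y
    · exact one_mem _
    · exact hU1
  have g1 : tens (fun _ : Fin n => τ) ≤ (((∏ i, ![1, D] (x i) : ℝ)) : ℂ) • tens (fun i => ud ((![Ut, U0] : Fin 2 → Matrix β β ℂ) (x i)) (![r, q] (x i))) := by
    rw [← tens_smul (fun i => ![1, D] (x i))]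
    apply tens_mono fun _ => hτ.1
    intro i; generalize x i = y
    fin_cases y
    · simp [ht]
    · simpa [← h0] using hle
  have hDp : 0 ≤ ∏ i, (![1, D] : Fin 2 → ℝ) (x i) := by
    refine Finset.prod_nonneg fun i _ => ?_
    generalize x i = y
    fin_cases y
    · simp
    · simpa using hD
  obtain ⟨m, hm⟩ : ∃ m : ℝ, m = ∏ i, (![1, D] : Fin 2 → ℝ) (x i) := ⟨_, rfl⟩
  rw [← hm] at g1 hDp ⊢
  obtain ⟨Q, hQ⟩ : ∃ Q, Q = hiT ![Ut, U0] q A x := ⟨_, rfl⟩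
  obtain ⟨P, hP⟩ : ∃ P, P = loT ![1, U1] p A' x := ⟨_, rfl⟩
  have hQh : Qᴴ = Q := by rw [hQ]; exact hiT_herm _ _ _ _
  have hPh : Pᴴ = P := by rw [hP]; exact loT_herm _ _ _ _
  have hP2 : P * P = P := by rw [hP]; exact loT_idem hV' _ _ _
  have g2 := hi_compress (n := n) hV hr hq A x
  have g3 := lo_compress (n := n) hV' (w := fun _ => 1) (fun _ => zero_le_one) hp A' x
  rw [← hQ] at g2
  rw [← hP] at g3
  have e1 : (fun i => ud ((![1, U1] : Fin 2 → Matrix β β ℂ) (x i)) (![fun _ => 1, fun _ => 1] (x i))) = fun _ => (1 : Matrix β β ℂ) := by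
    funext i
    have := hV' (x i)
    revert this
    generalize x i = y
    intro this
    fin_cases y
    · exact ud_one this
    · exact ud_one this
  rw [e1, tens_one, mul_one, hPh, hP2] at g3
  rw [← hQ, ← hP]
  have g4 : Q * tens (fun _ : Fin n => τ) * Qᴴ ≤ ((m * Real.exp A : ℝ) : ℂ) • tens (fun i => ud ((![Ut, U0] : Fin 2 → Matrix β β ℂ) (x i)) (![r, fun _ => 1] (x i))) := by
    refine (conj_le g1 Q).trans ?_
    rw [mul_smul_comm, smul_mul_assoc]
    refine (smul_mono_mat g2 hDp).trans (le_of_eq ?_)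
    rw [smul_smul, ← Complex.ofReal_mul]
  have hPp : P.PosSemidef := by
    have := psd_conj (A := (1 : Matrix (Fin n → β) (Fin n → β) ℂ)) PosSemidef.one P
    rwa [mul_one, hPh, hP2] at this
  have hTp : (tens (fun i => ud ((![Ut, U0] : Fin 2 → Matrix β β ℂ) (x i)) (![r, fun _ => 1] (x i)))).PosSemidef := by
    apply tens_psd
    intro i; generalize x i = y
    fin_cases y
    · exact ud_psd _ hr
    · exact ud_psd _ fun _ => zero_le_one
  have g5 := rtr_mul_mono hPp g4
  have g6 := rtr_mul_mono hTp g3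
  have e2 : rtr (tens (fun _ : Fin n => τ) * (Q * P * Q)) = rtr (P * (Q * tens (fun _ : Fin n => τ) * Qᴴ)) := by
    rw [hQh, rtr_comm]
    calc rtr (Q * P * Q * tens (fun _ : Fin n => τ)) = rtr (Q * (P * Q * tens (fun _ : Fin n => τ))) := by simp only [mul_assoc]
      _ = _ := by rw [rtr_comm]; simp only [mul_assoc]
  have e3 : rtr (tens (fun i => ud ((![Ut, U0] : Fin 2 → Matrix β β ℂ) (x i)) (![r, fun _ => 1] (x i))) *
      tens (fun i => ud ((![1, U1] : Fin 2 → Matrix β β ℂ) (x i)) (![fun _ => 1, p] (x i)))) = 1 := by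
    rw [tens_mul, rtr, tens_trace]
    have : ∀ i, (ud ((![Ut, U0] : Fin 2 → Matrix β β ℂ) (x i)) (![r, fun _ => 1] (x i)) * ud ((![1, U1] : Fin 2 → Matrix β β ℂ) (x i)) (![fun _ => 1, p] (x i))).trace = 1 := by
      intro i; generalize x i = y
      fin_cases y
      · have : ud (1 : Matrix β β ℂ) (fun _ => 1) = 1 := ud_one (one_mem _)
        simp [← ht, this, hτ.2]
      · simp [ud_one hU0, ← h1, hσ1.2]
    simp [this]
  rw [mul_smul_comm, rtr_smul, rtr_comm P (tens _)] at g5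
  rw [mul_smul_comm, rtr_smul, e3, mul_one] at g6
  rw [e2, sub_eq_add_neg, Real.exp_add]
  refine g5.trans ?_
  rw [← mul_assoc m]
  exact mul_le_mul_of_nonneg_left g6 (mul_nonneg hDp (Real.exp_pos A).le)

end Tests
end CovertPaper

end

end

section
open Matrix Filter
open scoped Kronecker Classical ComplexOrder MatrixOrder

noncomputable section
set_option linter.unusedSectionVars false
set_option linter.unusedVariables false

namespace CovertPaper

section Cont
variable {β : Type*} [Fintype β] [DecidableEq β]

lemma neg_mul_log_le {t : ℝ} (h0 : 0 ≤ t) : -(t * Real.log t) ≤ 2 * Real.sqrt t := by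
  rcases h0.eq_or_lt with rfl | h
  · simp
  have hs := Real.sqrt_pos.2 h
  have h1 := Real.log_le_sub_one_of_pos (inv_pos.2 hs)
  rw [Real.log_inv, Real.log_sqrt h.le] at h1
  have h2 : t * (Real.sqrt t)⁻¹ = Real.sqrt t := by
    nth_rewrite 1 [← Real.mul_self_sqrt h.le]
    rw [mul_assoc, mul_inv_cancel₀ hs.ne', mul_one]
  nlinarith

/-- Continuity bound for the relative entropy with respect to an i.i.d. state. -/
lemma covert_cont {ω0 : Matrix β β ℂ} (h0 : IsDensity ω0) [Nonempty β] :
    ∃ K : ℝ, 0 ≤ K ∧ ∀ (n : ℕ) (τ1 : Matrix β β ℂ), IsDensity τ1 → SuppLE τ1 ω0 →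
      ∀ ρ : Matrix (Fin n → β) (Fin n → β) ℂ, IsDensity ρ → ∀ δ, δ ≤ 1 →
      traceNorm (ρ - tpow τ1 n) ≤ δ →
      relEnt ρ (tpow ω0 n) ≤ n * relEnt τ1 ω0 + n * K * δ + 6 * Real.sqrt δ := by
  obtain ⟨U, hU, q, hq, hω⟩ := exists_ud_psd h0.1
  have hq1 : ∀ b, q b ≤ 1 := fun b => by
    have hs : ∑ b, q b = 1 := by rw [← rtr_ud hU, ← hω, rtr_density h0]
    rw [← hs]; exact Finset.single_le_sum (fun b _ => hq b) (Finset.mem_univ b)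
  obtain ⟨Λ, hΛ⟩ : ∃ Λ : ℝ, Λ = ∑ b, |Real.log (q b)| := ⟨_, rfl⟩
  have hΛ0 : 0 ≤ Λ := by rw [hΛ]; exact Finset.sum_nonneg fun _ _ => abs_nonneg _
  have hΛb : ∀ b, - Λ ≤ Real.log (q b) := fun b => by
    have := Finset.single_le_sum (fun b (_ : b ∈ Finset.univ) => abs_nonneg (Real.log (q b))) (Finset.mem_univ b)
    rw [← hΛ] at this
    linarith [neg_abs_le (Real.log (q b))]
  have hcard : 0 ≤ Real.log (Fintype.card β) := Real.log_natCast_nonneg _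
  refine ⟨Real.log (Fintype.card β) + Λ, by linarith, fun n τ1 hτ1 hs ρ hρ δ hδ1 hδ => ?_⟩
  have hτ := tpow_density hτ1 n
  obtain ⟨P, N, hP, hN, hPN, htr⟩ := exists_parts (hρ.1.1.sub hτ.1.1)
  have htt : rtr P = rtr N := by
    have : rtr (ρ - tpow τ1 n) = 0 := by rw [rtr_sub, rtr_density hρ, rtr_density hτ, sub_self]
    rw [hPN, rtr_sub] at this; linarith
  obtain ⟨t, ht⟩ : ∃ t, t = rtr P := ⟨_, rfl⟩
  have ht0 : 0 ≤ t := by rw [ht]; exact rtr_nonneg hP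
  have htδ : t ≤ δ := by rw [← htt, ← ht] at htr; linarith
  have hθ : tpow ω0 n = ud (tens fun _ => U) (fun b => ∏ i, q (b i)) := by
    rw [tpow_eq, hω, tens_ud (fun _ => U) (fun _ => q)]
  have hUn : tens (fun _ : Fin n => U) ∈ unitaryGroup (Fin n → β) ℂ := tens_unitary fun _ => hU
  have hlog : matLog (tpow ω0 n) = ud (tens fun _ => U) (fun b => Real.log (∏ i, q (b i))) := by
    rw [hθ, matLog_ud hUn]
  have hlog_le : matLog (tpow ω0 n) ≤ 0 := by
    rw [hlog, show (0 : Matrix (Fin n → β) (Fin n → β) ℂ) = ud (tens fun _ => U) (fun _ => 0) by rw [ud_const hUn]; simp]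
    apply ud_le
    intro b
    exact Real.log_nonpos (Finset.prod_nonneg fun i _ => hq _) (Finset.prod_le_one (fun i _ => hq _) fun i _ => hq1 _)
  have hlog_ge : ((-(n * Λ) : ℝ) : ℂ) • 1 ≤ matLog (tpow ω0 n) := by
    rw [hlog, ← ud_const hUn]
    apply ud_le
    intro b
    by_cases hz : ∏ i, q (b i) = 0
    · rw [hz, Real.log_zero]; have : 0 ≤ n * Λ := by positivity
      linarith
    · rw [Real.log_prod fun i hi => Finset.prod_ne_zero_iff.1 hz i hi]
      calc -(n * Λ) = ∑ i : Fin n, (-Λ) := by simp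
        _ ≤ _ := Finset.sum_le_sum fun i _ => hΛb _
  have c1 : rtr (N * matLog (tpow ω0 n)) ≤ 0 := by
    have := rtr_mul_mono hN hlog_le; rwa [mul_zero, rtr_zero] at this
  have c2 : -(n * Λ) * t ≤ rtr (P * matLog (tpow ω0 n)) := by
    have := rtr_mul_mono hP hlog_ge; rwa [mul_smul_comm, rtr_smul, mul_one, ← ht] at this
  have hsum : ρ + N = tpow τ1 n + P := by
    have := hPN; rw [sub_eq_iff_eq_add] at this; rw [this]; abel
  have c3 := vnEnt_add_le hρ.1 hN
  have c4 := vnEnt_add_ge hτ.1 hP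
  rw [hsum] at c3
  rw [rtr_density hτ, ← ht] at c4
  have c5 := vnEnt_le_dim hN
  rw [← htt, ← ht, Fintype.card_fun, Fintype.card_fin, Nat.cast_pow, Real.log_pow] at c5
  have c6 := vnEnt_nonneg hP (by rw [← ht]; linarith)
  have hρ' : ρ = tpow τ1 n + P - N := by rw [← hsum]; abel
  have c7 : rtr (ρ * matLog (tpow ω0 n)) = rtr (tpow τ1 n * matLog (tpow ω0 n)) + rtr (P * matLog (tpow ω0 n)) - rtr (N * matLog (tpow ω0 n)) := by
    rw [hρ', sub_mul, add_mul, rtr_sub, rtr_add]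
  have c8 : - vnEnt (tpow τ1 n) - rtr (tpow τ1 n * matLog (tpow ω0 n)) = n * relEnt τ1 ω0 := by
    rw [tpow_eq, tpow_eq, vnEnt_tens fun _ => hτ1, cross_tens (fun _ => hτ1) (fun _ => h0.1) (fun _ => hs), relEnt_eq]
    simp only [Finset.sum_const, Finset.card_univ, Fintype.card_fin, nsmul_eq_mul, rtr]
    ring
  have c9 : relEnt ρ (tpow ω0 n) = - vnEnt ρ - rtr (ρ * matLog (tpow ω0 n)) := relEnt_eq _ _
  have c10 := neg_mul_log_le ht0
  have ht1 : t ≤ 1 := by linarith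
  have c11 : (1 + t) * Real.log (1 + t) ≤ 2 * Real.sqrt t := by
    have h1 : Real.log (1 + t) ≤ t := by
      have := Real.log_le_sub_one_of_pos (show 0 < 1 + t by linarith); linarith
    have h2 : t ≤ Real.sqrt t := Real.le_sqrt_of_sq_le (by nlinarith)
    have h3 : (1 + t) * Real.log (1 + t) ≤ (1 + t) * t := mul_le_mul_of_nonneg_left h1 (by linarith)
    nlinarith
  have c12 : Real.sqrt t ≤ Real.sqrt δ := Real.sqrt_le_sqrt htδ
  have c13 : n * (Real.log (Fintype.card β) + Λ) * t ≤ n * (Real.log (Fintype.card β) + Λ) * δ := by gcongr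
  rw [c9, c7]
  simp only [Real.log_one, mul_zero] at c4
  linarith

end Cont
end CovertPaper

end

end

section
open Matrix Filter
open scoped Kronecker Classical ComplexOrder MatrixOrder

noncomputable section
set_option linter.unusedSectionVars false
set_option linter.unusedVariables false

namespace CovertPaper

section TN
variable {ι : Type*} [Fintype ι] [DecidableEq ι]

lemma rtr_sign_le {S A : Matrix ι ι ℂ} (hS : S.IsHermitian) (hS2 : S * S = 1) (hA : A.IsHermitian) :
    rtr (S * A) ≤ traceNorm A := by
  obtain ⟨P, N, hP, hN, h1, h2⟩ := exists_parts hA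
  rw [← h2]
  nth_rewrite 1 [h1]
  have a1 := rtr_mul_nonneg (one_add_sign_psd hS hS2) hN
  have a2 := rtr_mul_nonneg (one_add_sign_psd hS.neg (by rw [neg_mul_neg, hS2])) hP
  rw [add_mul, one_mul, rtr_add] at a1
  rw [add_mul, one_mul, rtr_add, neg_mul, rtr_neg] at a2
  rw [mul_sub, rtr_sub]
  linarith

lemma traceNorm_avg {κ : Type*} [Fintype κ] {c : ℝ} (hc : 0 ≤ c) {A : κ → Matrix ι ι ℂ} (hA : ∀ k, (A k).IsHermitian) :
    traceNorm ((c:ℂ) • ∑ k, A k) ≤ c * ∑ k, traceNorm (A k) := by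
  have hch : ((c:ℂ) • ∑ x, A x).IsHermitian := by
    rw [Matrix.IsHermitian, conjTranspose_smul, conjTranspose_sum]
    simp only [(hA _).eq, Complex.star_def, Complex.conj_ofReal]
  obtain ⟨S, hS, hS2, h⟩ := exists_sign hch
  rw [h, mul_smul_comm, rtr_smul, Finset.mul_sum, rtr_sum]
  gcongr with k
  exact rtr_sign_le hS hS2 (hA k)

end TN

section Asym
variable {β : Type*} [Fintype β] [DecidableEq β]

lemma mean_state (σ : Fin 2 → Matrix β β ℂ) (α : ℝ) (n : ℕ) :
    ∑ x : Fin n → Fin 2, ((cb (pw α) x : ℝ) : ℂ) • tens (fun i => σ (x i)) = tpow (mixS (σ 1) (σ 0) α) n := by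
  rw [tpow_eq]
  have : (fun _ : Fin n => mixS (σ 1) (σ 0) α) = fun _ : Fin n => ∑ y, ((pw α y : ℝ) : ℂ) • σ y := by
    funext i
    rw [Fin.sum_univ_two, mixS]
    simp only [pw, Matrix.cons_val_zero, Matrix.cons_val_one]
    rw [add_comm]
  rw [this, tens_sum (fun _ y => ((pw α y : ℝ) : ℂ) • σ y)]
  refine Finset.sum_congr rfl fun x _ => ?_
  rw [tens_smul (fun i => pw α (x i)) (fun i => σ (x i)), cb]

lemma fam_two {p : Matrix β β ℂ → Prop} {a b : Matrix β β ℂ} (ha : p a) (hb : p b) :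
    ∀ y, p ((![a, b] : Fin 2 → Matrix β β ℂ) y) := by
  intro y; fin_cases y
  · exact ha
  · exact hb

lemma willie_asym {ω : Fin 2 → Matrix β β ℂ} (hω : ∀ y, IsDensity (ω y)) (hs : SuppLE (ω 1) (ω 0)) {η : ℝ} (hη : 0 < η) :
    ∃ c > 0, ∀ (n : ℕ) (α : ℝ), 0 ≤ α → α ≤ 1 → ∃ P Q : (Fin n → Fin 2) → Matrix (Fin n → β) (Fin n → β) ℂ,
      (∀ x, (P x).IsHermitian) ∧ (∀ x, P x * P x = P x) ∧ (∀ x, (Q x).IsHermitian) ∧ (∀ x, Q x * Q x = Q x) ∧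
      (∀ x, (Q x * P x) * tens (fun i => ω (x i)) * (Q x * P x)ᴴ ≤
        ((Real.exp (n * α * (relEnt (ω 1) (ω 0) + 2 * η)) : ℝ) : ℂ) • tpow (ω 0) n) ∧
      ∑ x, cb (pw α) x * (rtr (tens (fun i => ω (x i)) * (1 - P x)) + rtr (tens (fun i => ω (x i)) * (1 - Q x))) ≤
        2 * Real.exp (-c * (n * α)) := by
  obtain ⟨U0, hU0, q, hq, h0⟩ := exists_ud_psd (hω 0).1
  obtain ⟨U1, hU1, p, hp, h1⟩ := exists_ud_psd (hω 1).1
  obtain ⟨c1, hc1, t1⟩ := tail_hi hU1 (hω 1) hp (by rw [← h1]; exact suppLE_self _) hη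
  obtain ⟨c2, hc2, t2⟩ := tail_lo hU0 (hω 1) hq (by rw [← h0]; exact hs) hη
  refine ⟨min c1 c2, lt_min hc1 hc2, fun n α ha0 ha1 => ?_⟩
  rw [← h1] at t1
  rw [← h0] at t2
  have r1 := t1 n α ha0 ha1 ![U0, U1] ω (fam_two (p := fun V => V ∈ unitaryGroup β ℂ) hU0 hU1) hω rfl rfl
  have r2 := t2 n α ha0 ha1 ![U0, U0] ω (fam_two (p := fun V => V ∈ unitaryGroup β ℂ) hU0 hU0) hω rfl rfl
  refine ⟨fun x => hiT ![U0, U1] p (n * α * (rtr (ω 1 * matLog (ω 1)) + η)) x, fun x => loT ![U0, U0] q (n * α * (rtr (ω 1 * matLog (ω 0)) - η)) x,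
    fun x => hiT_herm _ _ _ _, fun x => hiT_idem (fam_two (p := fun V => V ∈ unitaryGroup β ℂ) hU0 hU1) _ _ _, fun x => loT_herm _ _ _ _,
    fun x => loT_idem (fam_two (p := fun V => V ∈ unitaryGroup β ℂ) hU0 hU0) _ _ _, fun x => ?_, ?_⟩
  · have := willie_compress hU0 hU1 hq hp h0 h1 (n * α * (rtr (ω 1 * matLog (ω 1)) + η)) (n * α * (rtr (ω 1 * matLog (ω 0)) - η)) x
    refine this.trans (le_of_eq ?_)
    have e : n * α * (rtr (ω 1 * matLog (ω 1)) + η) - n * α * (rtr (ω 1 * matLog (ω 0)) - η) = n * α * (relEnt (ω 1) (ω 0) + 2 * η) := by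
      have : relEnt (ω 1) (ω 0) = rtr (ω 1 * matLog (ω 1)) - rtr (ω 1 * matLog (ω 0)) := by
        unfold relEnt; rw [mul_sub, ← rtr_sub]; rfl
      rw [this]; ring
    rw [e, tpow_eq]
  · simp only [mul_add, Finset.sum_add_distrib]
    have hna : 0 ≤ n * α := by positivity
    have m1 : Real.exp (-c1 * (n * α)) ≤ Real.exp (-(min c1 c2) * (n * α)) := by
      apply Real.exp_le_exp.2; have := min_le_left c1 c2; nlinarith
    have m2 : Real.exp (-c2 * (n * α)) ≤ Real.exp (-(min c1 c2) * (n * α)) := by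
      apply Real.exp_le_exp.2; have := min_le_right c1 c2; nlinarith
    simp only [← mul_add]
    simp only [mul_add] at r1 r2 ⊢
    linarith

lemma bob_asym {σ : Fin 2 → Matrix β β ℂ} (hσ : ∀ y, IsDensity (σ y)) (hs : SuppLE (σ 1) (σ 0)) {η : ℝ} (hη : 0 < η) :
    ∃ c > 0, ∃ D : ℝ, 0 ≤ D ∧ ∀ (n : ℕ) (α : ℝ), 0 ≤ α → α ≤ 1 → ∃ T : (Fin n → Fin 2) → Matrix (Fin n → β) (Fin n → β) ℂ,
      (∀ x, (T x).PosSemidef) ∧ (∀ x, T x ≤ 1) ∧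
      ∑ x, cb (pw α) x * rtr (tens (fun i => σ (x i)) * (1 - T x)) ≤ 5 * Real.exp (-c * (n * α)) ∧
      ∑ x, cb (pw α) x * ∑ y, cb (pw α) y * rtr (tens (fun i => σ (x i)) * T y) ≤
        Real.exp (D * (n * α ^ 2)) * Real.exp (- (n * α * (relEnt (σ 1) (σ 0) - 2 * η))) := by
  obtain ⟨U0, hU0, q, hq, h0⟩ := exists_ud_psd (hσ 0).1
  obtain ⟨U1, hU1, p, hp, h1⟩ := exists_ud_psd (hσ 1).1
  obtain ⟨c1, hc1, t1⟩ := tail_hi hU0 (hσ 1) hq (by rw [← h0]; exact hs) hη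
  obtain ⟨c2, hc2, t2⟩ := tail_lo hU1 (hσ 1) hp (by rw [← h1]; exact suppLE_self _) hη
  obtain ⟨D, hD, hDle⟩ := exists_le_of_suppLE (hσ 1).1 (hσ 0).1 hs
  refine ⟨min c1 c2, lt_min hc1 hc2, D, hD, fun n α ha0 ha1 => ?_⟩
  rw [← h0] at t1
  rw [← h1] at t2
  have hτ := mixS_density (hσ 1) (hσ 0) ha0 ha1
  obtain ⟨τ, hτe⟩ : ∃ τ, τ = mixS (σ 1) (σ 0) α := ⟨_, rfl⟩
  rw [← hτe] at hτ
  obtain ⟨Ut, hUt, r, hr, ht⟩ := exists_ud_psd hτ.1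
  have u1 := fam_two (p := fun V => V ∈ unitaryGroup β ℂ) hUt hU0
  have u2 := fam_two (p := fun V => V ∈ unitaryGroup β ℂ) (one_mem _) hU1
  have r1 := t1 n α ha0 ha1 ![Ut, U0] σ u1 hσ rfl rfl
  have r2 := t2 n α ha0 ha1 ![1, U1] σ u2 hσ rfl rfl
  obtain ⟨A, hA⟩ : ∃ A : ℝ, A = n * α * (rtr (σ 1 * matLog (σ 0)) + η) := ⟨_, rfl⟩
  obtain ⟨A', hA'⟩ : ∃ A' : ℝ, A' = n * α * (rtr (σ 1 * matLog (σ 1)) - η) := ⟨_, rfl⟩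
  rw [← hA] at r1
  rw [← hA'] at r2
  have hst := fun x : Fin n → Fin 2 => seq_test (loT_herm ![1, U1] p A' x) (loT_idem u2 p A' x) (hiT_herm ![Ut, U0] q A x) (hiT_idem u1 q A x)
  refine ⟨fun x => hiT ![Ut, U0] q A x * loT ![1, U1] p A' x * hiT ![Ut, U0] q A x, fun x => (hst x).1, fun x => (hst x).2.1, ?_, ?_⟩
  · have hna : 0 ≤ n * α := by positivity
    have m1 : Real.exp (-c1 * (n * α)) ≤ Real.exp (-(min c1 c2) * (n * α)) := by
      apply Real.exp_le_exp.2; have := min_le_left c1 c2; nlinarith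
    have m2 : Real.exp (-c2 * (n * α)) ≤ Real.exp (-(min c1 c2) * (n * α)) := by
      apply Real.exp_le_exp.2; have := min_le_right c1 c2; nlinarith
    calc ∑ x : Fin n → Fin 2, cb (pw α) x * rtr (tens (fun i => σ (x i)) * (1 - hiT ![Ut, U0] q A x * loT ![1, U1] p A' x * hiT ![Ut, U0] q A x))
        ≤ ∑ x : Fin n → Fin 2, cb (pw α) x * (3 * rtr (tens (fun i => σ (x i)) * (1 - hiT ![Ut, U0] q A x)) + 2 * rtr (tens (fun i => σ (x i)) * (1 - loT ![1, U1] p A' x))) := by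
          refine Finset.sum_le_sum fun x _ => mul_le_mul_of_nonneg_left ?_ (cb_nonneg (pw_nonneg ha0 ha1) x)
          have := rtr_mul_mono (tens_density fun i => hσ (x i)).1 (hst x).2.2
          have e3 : (3:ℂ) = ((3:ℝ):ℂ) := by norm_num
          have e2 : (2:ℂ) = ((2:ℝ):ℂ) := by norm_num
          rw [mul_add, rtr_add, mul_smul_comm, mul_smul_comm, e3, e2, rtr_smul, rtr_smul] at this
          exact this
      _ = 3 * ∑ x : Fin n → Fin 2, cb (pw α) x * rtr (tens (fun i => σ (x i)) * (1 - hiT ![Ut, U0] q A x)) +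
          2 * ∑ x : Fin n → Fin 2, cb (pw α) x * rtr (tens (fun i => σ (x i)) * (1 - loT ![1, U1] p A' x)) := by
          rw [Finset.mul_sum, Finset.mul_sum, ← Finset.sum_add_distrib]
          exact Finset.sum_congr rfl fun _ _ => by ring
      _ ≤ _ := by linarith
  · have hle : τ ≤ ((1 + D * α : ℝ) : ℂ) • σ 0 := by
      apply le_of_psd_sub
      have e : ((1 + D * α : ℝ) : ℂ) • σ 0 - τ = (α : ℂ) • ((D : ℂ) • σ 0 - σ 1) + (α : ℂ) • σ 0 := by
        rw [hτe, mixS]; push_cast; module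
      rw [e]
      exact (psd_ofReal_smul ha0 (Matrix.le_iff.1 hDle)).add (psd_ofReal_smul ha0 (hσ 0).1)
    have hD1 : 0 ≤ 1 + D * α := by positivity
    have hb := fun y : Fin n → Fin 2 => bob_second hU0 hU1 hUt hq hp hr h0 h1 ht (hσ 1) hτ hD1 hle A A' y
    obtain ⟨T, hT⟩ : ∃ T : (Fin n → Fin 2) → Matrix (Fin n → β) (Fin n → β) ℂ, T = fun y => hiT ![Ut, U0] q A y * loT ![1, U1] p A' y * hiT ![Ut, U0] q A y := ⟨_, rfl⟩
    have hb' : ∀ y : Fin n → Fin 2, rtr (tens (fun _ => τ) * T y) ≤ (∏ i, ![1, 1 + D * α] (y i)) * Real.exp (A - A') := fun y => by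
      rw [hT]; exact hb y
    have hmean : ∀ y, ∑ x : Fin n → Fin 2, cb (pw α) x * rtr (tens (fun i => σ (x i)) * T y) = rtr (tens (fun _ => τ) * T y) := by
      intro y
      have := mean_state σ α n
      rw [← hτe, tpow_eq] at this
      rw [← this, Finset.sum_mul, rtr_sum]
      refine Finset.sum_congr rfl fun x _ => ?_
      rw [smul_mul_assoc, rtr_smul]
    have hAA : A - A' = - (n * α * (relEnt (σ 1) (σ 0) - 2 * η)) := by
      have : relEnt (σ 1) (σ 0) = rtr (σ 1 * matLog (σ 1)) - rtr (σ 1 * matLog (σ 0)) := by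
        unfold relEnt; rw [mul_sub, ← rtr_sub]; rfl
      rw [this, hA, hA']; ring
    have key : ∑ x : Fin n → Fin 2, cb (pw α) x * ∑ y, cb (pw α) y * rtr (tens (fun i => σ (x i)) * T y) ≤
        Real.exp (D * (n * α ^ 2)) * Real.exp (A - A') := by
      calc ∑ x : Fin n → Fin 2, cb (pw α) x * ∑ y, cb (pw α) y * rtr (tens (fun i => σ (x i)) * T y)
          = ∑ y, cb (pw α) y * ∑ x : Fin n → Fin 2, cb (pw α) x * rtr (tens (fun i => σ (x i)) * T y) := by
            simp only [Finset.mul_sum]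
            rw [Finset.sum_comm]
            exact Finset.sum_congr rfl fun _ _ => Finset.sum_congr rfl fun _ _ => by ring
        _ ≤ ∑ y : Fin n → Fin 2, cb (pw α) y * ((∏ i, ![1, 1 + D * α] (y i)) * Real.exp (A - A')) := by
            refine Finset.sum_le_sum fun y _ => mul_le_mul_of_nonneg_left ?_ (cb_nonneg (pw_nonneg ha0 ha1) y)
            rw [hmean]; exact hb' y
        _ = (∑ y : Fin n → Fin 2, ∏ i, (pw α (y i) * ![1, 1 + D * α] (y i))) * Real.exp (A - A') := by
            rw [Finset.sum_mul]
            refine Finset.sum_congr rfl fun y _ => ?_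
            rw [Finset.prod_mul_distrib, cb]; ring
        _ ≤ _ := by
            gcongr
            rw [sum_prod_all (fun _ z => pw α z * ![1, 1 + D * α] z), Finset.prod_const, Finset.card_univ, Fintype.card_fin, Fin.sum_univ_two]
            simp only [pw, Matrix.cons_val_zero, Matrix.cons_val_one]
            have e1 : (1 - α) * 1 + α * (1 + D * α) = D * α ^ 2 + 1 := by ring
            rw [e1]
            calc (D * α ^ 2 + 1) ^ n ≤ (Real.exp (D * α ^ 2)) ^ n :=
                  pow_le_pow_left₀ (by positivity) (Real.add_one_le_exp _) n
              _ = _ := by rw [← Real.exp_nat_mul]; ring_nf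
    rw [hAA, hT] at key
    exact key

end Asym
end CovertPaper

end

end

section
open Matrix Filter
open scoped Kronecker Classical ComplexOrder MatrixOrder

noncomputable section
set_option linter.unusedSectionVars false
set_option linter.unusedVariables false

namespace CovertPaper

section Code
variable {B W : Type*} [Fintype B] [DecidableEq B] [Fintype W] [DecidableEq W]

lemma traceNorm_nonneg_herm {ι : Type*} [Fintype ι] [DecidableEq ι] {A : Matrix ι ι ℂ} (hA : A.IsHermitian) : 0 ≤ traceNorm A := by
  have h1 := traceNorm_ge hA
  have h2 := rtr_sign_le (S := 1) Matrix.isHermitian_one (by simp) hA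
  rw [one_mul] at h2
  linarith

lemma code_finite {π : Fin 2 → Matrix (B × W) (B × W) ℂ} (hπ : ∀ x, IsDensity (π x)) [Nonempty W]
    {n M L : ℕ} (hM : 1 ≤ M) (hL : 1 ≤ L) {α : ℝ} (hα0 : 0 ≤ α) (hα1 : α ≤ 1)
    {T : (Fin n → Fin 2) → Matrix (Fin n → B) (Fin n → B) ℂ} (hT : ∀ x, (T x).PosSemidef) (hT1 : ∀ x, T x ≤ 1)
    {e1 e2 z ε τ a u s t : ℝ} (hz : 0 < z) (hε : 0 < ε) (hτ : 0 < τ)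
    (he1 : ∑ x, cb (pw α) x * rtr (tens (fun i => bobOut π (x i)) * (1 - T x)) ≤ e1)
    (he2 : ∑ x, cb (pw α) x * ∑ y, cb (pw α) y * rtr (tens (fun i => bobOut π (x i)) * T y) ≤ e2)
    {P Q : (Fin n → Fin 2) → Matrix (Fin n → W) (Fin n → W) ℂ}
    (hP : ∀ x, (P x).IsHermitian) (hP2 : ∀ x, P x * P x = P x)
    (hQ : ∀ x, (Q x).IsHermitian) (hQ2 : ∀ x, Q x * Q x = Q x)
    (ha : 0 < a) (hs : 0 < s) (ht : 0 < t)
    (hle : ∀ x, (Q x * P x) * tens (fun i => willieOut π (x i)) * (Q x * P x)ᴴ ≤ (a:ℂ) • tpow (willieOut π 0) n)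
    (hu : ∑ x, cb (pw α) x * (rtr (tens (fun i => willieOut π (x i)) * (1 - P x)) +
      rtr (tens (fun i => willieOut π (x i)) * (1 - Q x))) ≤ u)
    (hB : 2 * e1 + 4 * ((M:ℝ) * L) * e2 + 4 * z ≤ ε / 2)
    (hW : 2 * (s + u / s + u) + t + a * (L:ℝ)⁻¹ / (2 * t) ≤ τ / 2) :
    ∃ (f : Fin M → Fin L → Fin 1 → Fin n → Fin 2)
      (Λ : Fin 1 → Fin M → Fin L → Matrix (Fin n → B) (Fin n → B) ℂ),
      IsPOVM (B := B) Λ ∧ avgErr π f Λ ≤ ε ∧ IsDensity (willieAvg π f) ∧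
      (M:ℝ)⁻¹ * ∑ m, traceNorm (willieMsg π f m - tpow (mixS (willieOut π 1) (willieOut π 0) α) n) ≤ τ ∧
      traceNorm (willieAvg π f - tpow (mixS (willieOut π 1) (willieOut π 0) α) n) ≤ τ := by
  have hMr : (1:ℝ) ≤ M := by exact_mod_cast hM
  have hMne : (M:ℝ) ≠ 0 := by positivity
  have hLr : (1:ℝ) ≤ L := by exact_mod_cast hL
  have hLne : (L:ℝ) ≠ 0 := by positivity
  have hBd := bobOut_density hπ
  have hWd := willieOut_density hπ
  obtain ⟨θ, hθ⟩ : ∃ θ, θ = tpow (mixS (willieOut π 1) (willieOut π 0) α) n := ⟨_, rfl⟩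
  have hθd : IsDensity θ := by rw [hθ]; exact tpow_density (mixS_density (hWd 1) (hWd 0) hα0 hα1) n
  rw [← hθ]
  obtain ⟨c, hc⟩ : ∃ c : ℝ, c = ((M : ℝ) * L * (1 : ℕ))⁻¹ := ⟨_, rfl⟩
  have hc' : c = (M:ℝ)⁻¹ * (L:ℝ)⁻¹ := by rw [hc]; push_cast; rw [mul_one, mul_inv]
  have hcard : c * Fintype.card (Fin M × Fin L) = 1 := by
    rw [hc']; simp; field_simp
  have hcM : (M:ℝ)⁻¹ * Fintype.card (Fin M) = 1 := by simp [hMne]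
  have hcL : (L:ℝ)⁻¹ * Fintype.card (Fin L) = 1 := by simp [hLne]
  have hp : ∀ x : Fin n → Fin 2, 0 ≤ cb (pw α) x := cb_nonneg (pw_nonneg hα0 hα1)
  have h1 : ∑ x : Fin n → Fin 2, cb (pw α) x = 1 := cb_sum (pw_sum α)
  have hmean : ∑ x : Fin n → Fin 2, ((cb (pw α) x : ℝ) : ℂ) • tens (fun i => willieOut π (x i)) = θ := by
    rw [hθ]; exact mean_state (willieOut π) α n
  obtain ⟨Λ, hΛ1, hΛ2, hΛ3⟩ := bob_oneshot (κ := Fin M × Fin L) hp h1 (ρ := fun x => tens (fun i => bobOut π (x i)))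
    (fun x => tens_density fun i => hBd _) hT hT1 hz hcard he1 he2
  have hcov : ∀ m : Fin M, ∑ C : Fin M × Fin L → (Fin n → Fin 2), cb (cb (pw α)) C *
      traceNorm ((((L:ℝ)⁻¹ : ℝ):ℂ) • ∑ l, tens (fun i => willieOut π (C (m, l) i)) - θ) ≤ τ / 2 := by
    intro m
    have := cover_oneshot hp h1 (ρ := fun x => tens (fun i => willieOut π (x i))) (fun x => tens_density fun i => hWd _)
      hP hP2 hQ hQ2 (tpow_density (hWd 0) n) ha hs ht hle hu (e := fun l : Fin L => (m, l))
      (fun l l' h => (Prod.mk.inj h).2) hcL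
    rw [hmean] at this
    exact this.trans hW
  have hΛ3' : ∑ C : Fin M × Fin L → (Fin n → Fin 2), cb (cb (pw α)) C *
      (c * ∑ k, (1 - rtr (Λ C k * tens (fun i => bobOut π (C k i))))) ≤ ε / 2 := by
    refine hΛ3.trans (le_trans (le_of_eq ?_) hB)
    simp
  obtain ⟨E, hE⟩ : ∃ E : (Fin M × Fin L → (Fin n → Fin 2)) → ℝ, E = fun C =>
    c * ∑ k, (1 - rtr (Λ C k * tens (fun i => bobOut π (C k i)))) := ⟨_, rfl⟩
  obtain ⟨G, hG⟩ : ∃ G : (Fin M × Fin L → (Fin n → Fin 2)) → Fin M → ℝ, G = fun C m =>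
    traceNorm ((((L:ℝ)⁻¹ : ℝ):ℂ) • ∑ l, tens (fun i => willieOut π (C (m, l) i)) - θ) := ⟨_, rfl⟩
  have hmd : ∀ (C : Fin M × Fin L → (Fin n → Fin 2)) (m : Fin M),
      IsDensity ((((L:ℝ)⁻¹ : ℝ):ℂ) • ∑ l, tens (fun i => willieOut π (C (m, l) i))) := fun C m =>
    avg_density (fun l => tens_density fun i => hWd _) hcL
  have hherm : ∀ (C : Fin M × Fin L → (Fin n → Fin 2)) (m : Fin M),
      ((((L:ℝ)⁻¹ : ℝ):ℂ) • ∑ l, tens (fun i => willieOut π (C (m, l) i)) - θ).IsHermitian := fun C m =>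
    (hmd C m).1.1.sub hθd.1.1
  have hG0 : ∀ C m, 0 ≤ G C m := fun C m => by rw [hG]; exact traceNorm_nonneg_herm (hherm C m)
  have hE0 : ∀ C, 0 ≤ E C := fun C => by
    rw [hE]
    refine mul_nonneg (c_pos hcard).le (Finset.sum_nonneg fun k _ => ?_)
    have hΛle : Λ C k ≤ 1 :=
      le_trans (Finset.single_le_sum (f := Λ C) (fun j _ => psd_nonneg (hΛ1 C j)) (Finset.mem_univ k))
        (Matrix.le_iff.mpr (hΛ2 C))
    have hd : IsDensity (tens (fun i => bobOut π (C k i))) := tens_density fun i => hBd _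
    have := rtr_mul_mono hd.1 hΛle
    rw [mul_one, rtr_density hd, rtr_comm] at this
    linarith
  obtain ⟨C, hC⟩ := exists_le_avg (p := cb (cb (pw α))) (cb_nonneg hp) (cb_sum h1)
    (fun C : Fin M × Fin L → (Fin n → Fin 2) => ε⁻¹ * E C + τ⁻¹ * ((M:ℝ)⁻¹ * ∑ m, G C m))
  have hsum : ∑ C : Fin M × Fin L → (Fin n → Fin 2), cb (cb (pw α)) C * (ε⁻¹ * E C + τ⁻¹ * ((M:ℝ)⁻¹ * ∑ m, G C m)) ≤ 1 := by
    have e : ∑ C : Fin M × Fin L → (Fin n → Fin 2), cb (cb (pw α)) C * (ε⁻¹ * E C + τ⁻¹ * ((M:ℝ)⁻¹ * ∑ m, G C m)) =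
        ε⁻¹ * (∑ C : Fin M × Fin L → (Fin n → Fin 2), cb (cb (pw α)) C * E C) +
        τ⁻¹ * ((M:ℝ)⁻¹ * ∑ m, ∑ C : Fin M × Fin L → (Fin n → Fin 2), cb (cb (pw α)) C * G C m) := by
      rw [Finset.sum_comm, Finset.mul_sum, Finset.mul_sum, Finset.mul_sum, ← Finset.sum_add_distrib]
      refine Finset.sum_congr rfl fun C _ => ?_
      rw [← Finset.mul_sum]; ring
    rw [e]
    have i1 : ε⁻¹ * (∑ C : Fin M × Fin L → (Fin n → Fin 2), cb (cb (pw α)) C * E C) ≤ ε⁻¹ * (ε / 2) := by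
      refine mul_le_mul_of_nonneg_left ?_ (inv_pos.2 hε).le
      rw [hE]; exact hΛ3'
    have i2 : (M:ℝ)⁻¹ * ∑ m, ∑ C : Fin M × Fin L → (Fin n → Fin 2), cb (cb (pw α)) C * G C m ≤ τ / 2 := by
      have : ∑ m, ∑ C : Fin M × Fin L → (Fin n → Fin 2), cb (cb (pw α)) C * G C m ≤ ∑ m : Fin M, τ / 2 := by
        refine Finset.sum_le_sum fun m _ => ?_
        rw [hG]; exact hcov m
      refine (mul_le_mul_of_nonneg_left this (inv_nonneg.2 (by positivity))).trans (le_of_eq ?_)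
      simp; field_simp
    have i3 := mul_le_mul_of_nonneg_left i2 (inv_pos.2 hτ).le
    have j1 : ε⁻¹ * (ε / 2) = 1 / 2 := by field_simp
    have j2 : τ⁻¹ * (τ / 2) = 1 / 2 := by field_simp
    linarith
  have hC1 := hC.trans hsum
  have hGs : 0 ≤ (M:ℝ)⁻¹ * ∑ m, G C m := mul_nonneg (inv_nonneg.2 (by positivity)) (Finset.sum_nonneg fun m _ => hG0 C m)
  have hEC : E C ≤ ε := by
    have : ε⁻¹ * E C ≤ 1 := by
      have := mul_nonneg (inv_pos.2 hτ).le hGs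
      linarith
    rwa [inv_mul_le_iff₀ hε, mul_one] at this
  have hGC : (M:ℝ)⁻¹ * ∑ m, G C m ≤ τ := by
    have : τ⁻¹ * ((M:ℝ)⁻¹ * ∑ m, G C m) ≤ 1 := by
      have := mul_nonneg (inv_pos.2 hε).le (hE0 C)
      linarith
    rwa [inv_mul_le_iff₀ hτ, mul_one] at this
  obtain ⟨f, hf⟩ : ∃ f : Fin M → Fin L → Fin 1 → Fin n → Fin 2, f = fun m l _ => C (m, l) := ⟨_, rfl⟩
  have hmsg : ∀ m, willieMsg π f m = (((L:ℝ)⁻¹ : ℝ) : ℂ) • ∑ ℓ, tens (fun i => willieOut π (C (m, ℓ) i)) := by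
    intro m; unfold willieMsg willieWord; simp [hf, stringState_eq]
  have havg : willieAvg π f = (c : ℂ) • ∑ k, tens (fun i => willieOut π (C k i)) := by
    unfold willieAvg willieWord
    rw [Fintype.sum_prod_type, ← hc]; simp [hf, stringState_eq]
  have havg2 : willieAvg π f = (((M:ℝ)⁻¹ : ℝ) : ℂ) • ∑ m, willieMsg π f m := by
    rw [havg, Fintype.sum_prod_type, hc', Complex.ofReal_mul, mul_smul]
    congr 1
    rw [Finset.smul_sum]
    exact Finset.sum_congr rfl fun m _ => (hmsg m).symm
  have hsec : (M:ℝ)⁻¹ * ∑ m, traceNorm (willieMsg π f m - θ) ≤ τ := by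
    refine le_trans (le_of_eq ?_) hGC
    rw [hG]
    simp only [hmsg]
  refine ⟨f, fun _ m l => Λ C (m, l), ⟨fun k m l => hΛ1 C _, fun k => ?_⟩, ?_, ?_, hsec, ?_⟩
  · rw [← Fintype.sum_prod_type (f := fun x => Λ C x)]
    exact hΛ2 C
  · refine le_trans (le_of_eq ?_) hEC
    rw [hE]
    unfold avgErr
    rw [← hc]
    simp only [Fintype.sum_prod_type]
    simp [hf, bobWord, stringState_eq, rtr]
  · rw [havg]; exact avg_density (fun k => tens_density fun i => hWd _) hcard
  · have e : willieAvg π f - θ = (((M:ℝ)⁻¹ : ℝ) : ℂ) • ∑ m, (willieMsg π f m - θ) := by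
      rw [havg2, Finset.sum_sub_distrib, smul_sub]
      congr 1
      rw [Finset.sum_const, Finset.card_univ, Fintype.card_fin, ← Nat.cast_smul_eq_nsmul ℂ, smul_smul]
      have : (((M:ℝ)⁻¹ : ℝ) : ℂ) * (M:ℂ) = 1 := by
        rw [← Complex.ofReal_natCast, ← Complex.ofReal_mul, inv_mul_cancel₀ hMne, Complex.ofReal_one]
      rw [this, one_smul]
    rw [e]
    refine (traceNorm_avg (inv_nonneg.2 (by positivity)) fun m => ?_).trans hsec
    rw [hmsg]; exact hherm C m

end Code

end CovertPaper

end

end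

section
open Matrix Filter
open scoped Kronecker Classical ComplexOrder MatrixOrder

noncomputable section
set_option linter.unusedSectionVars false
set_option linter.unusedVariables false

namespace CovertPaper

lemma ev_exp {k : ℝ} (hk : 0 < k) (A : ℝ) {e : ℝ} (he : 0 < e) :
    ∀ᶠ n : ℕ in atTop, A * Real.exp (-(k * Real.sqrt n)) ≤ e := by
  have h1 : Tendsto (fun n : ℕ => k * Real.sqrt n) atTop atTop := Tendsto.const_mul_atTop hk sqrt_tendsto
  have h2 : Tendsto (fun n : ℕ => A * Real.exp (-(k * Real.sqrt n))) atTop (nhds (A * 0)) :=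
    (Real.tendsto_exp_neg_atTop_nhds_zero.comp h1).const_mul A
  rw [mul_zero] at h2
  exact (h2.eventually (gt_mem_nhds he)).mono fun n h => h.le

lemma ev_exp2 {k : ℝ} (hk : 0 < k) (A : ℝ) :
    ∀ᶠ n : ℕ in atTop, A * Real.exp (-(k * Real.sqrt n)) ≤ (1 / (n:ℝ) ^ 2) / 4 := by
  have h1 : Tendsto (fun n : ℕ => k * Real.sqrt n) atTop atTop := Tendsto.const_mul_atTop hk sqrt_tendsto
  have h2 : Tendsto (fun n : ℕ => (4 * A / k ^ 4) * ((k * Real.sqrt n) ^ 4 * Real.exp (-(k * Real.sqrt n)))) atTop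
      (nhds ((4 * A / k ^ 4) * 0)) :=
    ((Real.tendsto_pow_mul_exp_neg_atTop_nhds_zero 4).comp h1).const_mul _
  rw [mul_zero] at h2
  filter_upwards [h2.eventually (gt_mem_nhds one_pos), eventually_gt_atTop 0] with n hn hn0
  have hn' : (0:ℝ) < n := by exact_mod_cast hn0
  have e4 : (Real.sqrt n) ^ 4 = (n:ℝ) ^ 2 := by
    rw [show (4:ℕ) = 2 * 2 by norm_num, pow_mul, Real.sq_sqrt hn'.le]
  have hx : (4 * A / k ^ 4) * ((k * Real.sqrt n) ^ 4 * Real.exp (-(k * Real.sqrt n))) =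
      (A * Real.exp (-(k * Real.sqrt n))) * (4 * (n:ℝ) ^ 2) := by
    rw [mul_pow, e4]; field_simp
  rw [hx] at hn
  rw [div_div, le_div_iff₀ (by positivity)]
  linarith

section Ach
variable {B W : Type*} [Fintype B] [DecidableEq B] [Fintype W] [DecidableEq W]

lemma ev_relEnt {ω₁ ω₀ : Matrix W W ℂ} [Nonempty W] (h1 : IsDensity ω₁) (h0 : IsDensity ω₀)
    (h : SuppLE ω₁ ω₀) {γ v : ℝ} (hγ : 0 < γ) (hv : 2⁻¹ * chiSq ω₁ ω₀ < v) :
    ∀ᶠ n : ℕ in atTop, (n:ℝ) * relEnt (mixS ω₁ ω₀ (γ / Real.sqrt n)) ω₀ ≤ γ ^ 2 * v := by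
  have ht : Tendsto (fun n : ℕ => γ / Real.sqrt n) atTop (nhdsWithin 0 {0}ᶜ) := by
    refine tendsto_nhdsWithin_iff.2 ⟨sqrt_tendsto.const_div_atTop γ, ?_⟩
    filter_upwards [eventually_gt_atTop 0] with n hn
    have hn' : (0:ℝ) < n := by exact_mod_cast hn
    have := div_pos hγ (Real.sqrt_pos.2 hn')
    exact this.ne'
  have := ((chi_taylor h1 h0 h).comp ht).eventually (gt_mem_nhds hv)
  filter_upwards [this, eventually_gt_atTop 0] with n hlt hn
  have hn' : (0:ℝ) < n := by exact_mod_cast hn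
  simp only [Function.comp] at hlt
  have hp := div_pos hγ (Real.sqrt_pos.2 hn')
  rw [div_lt_iff₀ (by positivity)] at hlt
  have e : (n:ℝ) * (v * (γ / Real.sqrt n) ^ 2) = γ ^ 2 * v := by
    rw [div_pow, Real.sq_sqrt hn'.le]; field_simp
  rw [← e]
  exact mul_le_mul_of_nonneg_left hlt.le hn'.le

lemma ceil_exp {y : ℝ} (hy : 0 ≤ y) : Real.exp y ≤ (⌈Real.exp y⌉₊ : ℝ) ∧ (⌈Real.exp y⌉₊ : ℝ) ≤ 2 * Real.exp y ∧ 1 ≤ ⌈Real.exp y⌉₊ := by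
  have h1 : 1 ≤ Real.exp y := Real.one_le_exp hy
  refine ⟨Nat.le_ceil _, ?_, Nat.one_le_ceil_iff.2 (by positivity)⟩
  have := Nat.ceil_lt_add_one (Real.exp_pos y).le
  linarith

set_option maxHeartbeats 1600000 in
lemma achievability {π : Fin 2 → Matrix (B × W) (B × W) ℂ} (hπ : ∀ x, IsDensity (π x))
    (hσ : SuppLE (bobOut π 1) (bobOut π 0)) (hω : SuppLE (willieOut π 1) (willieOut π 0))
    (hne : willieOut π 1 ≠ willieOut π 0) [Nonempty W] {LS : ℝ} (hLS : 0 < LS)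
    (hlt : LS < (relEnt (bobOut π 1) (bobOut π 0) - relEnt (willieOut π 1) (willieOut π 0)) /
        Real.sqrt (2⁻¹ * chiSq (willieOut π 1) (willieOut π 0))) : AchievableNoKey π LS := by
  refine ⟨hLS, fun ε δcov δsec hε hδc hδs => ?_⟩
  have hBd := bobOut_density hπ
  have hWd := willieOut_density hπ
  have hχ := chi_pos (hWd 1) (hWd 0) hω hne
  have hDW := relEnt_nonneg (hWd 1) (hWd 0) hω
  obtain ⟨χ, hχe⟩ : ∃ χ, χ = 2⁻¹ * chiSq (willieOut π 1) (willieOut π 0) := ⟨_, rfl⟩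
  obtain ⟨DW, hDWe⟩ : ∃ d, d = relEnt (willieOut π 1) (willieOut π 0) := ⟨_, rfl⟩
  obtain ⟨DB, hDBe⟩ : ∃ d, d = relEnt (bobOut π 1) (bobOut π 0) := ⟨_, rfl⟩
  rw [← hDWe] at hDW
  rw [← hDWe, ← hDBe, ← hχe] at hlt
  rw [← hχe] at hχ
  have hsχ := Real.sqrt_pos.2 hχ
  rw [lt_div_iff₀ hsχ] at hlt
  have hΔ : 0 < DB - DW := lt_trans (by positivity) hlt
  have hsδ := Real.sqrt_pos.2 hδc
  -- choose γ
  obtain ⟨γ, hγ1, hγ2⟩ : ∃ γ, Real.sqrt δcov * LS / (DB - DW) < γ ∧ γ < Real.sqrt δcov / Real.sqrt χ := by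
    apply exists_between
    rw [div_lt_div_iff₀ hΔ hsχ, mul_assoc]
    exact mul_lt_mul_of_pos_left hlt hsδ
  have hγ : 0 < γ := lt_trans (by positivity) hγ1
  rw [div_lt_iff₀ hΔ] at hγ1
  rw [lt_div_iff₀ hsχ] at hγ2
  have hγχ : γ ^ 2 * χ < δcov := by
    have := pow_lt_pow_left₀ hγ2 (by positivity) two_ne_zero
    rwa [mul_pow, Real.sq_sqrt hχ.le, Real.sq_sqrt hδc.le] at this
  obtain ⟨v, hv1, hv2⟩ : ∃ v, χ < v ∧ v < δcov / γ ^ 2 := by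
    apply exists_between
    rw [lt_div_iff₀ (by positivity)]; linarith
  rw [lt_div_iff₀ (by positivity)] at hv2
  obtain ⟨η, hη⟩ : ∃ η, η = (γ * (DB - DW) - Real.sqrt δcov * LS) / (6 * γ) := ⟨_, rfl⟩
  have hη0 : 0 < η := by rw [hη]; exact div_pos (by linarith) (by positivity)
  have hηe : 6 * γ * η = γ * (DB - DW) - Real.sqrt δcov * LS := by rw [hη]; field_simp
  obtain ⟨g, hg⟩ : ∃ g, g = Real.sqrt δcov * LS := ⟨_, rfl⟩
  have hg0 : 0 < g := by rw [hg]; positivity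
  rw [← hg] at hηe
  obtain ⟨c, hc, hWil⟩ := willie_asym hWd hω hη0
  obtain ⟨c', hc', D, hD, hBob⟩ := bob_asym hBd hσ hη0
  obtain ⟨K, hK, hcont⟩ := covert_cont (hWd 0)
  have hslack : 0 < δcov - γ ^ 2 * v := by linarith
  have hnn : Tendsto (fun n : ℕ => (K + 6) / (n:ℝ)) atTop (nhds 0) := tendsto_natCast_atTop_atTop.const_div_atTop _
  have hn2 : Tendsto (fun n : ℕ => 1 / (n:ℝ)) atTop (nhds 0) := tendsto_natCast_atTop_atTop.const_div_atTop _
  have hgn : Tendsto (fun n : ℕ => γ / Real.sqrt n) atTop (nhds 0) := sqrt_tendsto.const_div_atTop γ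
  filter_upwards [eventually_gt_atTop 0, hnn.eventually (gt_mem_nhds hslack), hn2.eventually (gt_mem_nhds hδs),
    hgn.eventually (gt_mem_nhds one_pos), ev_relEnt (hWd 1) (hWd 0) hω hγ (hχe ▸ hv1),
    ev_exp2 (k := c * γ / 2) (by positivity) 10, ev_exp2 (k := γ * η / 2) (by positivity) 2,
    ev_exp (k := c' * γ) (by positivity) 10 (e := ε / 8) (by positivity),
    ev_exp (k := γ * η) (by positivity) (16 * Real.exp (D * γ ^ 2)) (e := ε / 8) (by positivity)] with
    n hn0 h1 h2 h3 h4 h5 h6 h7 h8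
  have hn1 : (1:ℝ) ≤ n := by exact_mod_cast hn0
  have hn' : (0:ℝ) < n := by linarith
  obtain ⟨r, hr⟩ : ∃ r, r = Real.sqrt n := ⟨_, rfl⟩
  have hr0 : 0 < r := by rw [hr]; exact Real.sqrt_pos.2 hn'
  have hrr : r ^ 2 = n := by rw [hr]; exact Real.sq_sqrt hn'.le
  rw [← hr] at h3 h4 h5 h6 h7 h8
  obtain ⟨α, hα⟩ : ∃ α, α = γ / r := ⟨_, rfl⟩
  rw [← hα] at h3 h4
  have hα0 : 0 < α := by rw [hα]; positivity
  have hnα : (n:ℝ) * α = γ * r := by rw [hα, ← hrr]; field_simp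
  have hnα2 : (n:ℝ) * α ^ 2 = γ ^ 2 := by rw [hα, ← hrr]; field_simp
  obtain ⟨P, Q, hP, hP2, hQ, hQ2, hle, hu⟩ := hWil n α hα0.le h3.le
  obtain ⟨T, hT, hT1, he1, he2⟩ := hBob n α hα0.le h3.le
  rw [← hDWe] at hle
  rw [← hDBe] at he2
  rw [hnα] at hle hu he1 he2
  rw [hnα2] at he2
  have hM := ceil_exp (y := g * r) (by positivity)
  have hL := ceil_exp (y := γ * r * (DW + 3 * η)) (by positivity)
  obtain ⟨M, hMe⟩ : ∃ M, M = ⌈Real.exp (g * r)⌉₊ := ⟨_, rfl⟩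
  obtain ⟨L, hLe⟩ : ∃ L, L = ⌈Real.exp (γ * r * (DW + 3 * η))⌉₊ := ⟨_, rfl⟩
  rw [← hMe] at hM
  rw [← hLe] at hL
  obtain ⟨hM1, hM2, hM3⟩ := hM
  obtain ⟨hL1, hL2, hL3⟩ := hL
  obtain ⟨τ, hτ⟩ : ∃ τ, τ = 1 / (n:ℝ) ^ 2 := ⟨_, rfl⟩
  have hτ0 : 0 < τ := by rw [hτ]; positivity
  have hτn : τ ≤ 1 / n := by
    rw [hτ]; exact one_div_le_one_div_of_le hn' (by nlinarith)
  have hτ1 : τ ≤ 1 := hτn.trans (by rw [div_le_one hn']; exact hn1)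
  rw [← hτ] at h5 h6
  have hB : 2 * (5 * Real.exp (-c' * (γ * r))) + 4 * ((M:ℝ) * L) *
      (Real.exp (D * γ ^ 2) * Real.exp (-(γ * r * (DB - 2 * η)))) + 4 * (ε / 32) ≤ ε / 2 := by
    have j1 : 2 * (5 * Real.exp (-c' * (γ * r))) ≤ ε / 8 := by
      refine le_trans (le_of_eq ?_) h7
      rw [show -c' * (γ * r) = -(c' * γ * r) by ring]; ring
    have j2 : 4 * ((M:ℝ) * L) * (Real.exp (D * γ ^ 2) * Real.exp (-(γ * r * (DB - 2 * η)))) ≤ ε / 8 := by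
      have k1 : (M:ℝ) * L ≤ (2 * Real.exp (g * r)) * (2 * Real.exp (γ * r * (DW + 3 * η))) :=
        mul_le_mul hM2 hL2 (by positivity) (by positivity)
      have k2 : 4 * ((M:ℝ) * L) * (Real.exp (D * γ ^ 2) * Real.exp (-(γ * r * (DB - 2 * η)))) ≤
          4 * ((2 * Real.exp (g * r)) * (2 * Real.exp (γ * r * (DW + 3 * η)))) *
          (Real.exp (D * γ ^ 2) * Real.exp (-(γ * r * (DB - 2 * η)))) :=
        mul_le_mul_of_nonneg_right (by linarith) (by positivity)
      refine k2.trans (le_trans (le_of_eq ?_) h8)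
      have k3 : Real.exp (-(γ * η * r)) = Real.exp (g * r) * Real.exp (γ * r * (DW + 3 * η)) *
          Real.exp (-(γ * r * (DB - 2 * η))) := by
        rw [← Real.exp_add, ← Real.exp_add]
        congr 1
        linear_combination (-r) * hηe
      rw [k3]; ring
    linarith
  have hWb : 2 * (Real.exp (-(c * γ / 2 * r)) + 2 * Real.exp (-c * (γ * r)) / Real.exp (-(c * γ / 2 * r)) +
      2 * Real.exp (-c * (γ * r))) + Real.exp (-(γ * η / 2 * r)) +
      Real.exp (γ * r * (DW + 2 * η)) * (L:ℝ)⁻¹ / (2 * Real.exp (-(γ * η / 2 * r))) ≤ τ / 2 := by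
    obtain ⟨b, hb⟩ : ∃ b, b = Real.exp (-(c * γ / 2 * r)) := ⟨_, rfl⟩
    obtain ⟨d, hd⟩ : ∃ d, d = Real.exp (-(γ * η / 2 * r)) := ⟨_, rfl⟩
    have hb0 : 0 < b := by rw [hb]; positivity
    have hd0 : 0 < d := by rw [hd]; positivity
    have hb1 : b ≤ 1 := by
      rw [hb]; refine Real.exp_le_one_iff.2 (neg_nonpos.2 (by positivity))
    have hbb : Real.exp (-c * (γ * r)) = b * b := by
      rw [hb, ← Real.exp_add]; congr 1; ring
    have hdd : Real.exp (γ * r * (DW + 2 * η)) = d * d * Real.exp (γ * r * (DW + 3 * η)) := by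
      rw [hd, ← Real.exp_add, ← Real.exp_add]; congr 1; ring
    rw [← hb] at h5 ⊢
    rw [← hd] at h6 ⊢
    rw [hbb, hdd]
    have k1 : 2 * (b * b) / b = 2 * b := by field_simp
    have k2 : d * d * Real.exp (γ * r * (DW + 3 * η)) * (L:ℝ)⁻¹ / (2 * d) ≤ d := by
      have hL0 : (0:ℝ) < L := by exact_mod_cast hL3
      have : d * d * Real.exp (γ * r * (DW + 3 * η)) * (L:ℝ)⁻¹ ≤ d * d * 1 := by
        rw [mul_assoc]
        refine mul_le_mul_of_nonneg_left ?_ (by positivity)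
        rw [← div_eq_mul_inv, div_le_one hL0]; exact hL1
      rw [div_le_iff₀ (by positivity)]
      have k4 := mul_pos hd0 hd0
      linarith
    rw [k1]
    have k3 : b * b ≤ b * 1 := mul_le_mul_of_nonneg_left hb1 hb0.le
    linarith
  obtain ⟨f, Λ, hΛ, herr, hden, hsec, hcov⟩ := code_finite hπ hM3 hL3 hα0.le h3.le hT hT1 (z := ε / 32) (by positivity) hε hτ0
    he1 he2 hP hP2 hQ hQ2 (Real.exp_pos _) (Real.exp_pos _) (Real.exp_pos _) hle hu hB hWb
  refine ⟨M, L, ?_, f, Λ, hΛ, herr, ?_, _, tpow_density (mixS_density (hWd 1) (hWd 0) hα0.le h3.le) n,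
    hsec.trans (hτn.trans h2.le)⟩
  · rw [Real.sqrt_mul hn'.le, ← hr, Real.le_log_iff_exp_le (by exact_mod_cast hM3)]
    refine le_trans (le_of_eq ?_) hM1
    rw [hg]; congr 1; ring
  · have := hcont n _ (mixS_density (hWd 1) (hWd 0) hα0.le h3.le) (mixS_suppLE hω α) _ hden τ hτ1 hcov
    unfold Covert
    refine this.trans ?_
    have k1 : (n:ℝ) * K * τ = K / n := by rw [hτ]; field_simp
    have k2 : Real.sqrt τ = 1 / n := by
      rw [hτ, ← _root_.one_div_pow, Real.sqrt_sq (by positivity)]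
    rw [k1, k2]
    have k3 : (K + 6) / (n:ℝ) = K / n + 6 * (1 / n) := by ring
    linarith

lemma capacity_formula {π : Fin 2 → Matrix (B × W) (B × W) ℂ} (hπ : ∀ x, IsDensity (π x))
    (hσ : SuppLE (bobOut π 1) (bobOut π 0)) (hω : SuppLE (willieOut π 1) (willieOut π 0)) :
    covertSecrecyCapacity π = max 0 (relEnt (bobOut π 1) (bobOut π 0) - relEnt (willieOut π 1) (willieOut π 0)) /
        Real.sqrt (2⁻¹ * chiSq (willieOut π 1) (willieOut π 0)) := by
  by_cases hne : willieOut π 1 = willieOut π 0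
  · rw [degenerate hne, hne, degenerate_chi]; simp
  have hWd := willieOut_density hπ
  have : Nonempty W := by
    by_contra h
    rw [not_nonempty_iff] at h
    have := (hWd 0).2
    simp [Matrix.trace] at this
  have hχ := Real.sqrt_pos.2 (chi_pos (hWd 1) (hWd 0) hω hne)
  obtain ⟨C, hC⟩ : ∃ C, C = max 0 (relEnt (bobOut π 1) (bobOut π 0) - relEnt (willieOut π 1) (willieOut π 0)) /
        Real.sqrt (2⁻¹ * chiSq (willieOut π 1) (willieOut π 0)) := ⟨_, rfl⟩
  have hC0 : 0 ≤ C := by rw [hC]; exact div_nonneg (le_max_left _ _) hχ.le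
  have hup : ∀ LS ∈ {LS : ℝ | AchievableNoKey π LS}, LS ≤ C := fun LS h => by
    rw [hC]; exact converse hπ hσ hω hne h
  rw [← hC]
  unfold covertSecrecyCapacity
  refine le_antisymm (Real.sSup_le hup hC0) ?_
  refine le_of_forall_lt fun y hy => ?_
  rcases lt_or_eq_of_le hC0 with hpos | h0
  · obtain ⟨w, hw1, hw2⟩ := exists_between (max_lt hy hpos)
    have hw0 : 0 < w := lt_of_le_of_lt (le_max_right _ _) hw1
    have hyw : y < w := lt_of_le_of_lt (le_max_left _ _) hw1
    refine lt_of_lt_of_le hyw (le_csSup ⟨C, hup⟩ ?_)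
    have hpos' := hpos
    rw [hC] at hpos'
    have hΔ : 0 < max 0 (relEnt (bobOut π 1) (bobOut π 0) - relEnt (willieOut π 1) (willieOut π 0)) := by
      by_contra hcon
      have := div_nonpos_of_nonpos_of_nonneg (not_lt.1 hcon) hχ.le
      linarith
    have hmax : max 0 (relEnt (bobOut π 1) (bobOut π 0) - relEnt (willieOut π 1) (willieOut π 0)) =
        relEnt (bobOut π 1) (bobOut π 0) - relEnt (willieOut π 1) (willieOut π 0) := by
      rcases lt_max_iff.1 hΔ with h | h
      · exact absurd h (lt_irrefl _)
      · exact max_eq_right h.le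
    refine achievability hπ hσ hω hne hw0 ?_
    rw [hC, hmax] at hw2
    exact hw2
  · refine lt_of_lt_of_le (h0 ▸ hy) (Real.sSup_nonneg fun LS h => ?_)
    exact le_of_lt h.1

end Ach

end CovertPaper

end

end

end Parts

noncomputable section

namespace CovertPaper

variable {ι : Type*} [Fintype ι] [DecidableEq ι]

section Statement2

variable {B W : Type*} [Fintype B] [DecidableEq B] [Fintype W] [DecidableEq W]

/-- **Theorem 3** (unassisted covert secrecy capacity):
`C_S(P) = [D(σ₁‖σ₀) − D(ω₁‖ω₀)]₊ / √((1/2) χ²(ω₁‖ω₀))`. -/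
theorem covert_secrecy_capacity_without_assistance
    (π : Fin 2 → Matrix (B × W) (B × W) ℂ)
    (hπ : ∀ x, IsDensity (π x))
    (hσ : SuppLE (bobOut π 1) (bobOut π 0))
    (hω : SuppLE (willieOut π 1) (willieOut π 0)) :
    covertSecrecyCapacity π =
      max 0 (relEnt (bobOut π 1) (bobOut π 0) - relEnt (willieOut π 1) (willieOut π 0)) /
        Real.sqrt (2⁻¹ * chiSq (willieOut π 1) (willieOut π 0)) := by
  exact capacity_formula hπ hσ hω

end Statement2

end CovertPaper
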